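/- arXiv:0906.1957 — 3 statements merged into one kernel-verified Lean document; each statement's English description precedes it below -/
import Mathlib

section
/- Let c < 0 and θ < 0 be real numbers, and define A₁ := −(cθ)^{1/(2(θ−1))}·√(2/(π(1−θ))), A₂ := (1 − 1/θ)·(cθ)^{1/(1−θ)}·cos(π/(1−θ)), A₃ := (1 − 1/θ)·(cθ)^{1/(1−θ)}·sin(π/(1−θ)), A₄ := π/(2(θ−1)), and μ := θ/(2(θ−1)) − ε for θ ≥ −2 (for an arbitrary fixed ε > 0) and μ := 1/(1−θ) for θ < −2. Then, as z → +∞ along the positive reals, writing L := log z, E(z; c, θ) = A₁·exp(A₂·L^{θ/(θ−1)})·L^{θ/(2(1−θ))}·cos(A₃·L^{θ/(θ−1)} + A₄) + O(exp(A₂·L^{θ/(θ−1)})·L^{θ/(2(1−θ)) − μ}). -/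
open MeasureTheory Filter Asymptotics

lemma lap_exp_sub (u v : ℂ) (M : ℝ) (hu : u.re ≤ M) (hv : v.re ≤ M) :
    ‖Complex.exp u - Complex.exp v‖ ≤ Real.exp M * ‖u - v‖ := by
  have hc : Convex ℝ {z : ℂ | z.re ≤ M} := convex_halfSpace_re_le M
  refine hc.norm_image_sub_le_of_norm_hasDerivWithin_le (f := Complex.exp) (f' := Complex.exp)
    (fun x _ => (Complex.hasDerivAt_exp x).hasDerivWithinAt) ?_ hv hu
  intro x hx
  rw [Complex.norm_exp]
  exact Real.exp_le_exp.2 hx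

lemma lap_kappa (h : ℝ → ℂ) (A B : ℝ) (a : ℂ) (hA : 0 < A) (hB : 0 < B) (ha : 0 < a.re)
    (hcont : ContinuousOn h (Set.Icc (-A) B))
    (hneg : ∀ x ∈ Set.Icc (-A) B, x ≠ 0 → (h x).re < 0)
    (C : ℝ) (hC : 0 < C) (hT : ∀ x ∈ Set.Icc (-A) B, ‖h x + a * x ^ 2‖ ≤ C * |x| ^ 3) :
    ∃ κ > 0, κ ≤ a.re ∧ ∀ x ∈ Set.Icc (-A) B, (h x).re ≤ - κ * x ^ 2 := by
  set δ := a.re / (2 * C) with hδ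
  have hδ0 : 0 < δ := by positivity
  have hnear : ∀ x ∈ Set.Icc (-A) B, |x| ≤ δ → (h x).re ≤ - (a.re / 2) * x ^ 2 := by
    intro x hx hxd
    have h1 := hT x hx
    have h2 : (h x + a * x ^ 2).re ≤ C * |x| ^ 3 := (Complex.re_le_norm _).trans h1
    have h3 : (h x + a * x ^ 2).re = (h x).re + a.re * x ^ 2 := by
      have : (a * (x:ℂ) ^ 2) = ((x ^ 2 : ℝ) : ℂ) * a := by push_cast; ring
      rw [Complex.add_re, this, Complex.re_ofReal_mul]; ring
    rw [h3] at h2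
    have h4 : C * |x| ^ 3 ≤ a.re / 2 * x ^ 2 := by
      have : C * |x| ≤ a.re / 2 := by
        calc C * |x| ≤ C * δ := by gcongr
          _ = a.re / 2 := by rw [hδ]; field_simp
      calc C * |x| ^ 3 = (C * |x|) * x ^ 2 := by rw [← sq_abs x]; ring
        _ ≤ _ := by gcongr
    linarith
  set K := Set.Icc (-A) B ∩ {x | δ ≤ |x|} with hK
  have hKc : IsCompact K := isCompact_Icc.inter_right (isClosed_le continuous_const continuous_abs)
  rcases K.eq_empty_or_nonempty with hKe | hKn
  · refine ⟨a.re / 2, by positivity, by linarith, fun x hx => hnear x hx ?_⟩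
    by_contra hcon
    have : x ∈ K := ⟨hx, (not_le.1 hcon).le⟩
    rw [hKe] at this; exact this
  · obtain ⟨x0, hx0, hmax⟩ := hKc.exists_isMaxOn hKn
      (f := fun x => (h x).re) ((Complex.continuous_re.comp_continuousOn hcont).mono Set.inter_subset_left)
    have hx0n : x0 ≠ 0 := by
      rintro rfl
      have := hx0.2
      simp at this; linarith
    have hm : (h x0).re < 0 := hneg x0 hx0.1 hx0n
    set m := -(h x0).re
    have hm0 : 0 < m := by simp only [m]; linarith
    set R := (A + B) ^ 2
    have hR : 0 < R := by positivity
    refine ⟨min (a.re / 2) (m / R), by positivity, (min_le_left _ _).trans (by linarith), ?_⟩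
    intro x hx
    by_cases hxd : |x| ≤ δ
    · have := hnear x hx hxd
      have h5 : min (a.re / 2) (m / R) * x ^ 2 ≤ a.re / 2 * x ^ 2 := by
        gcongr; exact min_le_left _ _
      linarith
    · have h1 : (h x).re ≤ (h x0).re := hmax ⟨hx, (not_le.1 hxd).le⟩
      have h5 : min (a.re / 2) (m / R) * x ^ 2 ≤ m / R * R := by
        have : x ^ 2 ≤ R := by
          apply sq_le_sq'
          · linarith [hx.1]
          · linarith [hx.2]
        gcongr; exact min_le_right _ _
      have : m / R * R = m := by field_simp
      simp only [m] at *
      linarith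

lemma lap_u (κ N x : ℝ) (hκ : 0 < κ) :
    N * x ^ 2 * Real.exp (-(κ * N * x ^ 2)) ≤ 2 / κ * Real.exp (-(κ / 2 * N * x ^ 2)) := by
  have h1 : κ / 2 * N * x ^ 2 ≤ Real.exp (κ / 2 * N * x ^ 2) := by
    linarith [Real.add_one_le_exp (κ / 2 * N * x ^ 2)]
  have h2 : Real.exp (-(κ * N * x ^ 2)) =
      Real.exp (-(κ / 2 * N * x ^ 2)) * Real.exp (-(κ / 2 * N * x ^ 2)) := by
    rw [← Real.exp_add]; ring_nf
  rw [h2]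
  have h3 : N * x ^ 2 * Real.exp (-(κ / 2 * N * x ^ 2)) ≤ 2 / κ := by
    rw [Real.exp_neg, ← div_eq_mul_inv, div_le_iff₀ (Real.exp_pos _)]
    calc N * x ^ 2 = 2 / κ * (κ / 2 * N * x ^ 2) := by field_simp
      _ ≤ _ := by gcongr
  calc _ = (N * x ^ 2 * Real.exp (-(κ / 2 * N * x ^ 2))) * Real.exp (-(κ / 2 * N * x ^ 2)) := by ring
    _ ≤ _ := by gcongr

lemma lap_v (κ N x : ℝ) (hκ : 0 < κ) (hN : 0 < N) :
    |x| * Real.exp (-(κ / 2 * N * x ^ 2)) ≤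
      (1 + 4 / κ) / Real.sqrt N * Real.exp (-(κ / 4 * N * x ^ 2)) := by
  have hs : 0 < Real.sqrt N := Real.sqrt_pos.2 hN
  have h0 := lap_u (κ / 2) N x (by positivity)
  have h1 : Real.sqrt N * |x| ≤ 1 + N * x ^ 2 := by
    have : (Real.sqrt N * |x|) ^ 2 = N * x ^ 2 := by
      rw [mul_pow, Real.sq_sqrt hN.le, sq_abs]
    nlinarith [sq_nonneg (Real.sqrt N * |x| - 1)]
  have h2 : Real.exp (-(κ / 2 * N * x ^ 2)) ≤ Real.exp (-(κ / 4 * N * x ^ 2)) := by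
    apply Real.exp_le_exp.2
    have : 0 ≤ κ * N * x ^ 2 := by positivity
    linarith
  have h3 : 2 / (κ / 2) = 4 / κ := by field_simp; norm_num
  have h4 : κ / 2 / 2 = κ / 4 := by ring
  rw [h3, h4] at h0
  rw [div_mul_eq_mul_div (1 + 4 / κ), le_div_iff₀ hs]
  calc _ = (Real.sqrt N * |x|) * Real.exp (-(κ / 2 * N * x ^ 2)) := by ring
    _ ≤ (1 + N * x ^ 2) * Real.exp (-(κ / 2 * N * x ^ 2)) := by gcongr
    _ ≤ _ := by linarith

lemma laplace_main (h : ℝ → ℂ) (ψ : ℝ → ℝ → ℂ) (A B r0 : ℝ) (a ψ0 : ℂ) (hA : 0 < A) (hB : 0 < B)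
    (ha : 0 < a.re)
    (hcont : ContinuousOn h (Set.Icc (-A) B))
    (hneg : ∀ x ∈ Set.Icc (-A) B, x ≠ 0 → (h x).re < 0)
    (C : ℝ) (hC : 0 < C) (hT : ∀ x ∈ Set.Icc (-A) B, ‖h x + a * x ^ 2‖ ≤ C * |x| ^ 3)
    (hψc : ∀ r ∈ Set.Ioc 0 r0, ContinuousOn (ψ r) (Set.Icc (-A) B))
    (C' : ℝ) (hC' : 0 < C')
    (hψ : ∀ r ∈ Set.Ioc 0 r0, ∀ x ∈ Set.Icc (-A) B, ‖ψ r x - ψ0‖ ≤ C' * (|x| + r)) :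
    ∃ D > 0, ∀ N : ℝ, 0 < N → ∀ r ∈ Set.Ioc 0 r0,
      ‖(∫ x in (-A)..B, Complex.exp (N * h x) * ψ r x) - ψ0 * (Real.pi / (a * N)) ^ (1 / 2 : ℂ)‖
        ≤ D * (1 / Real.sqrt N + r) / Real.sqrt N := by
  obtain ⟨κ, hκ, hκa, hκh⟩ := lap_kappa h A B a hA hB ha hcont hneg C hC hT
  set d := min A B with hd
  have hd0 : 0 < d := lt_min hA hB
  set K1 := C' + ‖ψ0‖ * C * (2 / κ) + ‖ψ0‖ / d with hK1
  have hK1' : 0 < K1 := by positivity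
  set K := K1 * (1 + 4 / κ) + C' with hK
  have hK' : 0 < K := by positivity
  refine ⟨K * Real.sqrt (Real.pi / (κ / 4)), by positivity, ?_⟩
  intro N hN r hr
  have hsN : 0 < Real.sqrt N := Real.sqrt_pos.2 hN
  have hr0 := hr.1
  set F : ℝ → ℂ := Set.indicator (Set.Ioc (-A) B) (fun x => Complex.exp (N * h x) * ψ r x) with hF
  set Gs : ℝ → ℂ := fun x => ψ0 * Complex.exp (-(a * N) * x ^ 2) with hGs
  have haN : 0 < (a * N).re := by rw [Complex.re_mul_ofReal]; positivity
  have hFi : (∫ x in (-A)..B, Complex.exp (N * h x) * ψ r x) = ∫ x, F x := by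
    rw [intervalIntegral.integral_of_le (by linarith), integral_indicator measurableSet_Ioc]
  have hGi : ψ0 * (Real.pi / (a * N)) ^ (1 / 2 : ℂ) = ∫ x, Gs x := by
    rw [hGs, integral_const_mul, integral_gaussian_complex haN]
  have hco : ContinuousOn (fun x => Complex.exp (N * h x) * ψ r x) (Set.Icc (-A) B) :=
    (Complex.continuous_exp.comp_continuousOn (continuousOn_const.mul hcont)).mul (hψc r hr)
  have hFint : Integrable F := by
    rw [hF, integrable_indicator_iff measurableSet_Ioc]
    exact (hco.integrableOn_Icc).mono_set Set.Ioc_subset_Icc_self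
  have hGint : Integrable Gs := by
    rw [hGs]
    exact (integrable_cexp_neg_mul_sq haN).const_mul _
  have hbound : ∀ x, ‖F x - Gs x‖ ≤ K * (1 / Real.sqrt N + r) * Real.exp (-(κ / 4 * N) * x ^ 2) := by
    intro x
    have hGn : ‖Complex.exp (-(a * N) * x ^ 2)‖ ≤ Real.exp (-(κ * N * x ^ 2)) := by
      rw [Complex.norm_exp]
      apply Real.exp_le_exp.2
      have : (-(a * N) * (x:ℂ) ^ 2) = ((-(N * x ^ 2) : ℝ) : ℂ) * a := by push_cast; ring
      rw [this, Complex.re_ofReal_mul]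
      have h7 : κ * (N * x ^ 2) ≤ a.re * (N * x ^ 2) := by gcongr
      linarith
    have hE2 : Real.exp (-(κ * N * x ^ 2)) ≤ Real.exp (-(κ / 2 * N * x ^ 2)) := by
      apply Real.exp_le_exp.2
      have : 0 ≤ κ * N * x ^ 2 := by positivity
      linarith
    have hE4 : Real.exp (-(κ / 2 * N * x ^ 2)) ≤ Real.exp (-(κ / 4 * N * x ^ 2)) := by
      apply Real.exp_le_exp.2
      have : 0 ≤ κ * N * x ^ 2 := by positivity
      linarith
    have key : ‖F x - Gs x‖ ≤ (K1 * |x| + C' * r) * Real.exp (-(κ / 2 * N * x ^ 2)) := by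
      by_cases hx : x ∈ Set.Ioc (-A) B
      · have hx' := Set.Ioc_subset_Icc_self hx
        rw [hF, Set.indicator_of_mem hx]
        have hdec : Complex.exp (N * h x) * ψ r x - Gs x =
            Complex.exp (N * h x) * (ψ r x - ψ0) +
              ψ0 * (Complex.exp (N * h x) - Complex.exp (-(a * N) * x ^ 2)) := by
          simp only [hGs]; ring
        rw [hdec]
        have hre : ((N:ℂ) * h x).re ≤ -(κ * N * x ^ 2) := by
          rw [Complex.re_ofReal_mul]
          have := mul_le_mul_of_nonneg_left (hκh x hx') hN.le
          linarith
        have hre2 : (-(a * N) * (x:ℂ) ^ 2).re ≤ -(κ * N * x ^ 2) := by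
          have : (-(a * N) * (x:ℂ) ^ 2) = ((-(N * x ^ 2) : ℝ) : ℂ) * a := by push_cast; ring
          rw [this, Complex.re_ofReal_mul]
          have h7 : κ * (N * x ^ 2) ≤ a.re * (N * x ^ 2) := by gcongr
          linarith
        have h1 : ‖Complex.exp (N * h x)‖ ≤ Real.exp (-(κ * N * x ^ 2)) := by
          rw [Complex.norm_exp]; exact Real.exp_le_exp.2 hre
        have h2 := lap_exp_sub _ _ _ hre hre2
        have h3 : ‖(N:ℂ) * h x - (-(a * N) * (x:ℂ) ^ 2)‖ ≤ N * (C * |x| ^ 3) := by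
          have : (N:ℂ) * h x - (-(a * N) * (x:ℂ) ^ 2) = N * (h x + a * x ^ 2) := by ring
          rw [this, norm_mul, Complex.norm_real, Real.norm_of_nonneg hN.le]
          gcongr
          exact hT x hx'
        have h4 := hψ r hr x hx'
        have h5 := lap_u κ N x hκ
        have h6 : Real.exp (-(κ * N * x ^ 2)) * ‖(N:ℂ) * h x - (-(a * N) * (x:ℂ) ^ 2)‖ ≤
            C * |x| * (2 / κ * Real.exp (-(κ / 2 * N * x ^ 2))) := by
          calc _ ≤ Real.exp (-(κ * N * x ^ 2)) * (N * (C * |x| ^ 3)) := by gcongr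
            _ = C * |x| * (N * x ^ 2 * Real.exp (-(κ * N * x ^ 2))) := by rw [← sq_abs x]; ring
            _ ≤ _ := by gcongr
        calc _ ≤ ‖Complex.exp (N * h x)‖ * ‖ψ r x - ψ0‖ +
              ‖ψ0‖ * ‖Complex.exp (N * h x) - Complex.exp (-(a * N) * x ^ 2)‖ := by
              refine (norm_add_le _ _).trans ?_
              rw [norm_mul, norm_mul]
          _ ≤ Real.exp (-(κ / 2 * N * x ^ 2)) * (C' * (|x| + r)) +
              ‖ψ0‖ * (C * |x| * (2 / κ * Real.exp (-(κ / 2 * N * x ^ 2)))) := by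
              gcongr
              · exact h1.trans hE2
              · exact h2.trans h6
          _ = ((C' + ‖ψ0‖ * C * (2 / κ)) * |x| + C' * r) * Real.exp (-(κ / 2 * N * x ^ 2)) := by
              ring
          _ ≤ _ := by
              gcongr
              rw [hK1]
              have : 0 ≤ ‖ψ0‖ / d := by positivity
              linarith
      · rw [hF, Set.indicator_of_notMem hx, zero_sub, norm_neg, hGs]
        simp only
        rw [norm_mul]
        have hxd : d ≤ |x| := by
          simp only [Set.mem_Ioc, not_and_or, not_lt, not_le] at hx
          rcases hx with hx | hx
          · exact (min_le_left _ _).trans ((by linarith : A ≤ -x).trans (neg_le_abs x))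
          · exact (min_le_right _ _).trans (hx.le.trans (le_abs_self x))
        calc _ ≤ ‖ψ0‖ * Real.exp (-(κ / 2 * N * x ^ 2)) := by
              gcongr; exact hGn.trans hE2
          _ = (‖ψ0‖ / d * d) * Real.exp (-(κ / 2 * N * x ^ 2)) := by
              rw [div_mul_cancel₀ _ hd0.ne']
          _ ≤ (‖ψ0‖ / d * |x|) * Real.exp (-(κ / 2 * N * x ^ 2)) := by gcongr
          _ ≤ _ := by
              have h8 : 0 ≤ (C' + ‖ψ0‖ * C * (2 / κ)) * |x| := by positivity
              have h9 : 0 ≤ C' * r := by positivity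
              gcongr
              rw [hK1, add_mul]
              linarith
    have hv := lap_v κ N x hκ hN
    have e : -(κ / 4 * N) * x ^ 2 = -(κ / 4 * N * x ^ 2) := by ring
    rw [e]
    calc _ ≤ K1 * (|x| * Real.exp (-(κ / 2 * N * x ^ 2))) + C' * r * Real.exp (-(κ / 2 * N * x ^ 2)) := by
          refine key.trans (le_of_eq ?_); ring
      _ ≤ K1 * ((1 + 4 / κ) / Real.sqrt N * Real.exp (-(κ / 4 * N * x ^ 2))) +
          C' * r * Real.exp (-(κ / 4 * N * x ^ 2)) := by gcongr
      _ = (K1 * (1 + 4 / κ) * (1 / Real.sqrt N) + C' * r) * Real.exp (-(κ / 4 * N * x ^ 2)) := by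
          ring
      _ ≤ _ := by
          gcongr
          rw [hK]
          have h1 : 0 ≤ C' * (1 / Real.sqrt N) := by positivity
          have h2 : 0 ≤ K1 * (1 + 4 / κ) * r := by positivity
          linarith
  rw [hFi, hGi, ← integral_sub hFint hGint]
  calc _ ≤ ∫ x, K * (1 / Real.sqrt N + r) * Real.exp (-(κ / 4 * N) * x ^ 2) := by
        apply norm_integral_le_of_norm_le _ (Eventually.of_forall hbound)
        exact (integrable_exp_neg_mul_sq (by positivity)).const_mul _
    _ = _ := by
        rw [integral_const_mul, integral_gaussian, show Real.pi / (κ / 4 * N) = Real.pi / (κ / 4) / N by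
          field_simp, Real.sqrt_div (by positivity) N]
        ring

/-- the phase function -/
noncomputable def phG (p : ℝ) (w : ℂ) : ℂ := w - w ^ ((-p : ℝ) : ℂ) / p
/-- the amplitude -/
noncomputable def ampQ (r : ℝ) (w : ℂ) : ℂ := Real.pi * r / Complex.sin (Real.pi * r * w)
/-- the integrand -/
noncomputable def intF (p N r : ℝ) (w : ℂ) : ℂ := Complex.exp (N * phG p w) * ampQ r w
/-- the convex domain -/
def domS (r : ℝ) : Set ℂ := {w | 0 < w.im ∨ (w.im = 0 ∧ 0 < w.re ∧ w.re < 1 / r)}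

lemma domS_convex (r : ℝ) : Convex ℝ (domS r) := by
  intro x hx y hy a b ha hb hab
  simp only [domS, Set.mem_ofPred_eq, Complex.add_im, Complex.add_re, Complex.real_smul,
    Complex.im_ofReal_mul, Complex.re_ofReal_mul] at *
  rcases ha.eq_or_lt with rfl | ha
  · have : b = 1 := by linarith
    subst this; simpa using hy
  rcases hb.eq_or_lt with rfl | hb
  · have : a = 1 := by linarith
    subst this; simpa using hx
  rcases hx with hx | ⟨hx1, hx2, hx3⟩
  · left
    have : 0 < a * x.im := by positivity
    have : 0 ≤ b * y.im := mul_nonneg hb.le (by rcases hy with h | h; exacts [h.le, h.1.ge])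
    linarith
  · rcases hy with hy | ⟨hy1, hy2, hy3⟩
    · left; rw [hx1]
      have : 0 < b * y.im := by positivity
      linarith
    · right
      refine ⟨by rw [hx1, hy1]; ring, by positivity, ?_⟩
      calc a * x.re + b * y.re < a * (1 / r) + b * (1 / r) := by gcongr
        _ = 1 / r := by rw [← add_mul, hab, one_mul]

lemma domS_slit {r : ℝ} {w : ℂ} (hw : w ∈ domS r) : w ∈ Complex.slitPlane := by
  rcases hw with h | h
  · exact Or.inr h.ne'
  · exact Or.inl h.2.1

lemma domS_sin {r : ℝ} (hr : 0 < r) {w : ℂ} (hw : w ∈ domS r) :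
    Complex.sin (Real.pi * r * w) ≠ 0 := by
  intro h
  rw [Complex.sin_eq_zero_iff] at h
  obtain ⟨k, hk⟩ := h
  have hpi : (Real.pi : ℂ) ≠ 0 := by exact_mod_cast Real.pi_ne_zero
  have h1 : (r : ℂ) * w = (k : ℝ) := by
    have : (Real.pi : ℂ) * (r * w) = Real.pi * ((k : ℝ) : ℂ) := by
      rw [← mul_assoc, hk]; push_cast; ring
    exact mul_left_cancel₀ hpi this
  have him := congrArg Complex.im h1
  have hre := congrArg Complex.re h1
  rw [Complex.im_ofReal_mul, Complex.ofReal_im] at him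
  rw [Complex.re_ofReal_mul, Complex.ofReal_re] at hre
  rcases hw with h | ⟨h2, h3, h4⟩
  · have : 0 < r * w.im := by positivity
    linarith
  · have h5 : 0 < r * w.re := by positivity
    have h6 : r * w.re < 1 := by
      rw [lt_div_iff₀ hr] at h4; linarith
    rw [hre] at h5 h6
    have h5' : (0 : ℤ) < k := by exact_mod_cast h5
    have h6' : k < 1 := by exact_mod_cast h6
    omega

lemma phG_diff {p : ℝ} {w : ℂ} (hw : w ∈ Complex.slitPlane) : DifferentiableAt ℂ (phG p) w := by
  unfold phG
  exact differentiableAt_id.sub ((differentiableAt_id.cpow_const hw).div_const _)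

lemma phG_hasDeriv {p : ℝ} (hp : p ≠ 0) {w : ℂ} (hw : w ∈ Complex.slitPlane) :
    HasDerivAt (phG p) (1 + w ^ ((-p - 1 : ℝ) : ℂ)) w := by
  unfold phG
  have h := (hasDerivAt_id w).sub (((hasDerivAt_id w).cpow_const (c := ((-p : ℝ) : ℂ)) hw).div_const (p : ℂ))
  have hp' : (p : ℂ) ≠ 0 := by exact_mod_cast hp
  have e : 1 - ((-p : ℝ) : ℂ) * id w ^ (((-p : ℝ) : ℂ) - 1) * 1 / (p : ℂ) =
      1 + w ^ ((-p - 1 : ℝ) : ℂ) := by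
    push_cast
    simp only [id_eq]
    field_simp
    ring
  rw [e] at h
  exact h

lemma intF_diff {p N r : ℝ} (hr : 0 < r) {w : ℂ} (hw : w ∈ domS r) :
    DifferentiableAt ℂ (intF p N r) w := by
  unfold intF ampQ
  have h1 := phG_diff (p := p) (domS_slit hw)
  have h2 := domS_sin hr hw
  fun_prop (disch := assumption)

lemma intF_cont {p N r : ℝ} (hr : 0 < r) : ContinuousOn (intF p N r) (domS r) :=
  fun _ hw => (intF_diff hr hw).continuousAt.continuousWithinAt

lemma exists_prim (p N : ℝ) {r : ℝ} (hr : 0 < r) :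
    ∃ Φ : ℂ → ℂ, ∀ w ∈ domS r, HasDerivWithinAt Φ (intF p N r w) (domS r) w :=
  (domS_convex r).exists_forall_hasDerivWithinAt
    (fun _ hw => (intF_diff hr hw).differentiableWithinAt)

lemma path_ftc {S : Set ℂ} {Φ f : ℂ → ℂ} (hΦ : ∀ w ∈ S, HasDerivWithinAt Φ (f w) S w)
    (hf : ContinuousOn f S) {γ γ' : ℝ → ℂ} {a b : ℝ} (hab : a ≤ b)
    (hγ : ∀ x, HasDerivAt γ (γ' x) x) (hγ' : Continuous γ')
    (hm : ∀ x ∈ Set.Icc a b, γ x ∈ S) :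
    ∫ x in a..b, f (γ x) * γ' x = Φ (γ b) - Φ (γ a) := by
  have hγc : Continuous γ := continuous_iff_continuousAt.2 fun x => (hγ x).continuousAt
  have hd : ∀ x ∈ Set.Icc a b, HasDerivWithinAt (Φ ∘ γ) (f (γ x) * γ' x) (Set.Icc a b) x := by
    intro x hx
    exact (hΦ (γ x) (hm x hx)).comp_of_eq x (hγ x).hasDerivWithinAt hm rfl
  refine intervalIntegral.integral_eq_sub_of_hasDerivAt_of_le hab (f := Φ ∘ γ)
    (fun x hx => (hd x hx).continuousWithinAt) ?_ ?_
  · intro x hx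
    exact (hd x (Set.Ioo_subset_Icc_self hx)).hasDerivAt (Icc_mem_nhds hx.1 hx.2)
  · apply ContinuousOn.intervalIntegrable
    rw [Set.uIcc_of_le hab]
    exact (hf.comp hγc.continuousOn hm).mul hγ'.continuousOn

lemma sinh_ge_sq {u : ℝ} (hu : 0 ≤ u) : u ^ 2 / 4 ≤ Real.sinh u := by
  rw [Real.sinh_eq]
  have h1 := Real.quadratic_le_exp_of_nonneg hu
  have h2 : Real.exp (-u) ≤ 1 := Real.exp_le_one_iff.2 (by linarith)
  linarith

lemma norm_sin_ge (z : ℂ) : |Real.sinh z.im| ≤ ‖Complex.sin z‖ := by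
  have h : Complex.sin z = (Real.sin z.re * Real.cosh z.im : ℝ) + (Real.cos z.re * Real.sinh z.im : ℝ) * Complex.I := by
    rw [Complex.sin_eq z]; push_cast; ring
  rw [h, Complex.norm_add_mul_I, ← Real.sqrt_sq_eq_abs]
  apply Real.sqrt_le_sqrt
  have h1 := Real.sin_sq_add_cos_sq z.re
  have h2 := Real.cosh_sq z.im
  have : (Real.sin z.re * Real.cosh z.im) ^ 2 + (Real.cos z.re * Real.sinh z.im) ^ 2 =
    Real.sinh z.im ^ 2 + Real.sin z.re ^ 2 := by
    rw [mul_pow, mul_pow, h2]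
    linear_combination (Real.sinh z.im ^ 2) * h1
  rw [this]
  nlinarith [sq_nonneg (Real.sin z.re)]

lemma ampQ_bound {r : ℝ} (hr : 0 < r) {w : ℂ} (hw : 0 < w.im) :
    ‖ampQ r w‖ ≤ 2 / (r * w.im ^ 2) := by
  unfold ampQ
  have hpi := Real.pi_pos
  have h1 := norm_sin_ge (Real.pi * r * w)
  have h2 : (Real.pi * r * w : ℂ).im = Real.pi * r * w.im := by
    rw [show (Real.pi * r * w : ℂ) = ((Real.pi * r : ℝ) : ℂ) * w by push_cast; ring,
      Complex.im_ofReal_mul]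
  have h3 : 0 < Real.pi * r * w.im := by positivity
  have h4 := sinh_ge_sq h3.le
  rw [h2] at h1
  have h5 : (Real.pi * r * w.im) ^ 2 / 4 ≤ ‖Complex.sin (Real.pi * r * w)‖ :=
    h4.trans ((le_abs_self _).trans h1)
  rw [norm_div, show (Real.pi * r : ℂ) = ((Real.pi * r : ℝ) : ℂ) by push_cast; ring,
    Complex.norm_real, Real.norm_of_nonneg (by positivity)]
  rw [show (((Real.pi * r : ℝ) : ℂ) * w) = Real.pi * r * w by push_cast; ring]
  calc Real.pi * r / ‖Complex.sin (Real.pi * r * w)‖ ≤ Real.pi * r / ((Real.pi * r * w.im) ^ 2 / 4) := by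
        gcongr
    _ = (4 / Real.pi) / (r * w.im ^ 2) := by field_simp
    _ ≤ _ := by
        gcongr
        rw [div_le_iff₀ hpi]
        linarith [Real.pi_gt_three]

lemma intF_bound {p N r : ℝ} (hN : 0 ≤ N) (hr : 0 < r) {w : ℂ} (hw : 0 < w.im) {M : ℝ}
    (hM : (phG p w).re ≤ M) :
    ‖intF p N r w‖ ≤ Real.exp (N * M) * (2 / (r * w.im ^ 2)) := by
  unfold intF
  rw [norm_mul, Complex.norm_exp, Complex.re_ofReal_mul]
  gcongr
  exact ampQ_bound hr hw

lemma phG_re_le {p : ℝ} (hp : 0 < p) (w : ℂ) : (phG p w).re ≤ w.re + ‖w‖ ^ (-p) / p := by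
  unfold phG
  rw [Complex.sub_re]
  have : -(w ^ ((-p : ℝ) : ℂ) / p).re ≤ ‖w‖ ^ (-p) / p := by
    calc _ ≤ ‖w ^ ((-p : ℝ) : ℂ) / p‖ := (neg_le_abs _).trans (Complex.abs_re_le_norm _)
      _ = _ := by rw [norm_div, Complex.norm_cpow_real, Complex.norm_real, Real.norm_of_nonneg hp.le]
  linarith

lemma phG_re_le' {p : ℝ} (hp : 0 < p) {w : ℂ} {b : ℝ} (hb : 0 < b) (hw : b ≤ w.im) :
    (phG p w).re ≤ w.re + b ^ (-p) / p := by
  refine (phG_re_le hp w).trans ?_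
  gcongr _ + ?_ / p
  apply Real.rpow_le_rpow_of_nonpos hb (hw.trans ((le_abs_self _).trans (Complex.abs_im_le_norm _)))
  linarith

lemma path_ftc' {S : Set ℂ} {Φ f : ℂ → ℂ} (hΦ : ∀ w ∈ S, HasDerivWithinAt Φ (f w) S w)
    (hf : ContinuousOn f S) {γ γ' : ℝ → ℂ} {a b : ℝ}
    (hγ : ∀ x, HasDerivAt γ (γ' x) x) (hγ' : Continuous γ')
    (hm : ∀ x ∈ Set.uIcc a b, γ x ∈ S) :
    ∫ x in a..b, f (γ x) * γ' x = Φ (γ b) - Φ (γ a) := by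
  rcases le_total a b with hab | hab
  · rw [Set.uIcc_of_le hab] at hm
    exact path_ftc hΦ hf hab hγ hγ' hm
  · rw [Set.uIcc_of_ge hab] at hm
    rw [intervalIntegral.integral_symm, path_ftc hΦ hf hab hγ hγ' hm]
    ring

lemma hor_deriv (v x : ℝ) : HasDerivAt (fun x : ℝ => (x : ℂ) + v * Complex.I) 1 x :=
  (Complex.ofRealCLM.hasDerivAt (x := x)).add_const _

lemma ver_deriv (u y : ℝ) : HasDerivAt (fun y : ℝ => (u : ℂ) + y * Complex.I) Complex.I y := by
  have h := ((Complex.ofRealCLM.hasDerivAt (x := y)).mul_const Complex.I).const_add (u : ℂ)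
  simpa using h

lemma ver_mem {r u y : ℝ} (hy : 0 < y) : (u : ℂ) + y * Complex.I ∈ domS r := by
  left; simpa using hy

lemma integrableOn_inv_sq {v : ℝ} (hv : 0 < v) :
    IntegrableOn (fun y : ℝ => 1 / y ^ 2) (Set.Ioi v) ∧
      ∫ y in Set.Ioi v, 1 / y ^ 2 = 1 / v := by
  have h1 := integrableOn_Ioi_rpow_of_lt (a := -2) (by norm_num) hv
  have h2 := integral_Ioi_rpow_of_lt (a := -2) (by norm_num) hv
  have e : Set.EqOn (fun y : ℝ => y ^ (-2 : ℝ)) (fun y : ℝ => 1 / y ^ 2) (Set.Ioi v) := by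
    intro y hy
    have hy0 : 0 < y := hv.trans hy
    simp only
    rw [Real.rpow_neg hy0.le]
    norm_num
  refine ⟨h1.congr_fun e measurableSet_Ioi, ?_⟩
  rw [← setIntegral_congr_fun measurableSet_Ioi e, h2]
  norm_num
  rw [Real.rpow_neg_one]

lemma ver_contOn {p N r : ℝ} (hr : 0 < r) (u : ℝ) {s : Set ℝ} (hs : ∀ y ∈ s, (u : ℂ) + y * Complex.I ∈ domS r) :
    ContinuousOn (fun y : ℝ => intF p N r (u + y * Complex.I)) s :=
  (intF_cont hr).comp (by fun_prop) hs

lemma ver_bound {p N r : ℝ} (hN : 0 ≤ N) (hr : 0 < r) (u : ℝ) {v M : ℝ} (hv : 0 < v)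
    (hM : ∀ y : ℝ, v ≤ y → (phG p (u + y * Complex.I)).re ≤ M) :
    IntegrableOn (fun y : ℝ => intF p N r (u + y * Complex.I)) (Set.Ioi v) ∧
    ‖∫ y in Set.Ioi v, intF p N r (u + y * Complex.I) * Complex.I‖ ≤
      Real.exp (N * M) * (2 / (r * v)) := by
  obtain ⟨h1, h2⟩ := integrableOn_inv_sq hv
  have hb : ∀ y ∈ Set.Ioi v, ‖intF p N r (u + y * Complex.I)‖ ≤
      Real.exp (N * M) * (2 / r) * (1 / y ^ 2) := by
    intro y hy
    have hy0 : 0 < y := hv.trans hy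
    have := intF_bound (p := p) (r := r) hN hr (w := u + y * Complex.I) (by simpa using hy0) (hM y hy.le)
    simp only [Complex.add_im, Complex.ofReal_im, Complex.mul_im, Complex.ofReal_re, Complex.I_im,
      mul_one, Complex.I_re, mul_zero, add_zero, zero_add] at this
    refine this.trans (le_of_eq ?_)
    field_simp
  have hintg : IntegrableOn (fun y => Real.exp (N * M) * (2 / r) * (1 / y ^ 2)) (Set.Ioi v) :=
    h1.const_mul _
  have hb' : ∀ᵐ (y : ℝ) ∂(volume.restrict (Set.Ioi v)), ‖intF p N r (u + y * Complex.I)‖ ≤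
      Real.exp (N * M) * (2 / r) * (1 / y ^ 2) :=
    (ae_restrict_iff' measurableSet_Ioi).2 (Eventually.of_forall hb)
  refine ⟨?_, ?_⟩
  · refine Integrable.mono' hintg ?_ hb'
    apply ContinuousOn.aestronglyMeasurable _ measurableSet_Ioi
    exact ver_contOn hr u fun y hy => ver_mem (hv.trans hy)
  · calc _ ≤ ∫ y in Set.Ioi v, Real.exp (N * M) * (2 / r) * (1 / y ^ 2) := by
          apply norm_integral_le_of_norm_le hintg
          filter_upwards [hb'] with y hy
          rwa [norm_mul, Complex.norm_I, mul_one]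
      _ = _ := by
          rw [integral_const_mul, h2]
          field_simp

lemma intF_real {p N r : ℝ} {x : ℝ} (hx : 0 < x) : (intF p N r x).im = 0 := by
  have : intF p N r x = ((Real.exp (N * (x - x ^ (-p) / p)) * (Real.pi * r / Real.sin (Real.pi * r * x)) : ℝ) : ℂ) := by
    unfold intF phG ampQ
    rw [← Complex.ofReal_cpow hx.le]
    push_cast
    rfl
  rw [this, Complex.ofReal_im]

lemma half_mem {r : ℝ} (hr : 0 < r) {y : ℝ} (hy : 0 ≤ y) :
    (((1 / (2 * r) : ℝ) : ℂ) + y * Complex.I) ∈ domS r := by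
  rcases hy.eq_or_lt with rfl | hy
  · right
    refine ⟨by simp, ?_, ?_⟩
    · simp; positivity
    · simp
      rw [← one_div, ← one_div]
      field_simp
      norm_num
  · exact ver_mem hy

lemma half_int {p N r : ℝ} (hp : 0 < p) (hN : 0 ≤ N) (hr : 0 < r) :
    IntegrableOn (fun y : ℝ => intF p N r (((1 / (2 * r) : ℝ) : ℂ) + y * Complex.I)) (Set.Ioi 0) := by
  rw [← Set.Ioc_union_Ioi_eq_Ioi (zero_le_one' ℝ)]
  refine IntegrableOn.union ?_ ?_
  · apply IntegrableOn.mono_set _ (Set.Ioc_subset_Icc_self)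
    apply ContinuousOn.integrableOn_Icc
    exact ver_contOn hr _ fun y hy => half_mem hr hy.1
  · refine (ver_bound hN hr _ (M := 1 / (2 * r) + 1 ^ (-p) / p) one_pos ?_).1
    intro y hy
    have := phG_re_le' hp (w := ((1 / (2 * r) : ℝ) : ℂ) + y * Complex.I) one_pos (by simpa using hy)
    simpa using this

lemma contour_eq {p N r : ℝ} (hp : 0 < p) (hN : 0 ≤ N) (hr : 0 < r)
    {γ γ' : ℝ → ℂ} {a b xe v : ℝ}
    (hγ : ∀ x, HasDerivAt γ (γ' x) x) (hγ' : Continuous γ')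
    (hab : a ≤ b) (hm : ∀ x ∈ Set.Icc a b, γ x ∈ domS r) (hstart : (γ a).im = 0)
    (hv : 0 < v) (hend : (γ b).im = v) :
    (∫ y in Set.Ioi (0:ℝ), intF p N r (((1 / (2 * r) : ℝ) : ℂ) + y * Complex.I) * Complex.I).im =
    ((∫ x in a..b, intF p N r (γ x) * γ' x) +
      (∫ x in (γ b).re..xe, intF p N r ((x : ℂ) + v * Complex.I)) +
      ∫ y in Set.Ioi v, intF p N r ((xe : ℂ) + y * Complex.I) * Complex.I).im := by
  obtain ⟨Φ, hΦ⟩ := exists_prim p N hr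
  have hc := intF_cont (p := p) (N := N) hr
  set x1 : ℝ := 1 / (2 * r) with hx1
  have hx1p : 0 < x1 := by positivity
  have hx1r : x1 < 1 / r := by rw [hx1]; field_simp; norm_num
  have hI1 : ∀ Y : ℝ, 0 ≤ Y → ∫ y in (0:ℝ)..Y, intF p N r ((x1 : ℂ) + y * Complex.I) * Complex.I =
      Φ ((x1 : ℂ) + Y * Complex.I) - Φ x1 := by
    intro Y hY
    have := path_ftc hΦ hc (γ := fun y : ℝ => (x1 : ℂ) + y * Complex.I) hY (ver_deriv x1)
      continuous_const (fun y hy => half_mem hr hy.1)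
    rw [this]; simp
  have hI2 : ∀ Y : ℝ, v ≤ Y → ∫ y in v..Y, intF p N r ((xe : ℂ) + y * Complex.I) * Complex.I =
      Φ ((xe : ℂ) + Y * Complex.I) - Φ (xe + v * Complex.I) := by
    intro Y hY
    exact path_ftc hΦ hc (γ := fun y : ℝ => (xe : ℂ) + y * Complex.I) hY (ver_deriv xe)
      continuous_const (fun y hy => ver_mem (hv.trans_le hy.1))
  have hJ : ∀ Y : ℝ, 0 < Y → ∫ x in xe..x1, intF p N r ((x : ℂ) + Y * Complex.I) =
      Φ ((x1 : ℂ) + Y * Complex.I) - Φ (xe + Y * Complex.I) := by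
    intro Y hY
    have := path_ftc' hΦ hc (γ := fun x : ℝ => (x : ℂ) + Y * Complex.I) (a := xe) (b := x1)
      (hor_deriv Y) continuous_const (fun y hy => ver_mem hY)
    simpa using this
  have hH : ∫ x in (γ b).re..xe, intF p N r ((x : ℂ) + v * Complex.I) =
      Φ (xe + v * Complex.I) - Φ (γ b) := by
    have := path_ftc' hΦ hc (γ := fun x : ℝ => (x : ℂ) + v * Complex.I) (a := (γ b).re) (b := xe)
      (hor_deriv v) continuous_const (fun y hy => ver_mem hv)
    simp only [mul_one] at this
    rw [this, ← hend, Complex.re_add_im]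
  have hP := path_ftc hΦ hc hab hγ hγ' hm
  have hsm := hm a ⟨le_rfl, hab⟩
  have hs2 : 0 < (γ a).re ∧ (γ a).re < 1 / r := by
    rcases hsm with h | h
    · rw [hstart] at h; exact absurd h (lt_irrefl _)
    · exact h.2
  have hR : ∫ x in (γ a).re..x1, intF p N r (x : ℂ) = Φ x1 - Φ (γ a) := by
    have := path_ftc' hΦ hc (γ := fun x : ℝ => (x : ℂ)) (γ' := fun _ => 1) (a := (γ a).re) (b := x1)
      (fun x => Complex.ofRealCLM.hasDerivAt (x := x)) continuous_const (fun y hy => by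
        right
        have h1 := hy.1
        have h2 := hy.2
        refine ⟨by simp, ?_, ?_⟩
        · simp only [Complex.ofReal_re]
          exact (lt_min hs2.1 hx1p).trans_le h1
        · simp only [Complex.ofReal_re]
          exact h2.trans_lt (max_lt hs2.2 hx1r))
    simp only [mul_one] at this
    rw [this]
    congr 2
    apply Complex.ext <;> simp [hstart]
  have hRim : (∫ x in (γ a).re..x1, intF p N r (x : ℂ)).im = 0 := by
    have e : ∫ x in (γ a).re..x1, intF p N r (x : ℂ) =
        ∫ x in (γ a).re..x1, (((intF p N r (x : ℂ)).re : ℝ) : ℂ) := by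
      apply intervalIntegral.integral_congr
      intro x hx
      have hx0 : 0 < x := (lt_min hs2.1 hx1p).trans_le hx.1
      apply Complex.ext
      · simp
      · simp [intF_real hx0]
    rw [e, intervalIntegral.integral_ofReal, Complex.ofReal_im]
  have hJ0 : Tendsto (fun Y : ℝ => ∫ x in xe..x1, intF p N r ((x : ℂ) + Y * Complex.I)) atTop (nhds 0) := by
    set M := max |xe| |x1| + 1 ^ (-p) / p with hM
    have hb : ∀ Y : ℝ, 1 ≤ Y → ‖∫ x in xe..x1, intF p N r ((x : ℂ) + Y * Complex.I)‖ ≤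
        Real.exp (N * M) * (2 / (r * Y ^ 2)) * |x1 - xe| := by
      intro Y hY
      apply intervalIntegral.norm_integral_le_of_norm_le_const
      intro x hx
      have h1 := intF_bound (p := p) (N := N) (r := r) (M := M) hN hr (w := (x : ℂ) + Y * Complex.I)
        (by simp; linarith) (by
          have := phG_re_le' hp (w := (x : ℂ) + Y * Complex.I) one_pos (by simpa using hY)
          refine this.trans ?_
          rw [hM]
          gcongr
          simp only [Complex.add_re, Complex.ofReal_re, Complex.mul_re, Complex.I_re, mul_zero,
            Complex.ofReal_im, Complex.I_im, mul_one, sub_self, add_zero]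
          have hx' := Set.uIoc_subset_uIcc hx
          rcases le_total xe x1 with h | h
          · rw [Set.uIcc_of_le h] at hx'
            exact (hx'.2.trans (le_abs_self _)).trans (le_max_right _ _)
          · rw [Set.uIcc_of_ge h] at hx'
            exact (hx'.2.trans (le_abs_self _)).trans (le_max_left _ _))
      simpa using h1
    rw [tendsto_zero_iff_norm_tendsto_zero]
    refine squeeze_zero' (g := fun Y => Real.exp (N * M) * (2 / (r * Y ^ 2)) * |x1 - xe|)
      (Eventually.of_forall fun _ => norm_nonneg _)
      ((eventually_ge_atTop 1).mono hb) ?_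
    have h2 : Tendsto (fun Y : ℝ => r * Y ^ 2) atTop atTop :=
      (tendsto_pow_atTop two_ne_zero).const_mul_atTop hr
    have h3 := ((h2.const_div_atTop 2).const_mul (Real.exp (N * M))).mul_const |x1 - xe|
    simpa using h3
  have hL1 := intervalIntegral_tendsto_integral_Ioi 0
    ((half_int hp hN hr).mul_const Complex.I) tendsto_id
  have hvb : IntegrableOn (fun y : ℝ => intF p N r ((xe : ℂ) + y * Complex.I)) (Set.Ioi v) := by
    refine (ver_bound hN hr _ (M := xe + v ^ (-p) / p) hv ?_).1
    intro y hy
    have := phG_re_le' hp (w := ((xe : ℝ) : ℂ) + y * Complex.I) hv (by simpa using hy)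
    simpa using this
  have hL2 := intervalIntegral_tendsto_integral_Ioi v (hvb.mul_const Complex.I) tendsto_id
  have hsum := (hJ0.add hL2).add_const (Φ (xe + v * Complex.I) - Φ x1)
  have heq := tendsto_nhds_unique_of_eventuallyEq hL1 hsum (by
    filter_upwards [eventually_ge_atTop v, eventually_ge_atTop 0, eventually_gt_atTop 0] with Y h1 h2 h3
    simp only [id]
    rw [hI1 Y h2, hI2 Y h1, hJ Y h3]
    ring)
  rw [heq, hP, hH]
  have hz : (Φ x1 - Φ (γ a)).im = 0 := by rw [← hR, hRim]
  have : (Φ (γ b) - Φ (γ a) + (Φ (xe + v * Complex.I) - Φ (γ b)) +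
      ∫ y in Set.Ioi v, intF p N r ((xe : ℂ) + y * Complex.I) * Complex.I) =
      (0 + (∫ y in Set.Ioi v, intF p N r ((xe : ℂ) + y * Complex.I) * Complex.I) +
        (Φ (xe + v * Complex.I) - Φ x1)) + (Φ x1 - Φ (γ a)) := by ring
  rw [this, Complex.add_im _ (Φ x1 - Φ (γ a)), hz, add_zero]

/-- Data of a steepest-descent type half contour. -/
structure PathD (p β : ℝ) where
  γ : ℂ → ℂ
  κ : ℂ
  A : ℝ
  B : ℝ
  xe : ℝ
  m : ℝ
  hγ : Differentiable ℂ γ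
  hA : 0 < A
  hB : 0 < B
  hm : 0 < m
  hκ : 0 < κ.re
  hκ2 : 0 < (κ ^ 2).re
  h0 : γ 0 = Complex.exp (β * Complex.I)
  h0' : deriv γ 0 = Complex.I * κ * Complex.exp (β / 2 * Complex.I)
  hs1 : (γ ((-A : ℝ) : ℂ)).im = 0
  hs2 : 0 < (γ ((-A : ℝ) : ℂ)).re
  him : ∀ x ∈ Set.Ioc (-A) B, 0 < (γ (x : ℂ)).im
  hre : ∀ x ∈ Set.Icc (-A) B, x ≠ 0 → (phG p (γ (x : ℂ))).re < (phG p (γ 0)).re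
  hleft : ∀ x ∈ Set.uIcc (γ (B : ℂ)).re xe,
    (phG p ((x : ℂ) + (γ (B : ℂ)).im * Complex.I)).re ≤ (phG p (γ 0)).re - m
  hup : ∀ y : ℝ, (γ (B : ℂ)).im ≤ y →
    (phG p ((xe : ℂ) + y * Complex.I)).re ≤ (phG p (γ 0)).re - m

lemma taylor3 {h h' : ℂ → ℂ} {h2 : ℂ} (hd : ∀ᶠ z in nhds 0, HasDerivAt h (h' z) z)
    (h0 : h 0 = 0) (h1 : h' 0 = 0) (hh2 : HasDerivAt h' h2 0) :
    ∃ C > 0, ∃ δ > 0, ∀ z : ℂ, ‖z‖ < δ → ‖h z - h2 / 2 * z ^ 2‖ ≤ C * ‖z‖ ^ 3 := by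
  set u : ℂ → ℂ := fun z => h z - h2 / 2 * z ^ 2 with hu
  have hud : ∀ᶠ z in nhds 0, HasDerivAt u (h' z - h2 * z) z := by
    filter_upwards [hd] with z hz
    have := hz.sub ((hasDerivAt_pow 2 z).const_mul (h2 / 2))
    convert! this using 1
    push_cast
    ring
  have hua : AnalyticAt ℂ u 0 := by
    rw [Complex.analyticAt_iff_eventually_differentiableAt]
    exact hud.mono fun z hz => hz.differentiableAt
  have hder : deriv u =ᶠ[nhds 0] fun z => h' z - h2 * z := hud.mono fun z hz => hz.deriv
  have hdd : HasDerivAt (fun z => h' z - h2 * z) 0 0 := by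
    have := hh2.sub ((hasDerivAt_id (0:ℂ)).const_mul h2)
    convert! this using 1
    simp
  have ho : ((3 : ℕ) : ℕ∞) ≤ analyticOrderAt u 0 := by
    rw [natCast_le_analyticOrderAt_iff_iteratedDeriv_eq_zero hua]
    intro i hi
    interval_cases i
    · simp [hu, h0]
    · rw [iteratedDeriv_one, hder.eq_of_nhds]; simp [h1]
    · rw [iteratedDeriv_succ, iteratedDeriv_one, hder.deriv_eq, hdd.deriv]
  rw [natCast_le_analyticOrderAt hua] at ho
  obtain ⟨g, hg, hgu⟩ := ho
  have hgc := hg.continuousAt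
  have hgb : ∀ᶠ z in nhds (0:ℂ), ‖g z‖ < ‖g 0‖ + 1 :=
    hgc.norm.eventually_lt continuousAt_const (by linarith)
  obtain ⟨δ, hδ, hball⟩ := Metric.eventually_nhds_iff.1 (hgb.and hgu)
  refine ⟨‖g 0‖ + 1, by positivity, δ, hδ, fun z hz => ?_⟩
  obtain ⟨ha, hb⟩ := hball (by simpa using hz : dist z 0 < δ)
  have : u z = z ^ 3 * g z := by rw [hb]; simp
  change ‖u z‖ ≤ _
  rw [this, norm_mul, norm_pow, mul_comm]
  gcongr

lemma loc_to_glob {u : ℝ → ℂ} {A B C δ : ℝ} (n : ℕ) (hδ : 0 < δ) (hC : 0 < C)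
    (hu : ContinuousOn u (Set.Icc (-A) B)) (hl : ∀ x : ℝ, |x| < δ → ‖u x‖ ≤ C * |x| ^ n) :
    ∃ C' > 0, ∀ x ∈ Set.Icc (-A) B, ‖u x‖ ≤ C' * |x| ^ n := by
  obtain ⟨K, hK⟩ := isCompact_Icc.exists_bound_of_continuousOn hu
  refine ⟨C + |K| / δ ^ n, by positivity, fun x hx => ?_⟩
  by_cases hxd : |x| < δ
  · refine (hl x hxd).trans ?_
    gcongr
    have : 0 ≤ |K| / δ ^ n := by positivity
    linarith
  · have h1 : δ ^ n ≤ |x| ^ n := by gcongr; exact not_lt.1 hxd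
    have h2 : |K| / δ ^ n * δ ^ n = |K| := by field_simp
    calc ‖u x‖ ≤ |K| := (hK x hx).trans (le_abs_self _)
      _ = |K| / δ ^ n * δ ^ n := h2.symm
      _ ≤ |K| / δ ^ n * |x| ^ n := by gcongr
      _ ≤ _ := by
        gcongr; linarith

lemma ampQ_near {r : ℝ} (hr : 0 < r) {w : ℂ} (hw : w ≠ 0) (h : Real.pi * r * ‖w‖ ≤ 1) :
    ‖ampQ r w - 1 / w‖ ≤ r := by
  have hpi := Real.pi_pos
  set z : ℂ := Real.pi * r * w with hz
  have hzn : ‖z‖ = Real.pi * r * ‖w‖ := by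
    rw [hz, show (Real.pi * r * w : ℂ) = ((Real.pi * r : ℝ) : ℂ) * w by push_cast; ring, norm_mul,
      Complex.norm_real, Real.norm_of_nonneg (by positivity)]
  have hwn : 0 < ‖w‖ := norm_pos_iff.2 hw
  have hz0 : 0 < ‖z‖ := by rw [hzn]; positivity
  have hz1 : ‖z‖ ≤ 1 := by rw [hzn]; exact h
  have hb := Complex.sin_bound hz1
  have h3 : ‖z ^ 3 / 6‖ = ‖z‖ ^ 3 / 6 := by rw [norm_div, norm_pow]; simp
  have hd : ‖Complex.sin z - z‖ ≤ ‖z‖ ^ 2 / 5 := by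
    calc ‖Complex.sin z - z‖ = ‖(Complex.sin z - (z - z ^ 3 / 6)) - z ^ 3 / 6‖ := by congr 1; ring
      _ ≤ ‖z‖ ^ 5 / 100 + ‖z‖ ^ 3 / 6 := by
          refine (norm_sub_le _ _).trans ?_
          rw [h3]; gcongr
      _ ≤ ‖z‖ ^ 2 / 100 + ‖z‖ ^ 2 / 6 := by
          gcongr ?_ / 100 + ?_ / 6
          · exact pow_le_pow_of_le_one hz0.le hz1 (by norm_num)
          · exact pow_le_pow_of_le_one hz0.le hz1 (by norm_num)
      _ ≤ _ := by nlinarith [sq_nonneg ‖z‖]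
  have hs : 4 / 5 * ‖z‖ ≤ ‖Complex.sin z‖ := by
    have h4 : ‖z‖ ≤ ‖Complex.sin z‖ + ‖Complex.sin z - z‖ := by
      calc ‖z‖ = ‖Complex.sin z - (Complex.sin z - z)‖ := by congr 1; ring
        _ ≤ _ := norm_sub_le _ _
    have h5 : ‖z‖ ^ 2 / 5 ≤ ‖z‖ / 5 := by nlinarith
    linarith
  have hs0 : Complex.sin z ≠ 0 := by
    intro h0; rw [h0, norm_zero] at hs; linarith
  have e : ampQ r w - 1 / w = (z - Complex.sin z) / (w * Complex.sin z) := by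
    have : ampQ r w = Real.pi * r / Complex.sin z := rfl
    rw [this]
    field_simp
    rw [hz]
  rw [e, norm_div, norm_mul, norm_sub_rev]
  calc _ ≤ (‖z‖ ^ 2 / 5) / (‖w‖ * (4 / 5 * ‖z‖)) := by gcongr
    _ = ‖z‖ / (4 * ‖w‖) := by field_simp
    _ = Real.pi / 4 * r := by rw [hzn]; field_simp
    _ ≤ 1 * r := by gcongr; linarith [Real.pi_le_four]
    _ = r := one_mul r

lemma w0_cpow {β : ℝ} (h1 : 0 < β) (h2 : β < Real.pi) (q : ℝ) :
    Complex.exp (β * Complex.I) ^ ((q : ℝ) : ℂ) = Complex.exp ((q * β : ℝ) * Complex.I) := by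
  rw [Complex.cpow_def_of_ne_zero (Complex.exp_ne_zero _), Complex.log_exp (by simp; linarith) (by simp; linarith)]
  congr 1
  push_cast
  ring

lemma beta_mem {p β : ℝ} (hp : 0 < p) (hβ : β = Real.pi / (1 + p)) : 0 < β ∧ β < Real.pi := by
  have := Real.pi_pos
  subst hβ
  refine ⟨by positivity, ?_⟩
  rw [div_lt_iff₀ (by positivity)]
  nlinarith

lemma w0_pow1 {p β : ℝ} (hp : 0 < p) (hβ : β = Real.pi / (1 + p)) :
    Complex.exp (β * Complex.I) ^ ((-p - 1 : ℝ) : ℂ) = -1 := by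
  obtain ⟨h1, h2⟩ := beta_mem hp hβ
  rw [w0_cpow h1 h2]
  have : (-p - 1) * β = -Real.pi := by rw [hβ]; field_simp; ring
  rw [this]
  push_cast
  rw [neg_mul, Complex.exp_neg, Complex.exp_pi_mul_I]
  norm_num

lemma w0_pow {p β : ℝ} (hp : 0 < p) (hβ : β = Real.pi / (1 + p)) :
    Complex.exp (β * Complex.I) ^ ((-p : ℝ) : ℂ) = -Complex.exp (β * Complex.I) := by
  have h := w0_pow1 hp hβ
  have h0 := Complex.exp_ne_zero (β * Complex.I)
  have e : ((-p : ℝ) : ℂ) = ((-p - 1 : ℝ) : ℂ) + 1 := by push_cast; ring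
  rw [e, Complex.cpow_add _ _ h0, h, Complex.cpow_one]
  ring

lemma phG_w0 {p β : ℝ} (hp : 0 < p) (hβ : β = Real.pi / (1 + p)) :
    phG p (Complex.exp (β * Complex.I)) = ((1 + 1 / p : ℝ) : ℂ) * Complex.exp (β * Complex.I) := by
  unfold phG
  rw [w0_pow hp hβ]
  push_cast
  ring

lemma gauss_val {p β N : ℝ} (hp : 0 < p) (hN : 0 < N) {κ : ℂ} (hκ : 0 < κ.re) :
    (Complex.I * κ * Complex.exp (β / 2 * Complex.I) / Complex.exp (β * Complex.I)) *
      (Real.pi / ((1 + p) * κ ^ 2 / 2 * N)) ^ (1 / 2 : ℂ) =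
    Complex.I * Complex.exp ((-(β / 2) : ℝ) * Complex.I) * Real.sqrt (2 * Real.pi / ((1 + p) * N)) := by
  have hpi := Real.pi_pos
  set R := Real.sqrt (2 * Real.pi / ((1 + p) * N)) with hR
  have hR0 : 0 < R := Real.sqrt_pos.2 (by positivity)
  have hR2 : R ^ 2 = 2 * Real.pi / ((1 + p) * N) := Real.sq_sqrt (by positivity)
  have hκ0 : κ ≠ 0 := by rintro rfl; simp at hκ
  have hNc : (N : ℂ) ≠ 0 := by exact_mod_cast hN.ne'
  have hpc : (1 + p : ℂ) ≠ 0 := by exact_mod_cast (by positivity : (1 + p) ≠ 0)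
  have e1 : (Real.pi / ((1 + p) * κ ^ 2 / 2 * N) : ℂ) = (R / κ) ^ 2 := by
    have : ((R : ℂ)) ^ 2 = 2 * Real.pi / ((1 + p) * N) := by exact_mod_cast hR2
    rw [div_pow, this]
    field_simp
  have e2 : ((R / κ : ℂ) ^ 2) ^ (1 / 2 : ℂ) = R / κ := by
    rw [one_div]
    apply Complex.sq_cpow_two_inv
    rw [Complex.div_re]
    simp only [Complex.ofReal_re, Complex.ofReal_im, zero_mul, zero_div, add_zero]
    have := Complex.normSq_pos.2 hκ0
    positivity
  rw [e1, e2]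
  have e3 : Complex.exp (β / 2 * Complex.I) / Complex.exp (β * Complex.I) =
      Complex.exp ((-(β / 2) : ℝ) * Complex.I) := by
    rw [← Complex.exp_sub]; congr 1; push_cast; ring
  rw [← e3]
  field_simp

lemma main_im {N : ℝ} (g : ℂ) (β R : ℝ) :
    (Complex.exp (N * g) * (Complex.I * Complex.exp ((-(β / 2) : ℝ) * Complex.I) * R)).im =
      Real.exp (N * g.re) * R * Real.cos (N * g.im - β / 2) := by
  have e : Complex.exp (N * g) = (Real.exp (N * g.re) : ℂ) * Complex.exp ((N * g.im : ℝ) * Complex.I) := by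
    rw [Complex.ofReal_exp, ← Complex.exp_add]
    congr 1
    apply Complex.ext <;> simp
  have e2 : Complex.exp (N * g) * (Complex.I * Complex.exp ((-(β / 2) : ℝ) * Complex.I) * R) =
      ((Real.exp (N * g.re) * R : ℝ) : ℂ) * (Complex.I * Complex.exp ((N * g.im - β / 2 : ℝ) * Complex.I)) := by
    rw [e, show ((N * g.im - β / 2 : ℝ) * Complex.I : ℂ) = (N * g.im : ℝ) * Complex.I + (-(β / 2) : ℝ) * Complex.I by push_cast; ring, Complex.exp_add]
    push_cast
    ring
  rw [e2, Complex.im_ofReal_mul, Complex.mul_im, Complex.exp_ofReal_mul_I_re]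
  simp

lemma PathD.slit {p β : ℝ} (P : PathD p β) : ∀ x ∈ Set.Icc (-P.A) P.B, P.γ (x : ℂ) ∈ Complex.slitPlane := by
  intro x hx
  rcases hx.1.eq_or_lt with h | h
  · left; rw [← h]; exact P.hs2
  · right; exact (P.him x ⟨h, hx.2⟩).ne'

lemma PathD.taylor {p β : ℝ} (hp : 0 < p) (hβ : β = Real.pi / (1 + p)) (P : PathD p β) :
    ∃ C > 0, ∀ x ∈ Set.Icc (-P.A) P.B,
      ‖(phG p (P.γ (x : ℂ)) - phG p (P.γ 0)) + (1 + p) * P.κ ^ 2 / 2 * (x : ℂ) ^ 2‖ ≤ C * |x| ^ 3 := by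
  have hsl0 : P.γ 0 ∈ Complex.slitPlane := by
    have := P.slit 0 ⟨by linarith [P.hA], P.hB.le⟩
    simpa using this
  have hγ0 : P.γ 0 ≠ 0 := by rw [P.h0]; exact Complex.exp_ne_zero _
  have hd : ∀ᶠ z in nhds (0:ℂ), HasDerivAt (fun z => phG p (P.γ z) - phG p (P.γ 0))
      ((1 + P.γ z ^ ((-p - 1 : ℝ) : ℂ)) * deriv P.γ z) z := by
    have : ∀ᶠ z in nhds (0:ℂ), P.γ z ∈ Complex.slitPlane :=
      (P.hγ.continuous.continuousAt).eventually (Complex.isOpen_slitPlane.mem_nhds hsl0)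
    filter_upwards [this] with z hz
    exact ((phG_hasDeriv hp.ne' hz).comp z (P.hγ z).hasDerivAt).sub_const _
  have hpw : P.γ 0 ^ ((-p - 1 : ℝ) : ℂ) = -1 := by rw [P.h0]; exact w0_pow1 hp hβ
  have hγd : Differentiable ℂ (deriv P.γ) := P.hγ.deriv
  have hh2 : HasDerivAt (fun z => (1 + P.γ z ^ ((-p - 1 : ℝ) : ℂ)) * deriv P.γ z)
      (-((1 + p) * P.κ ^ 2)) 0 := by
    have h1 := ((P.hγ 0).hasDerivAt.cpow_const (c := ((-p - 1 : ℝ) : ℂ)) hsl0)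
    have h2 := (h1.const_add 1).mul (hγd 0).hasDerivAt
    convert! h2 using 1
    rw [Complex.cpow_sub _ _ hγ0, hpw, Complex.cpow_one, P.h0', P.h0]
    have e : Complex.exp (β * Complex.I) = Complex.exp (β / 2 * Complex.I) ^ 2 := by
      rw [← Complex.exp_nat_mul]; congr 1; push_cast; ring
    have e0 := Complex.exp_ne_zero (β / 2 * Complex.I)
    rw [e]
    push_cast
    field_simp
    have hI := Complex.I_sq
    linear_combination (-(1 + (p:ℂ)) * P.κ ^ 2) * hI
  obtain ⟨C, hC, δ, hδ, hT⟩ := taylor3 hd (by simp) (by rw [hpw]; simp) hh2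
  have hcont : ContinuousOn (fun x : ℝ => (phG p (P.γ (x : ℂ)) - phG p (P.γ 0)) + (1 + p) * P.κ ^ 2 / 2 * (x : ℂ) ^ 2)
      (Set.Icc (-P.A) P.B) := by
    refine ContinuousOn.add (ContinuousOn.sub ?_ continuousOn_const) (by fun_prop)
    intro x hx
    have h1 := (phG_diff (p := p) (P.slit x hx)).continuousAt
    have h2 : ContinuousAt (fun x : ℝ => P.γ (x : ℂ)) x :=
      (P.hγ.continuous.comp Complex.continuous_ofReal).continuousAt
    exact (ContinuousAt.comp (g := phG p) (f := fun x : ℝ => P.γ (x:ℂ)) h1 h2).continuousWithinAt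
  refine loc_to_glob 3 hδ hC hcont ?_
  intro x hx
  have := hT x (by simpa using hx)
  rw [Complex.norm_real, Real.norm_eq_abs] at this
  refine le_trans (le_of_eq ?_) this
  congr 1; ring

lemma PathD.amp {p β : ℝ} (P : PathD p β) :
    ∃ C > 0, ∀ x ∈ Set.Icc (-P.A) P.B,
      ‖deriv P.γ x / P.γ x - deriv P.γ 0 / P.γ 0‖ ≤ C * |x| := by
  have hγ0 : P.γ 0 ≠ 0 := by rw [P.h0]; exact Complex.exp_ne_zero _
  have hγd : Differentiable ℂ (deriv P.γ) := P.hγ.deriv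
  have hd : DifferentiableAt ℂ (fun z => deriv P.γ z / P.γ z) 0 := (hγd 0).div (P.hγ 0) hγ0
  have hO := hd.isBigO_sub
  obtain ⟨C, hC, hb⟩ := hO.exists_pos
  rw [IsBigOWith] at hb
  obtain ⟨δ, hδ, hball⟩ := Metric.eventually_nhds_iff.1 hb
  have hcont : ContinuousOn (fun x : ℝ => deriv P.γ x / P.γ x - deriv P.γ 0 / P.γ 0)
      (Set.Icc (-P.A) P.B) := by
    refine ContinuousOn.sub (ContinuousOn.div ?_ ?_ ?_) continuousOn_const
    · exact (hγd.continuous.comp Complex.continuous_ofReal).continuousOn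
    · exact (P.hγ.continuous.comp Complex.continuous_ofReal).continuousOn
    · intro x hx; exact Complex.slitPlane_ne_zero (P.slit x hx)
  have := loc_to_glob 1 hδ hC hcont (by
    intro x hx
    have := hball (y := (x:ℂ)) (by simpa using hx)
    simpa using this)
  simpa using this

theorem core {p β : ℝ} (hp : 0 < p) (hβ : β = Real.pi / (1 + p)) (P : PathD p β) :
    ∃ D > 0, ∃ m > 0, ∃ r0 > 0, ∀ N > 0, ∀ r ∈ Set.Ioc 0 r0,
      |(∫ y in Set.Ioi (0:ℝ), intF p N r (((1 / (2 * r) : ℝ) : ℂ) + y * Complex.I) * Complex.I).im -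
        Real.exp (N * ((1 + 1 / p) * Real.cos β)) * Real.sqrt (2 * Real.pi / ((1 + p) * N)) *
          Real.cos (N * ((1 + 1 / p) * Real.sin β) - β / 2)| ≤
      D * Real.exp (N * ((1 + 1 / p) * Real.cos β)) *
        ((1 / Real.sqrt N + r) / Real.sqrt N + Real.exp (-(N * m)) / r) := by
  have hpi := Real.pi_pos
  set g0 := phG p (P.γ 0) with hg0
  have hg0' : g0 = ((1 + 1 / p : ℝ) : ℂ) * Complex.exp (β * Complex.I) := by
    rw [hg0, P.h0, phG_w0 hp hβ]
  have hre : g0.re = (1 + 1 / p) * Real.cos β := by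
    rw [hg0', Complex.re_ofReal_mul, Complex.exp_ofReal_mul_I_re]
  have him : g0.im = (1 + 1 / p) * Real.sin β := by
    rw [hg0', Complex.im_ofReal_mul, Complex.exp_ofReal_mul_I_im]
  rw [← hre, ← him]
  obtain ⟨C, hC, hT⟩ := P.taylor hp hβ
  obtain ⟨C1, hC1, hA1⟩ := P.amp
  have hγR : Continuous (fun x : ℝ => P.γ (x : ℂ)) := P.hγ.continuous.comp Complex.continuous_ofReal
  have hγ'R : Continuous (fun x : ℝ => deriv P.γ (x : ℂ)) :=
    P.hγ.deriv.continuous.comp Complex.continuous_ofReal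
  obtain ⟨M0, hM0⟩ := isCompact_Icc.exists_bound_of_continuousOn (s := Set.Icc (-P.A) P.B) hγR.continuousOn
  obtain ⟨M1, hM1⟩ := isCompact_Icc.exists_bound_of_continuousOn (s := Set.Icc (-P.A) P.B) hγ'R.continuousOn
  set M := |M0| + 1 with hM
  have hMpos : 0 < M := by positivity
  have hMb : ∀ x ∈ Set.Icc (-P.A) P.B, ‖P.γ (x:ℂ)‖ < M := fun x hx =>
    lt_of_le_of_lt (hM0 x hx) (by rw [hM]; linarith [le_abs_self M0])
  set r0 := 1 / (Real.pi * M) with hr0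
  have hr0p : 0 < r0 := by positivity
  have hrM : ∀ r ∈ Set.Ioc 0 r0, Real.pi * r * M ≤ 1 := by
    intro r hr
    have : r ≤ 1 / (Real.pi * M) := hr.2
    rw [le_div_iff₀ (by positivity)] at this
    linarith
  have hrMx : ∀ r ∈ Set.Ioc 0 r0, ∀ x ∈ Set.Icc (-P.A) P.B, Real.pi * r * ‖P.γ (x:ℂ)‖ ≤ 1 := by
    intro r hr x hx
    refine le_trans ?_ (hrM r hr)
    have := hr.1
    have := (hMb x hx).le
    gcongr
  have hmem : ∀ r ∈ Set.Ioc 0 r0, ∀ x ∈ Set.Icc (-P.A) P.B, P.γ (x:ℂ) ∈ domS r := by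
    intro r hr x hx
    rcases hx.1.eq_or_lt with h | h
    · right
      rw [← h]
      refine ⟨P.hs1, P.hs2, ?_⟩
      have h2 := hMb (-P.A) ⟨le_refl _, by linarith [P.hA, P.hB]⟩
      have h3 := Complex.re_le_norm (P.γ ((-P.A : ℝ) : ℂ))
      have h4 := hrM r hr
      have h5 : M ≤ 1 / r := by
        rw [le_div_iff₀ hr.1]
        have := hr.1
        have h6 : 1 * (r * M) ≤ Real.pi * (r * M) := by
          gcongr; linarith [Real.pi_gt_three]
        linarith
      linarith
    · left; exact P.him x ⟨h, hx.2⟩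
  obtain ⟨D, hD, hlap⟩ := laplace_main (fun x => phG p (P.γ (x:ℂ)) - g0)
    (fun r x => ampQ r (P.γ (x:ℂ)) * deriv P.γ (x:ℂ)) P.A P.B r0 ((1 + p) * P.κ ^ 2 / 2)
    (deriv P.γ 0 / P.γ 0) P.hA P.hB
    (by
      have : ((1 + p) * P.κ ^ 2 / 2 : ℂ) = (((1 + p) / 2 : ℝ) : ℂ) * P.κ ^ 2 := by push_cast; ring
      rw [this, Complex.re_ofReal_mul]
      have := P.hκ2
      positivity)
    (by
      refine ContinuousOn.sub ?_ continuousOn_const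
      intro x hx
      exact (ContinuousAt.comp (g := phG p) (f := fun x : ℝ => P.γ (x:ℂ))
        (phG_diff (p := p) (P.slit x hx)).continuousAt hγR.continuousAt).continuousWithinAt)
    (by
      intro x hx hx0
      have := P.hre x hx hx0
      simp only [Complex.sub_re]
      linarith)
    C hC hT
    (by
      intro r hr
      refine ContinuousOn.mul ?_ hγ'R.continuousOn
      unfold ampQ
      refine ContinuousOn.div continuousOn_const ?_ (fun x hx => domS_sin hr.1 (hmem r hr x hx))
      exact (Complex.continuous_sin.comp (continuous_const.mul hγR)).continuousOn)
    (C1 + |M1|) (by positivity)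
    (by
      intro r hr x hx
      have hne := Complex.slitPlane_ne_zero (P.slit x hx)
      have h1 := ampQ_near hr.1 hne (hrMx r hr x hx)
      have h2 := hA1 x hx
      have h3 := (hM1 x hx).trans (le_abs_self _)
      have hr' := hr.1
      calc ‖ampQ r (P.γ (x:ℂ)) * deriv P.γ (x:ℂ) - deriv P.γ 0 / P.γ 0‖
          = ‖(ampQ r (P.γ (x:ℂ)) - 1 / P.γ (x:ℂ)) * deriv P.γ (x:ℂ) +
            (deriv P.γ (x:ℂ) / P.γ (x:ℂ) - deriv P.γ 0 / P.γ 0)‖ := by congr 1; ring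
        _ ≤ r * |M1| + C1 * |x| := by
            refine (norm_add_le _ _).trans ?_
            rw [norm_mul]
            gcongr
        _ ≤ _ := by
            have : 0 ≤ C1 * r := by positivity
            have : 0 ≤ |M1| * |x| := by positivity
            linarith)
  set v := (P.γ (P.B : ℂ)).im with hv
  have hvp : 0 < v := P.him P.B ⟨by linarith [P.hA, P.hB], le_refl _⟩
  set K := 2 / v ^ 2 * |P.xe - (P.γ (P.B : ℂ)).re| + 2 / v with hK
  have hKp : 0 < K := by positivity
  refine ⟨D + K, by positivity, P.m, P.hm, r0, hr0p, ?_⟩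
  intro N hN r hr
  have hrp := hr.1
  have hN' : 0 < N := hN
  rw [contour_eq hp hN'.le hr.1 (γ := fun x : ℝ => P.γ (x:ℂ)) (γ' := fun x : ℝ => deriv P.γ (x:ℂ))
    (a := -P.A) (b := P.B) (xe := P.xe) (v := v)
    (fun x => (P.hγ (x:ℂ)).hasDerivAt.comp_ofReal) hγ'R (by linarith [P.hA, P.hB])
    (hmem r hr) P.hs1 hvp rfl]
  set J1 := ∫ x in (-P.A)..P.B, intF p N r (P.γ (x:ℂ)) * deriv P.γ (x:ℂ) with hJ1
  set J2 := ∫ x in (P.γ (P.B:ℂ)).re..P.xe, intF p N r ((x : ℂ) + v * Complex.I) with hJ2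
  set J3 := ∫ y in Set.Ioi v, intF p N r ((P.xe : ℂ) + y * Complex.I) * Complex.I with hJ3
  have hE : Real.exp (N * (g0.re - P.m)) = Real.exp (N * g0.re) * Real.exp (-(N * P.m)) := by
    rw [← Real.exp_add]; congr 1; ring
  have b2 : ‖J2‖ ≤ Real.exp (N * g0.re) * (Real.exp (-(N * P.m)) / r) * (2 / v ^ 2 * |P.xe - (P.γ (P.B : ℂ)).re|) := by
    have := intervalIntegral.norm_integral_le_of_norm_le_const (a := (P.γ (P.B:ℂ)).re) (b := P.xe)
      (f := fun x : ℝ => intF p N r ((x : ℂ) + v * Complex.I))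
      (C := Real.exp (N * (g0.re - P.m)) * (2 / (r * v ^ 2)))
      (fun x hx => by
        have h1 := intF_bound (p := p) (r := r) hN'.le hr.1 (w := x + v * Complex.I) (by simpa using hvp)
          (P.hleft x (Set.uIoc_subset_uIcc hx))
        simpa using h1)
    refine this.trans (le_of_eq ?_)
    rw [hE]; field_simp
  have b3 : ‖J3‖ ≤ Real.exp (N * g0.re) * (Real.exp (-(N * P.m)) / r) * (2 / v) := by
    refine (ver_bound hN'.le hr.1 P.xe hvp P.hup).2.trans (le_of_eq ?_)
    rw [hE]; field_simp
  have e1 : J1 = Complex.exp (N * g0) * ∫ x in (-P.A)..P.B, Complex.exp (N * (phG p (P.γ (x:ℂ)) - g0)) *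
      (ampQ r (P.γ (x:ℂ)) * deriv P.γ (x:ℂ)) := by
    rw [hJ1, ← intervalIntegral.integral_const_mul]
    congr 1
    funext x
    unfold intF
    rw [show (N * phG p (P.γ (x:ℂ)) : ℂ) = N * g0 + N * (phG p (P.γ (x:ℂ)) - g0) by ring, Complex.exp_add]
    ring
  have hl := hlap N hN' r hr
  rw [P.h0', P.h0, gauss_val hp hN' P.hκ] at hl
  rw [← main_im g0 β, ← Complex.sub_im]
  set V := Complex.I * Complex.exp ((-(β / 2) : ℝ) * Complex.I) * Real.sqrt (2 * Real.pi / ((1 + p) * N)) with hV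
  refine (Complex.abs_im_le_norm _).trans ?_
  have b1 : ‖J1 - Complex.exp (N * g0) * V‖ ≤ Real.exp (N * g0.re) * (D * (1 / Real.sqrt N + r) / Real.sqrt N) := by
    rw [e1, ← mul_sub, norm_mul, Complex.norm_exp, Complex.re_ofReal_mul]
    gcongr
  calc ‖J1 + J2 + J3 - Complex.exp (N * g0) * V‖
      = ‖(J1 - Complex.exp (N * g0) * V) + J2 + J3‖ := by congr 1; ring
    _ ≤ _ := norm_add₃_le
    _ ≤ _ := add_le_add (add_le_add b1 b2) b3
    _ ≤ _ := by
      have hx : 0 ≤ K * Real.exp (N * g0.re) * ((1 / Real.sqrt N + r) / Real.sqrt N) := by positivity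
      have hy : 0 ≤ D * Real.exp (N * g0.re) * (Real.exp (-(N * P.m)) / r) := by positivity
      have e : (D + K) * Real.exp (N * g0.re) * ((1 / Real.sqrt N + r) / Real.sqrt N + Real.exp (-(N * P.m)) / r) =
        D * Real.exp (N * g0.re) * ((1 / Real.sqrt N + r) / Real.sqrt N) +
        Real.exp (N * g0.re) * (Real.exp (-(N * P.m)) / r) * K +
        K * Real.exp (N * g0.re) * ((1 / Real.sqrt N + r) / Real.sqrt N) +
        D * Real.exp (N * g0.re) * (Real.exp (-(N * P.m)) / r) := by ring
      rw [e, hK]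
      have e4 : Real.exp (N * g0.re) * (D * (1 / Real.sqrt N + r) / Real.sqrt N) =
        D * Real.exp (N * g0.re) * ((1 / Real.sqrt N + r) / Real.sqrt N) := by ring
      rw [e4]
      rw [hK] at hx
      linarith

lemma arg_lt_iff {c y φ : ℝ} (hc : 0 < c) (h1 : 0 < φ) (h2 : φ < Real.pi / 2) :
    ((c : ℂ) + y * Complex.I).arg < φ ↔ y < c * Real.tan φ := by
  set w : ℂ := (c : ℂ) + y * Complex.I with hw
  have hre : w.re = c := by simp [hw]
  have him : w.im = y := by simp [hw]
  have ha : |w.arg| < Real.pi / 2 := Complex.abs_arg_lt_pi_div_two_iff.2 (Or.inl (by rw [hre]; exact hc))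
  rw [abs_lt] at ha
  have ht := Complex.tan_arg w
  rw [hre, him] at ht
  rw [← Real.strictMonoOn_tan.lt_iff_lt (a := w.arg) (b := φ) ⟨ha.1, ha.2⟩ ⟨by linarith, h2⟩, ht, div_lt_iff₀ hc, mul_comm]

lemma arg_gt_iff {c y φ : ℝ} (hc : 0 < c) (h1 : 0 < φ) (h2 : φ < Real.pi / 2) :
    φ < ((c : ℂ) + y * Complex.I).arg ↔ c * Real.tan φ < y := by
  set w : ℂ := (c : ℂ) + y * Complex.I with hw
  have hre : w.re = c := by simp [hw]
  have him : w.im = y := by simp [hw]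
  have ha : |w.arg| < Real.pi / 2 := Complex.abs_arg_lt_pi_div_two_iff.2 (Or.inl (by rw [hre]; exact hc))
  rw [abs_lt] at ha
  have ht := Complex.tan_arg w
  rw [hre, him] at ht
  rw [← Real.strictMonoOn_tan.lt_iff_lt (a := φ) (b := w.arg) ⟨by linarith, h2⟩ ⟨ha.1, ha.2⟩, ht, lt_div_iff₀ hc, mul_comm]

lemma ver_re_deriv {p c : ℝ} (hp : 0 < p) (hc : 0 < c) (y : ℝ) :
    HasDerivAt (fun y : ℝ => (phG p ((c : ℂ) + y * Complex.I)).re)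
      (‖(c : ℂ) + y * Complex.I‖ ^ (-p - 1) * Real.sin ((p + 1) * ((c : ℂ) + y * Complex.I).arg)) y := by
  have hs : (c : ℂ) + y * Complex.I ∈ Complex.slitPlane := by left; simpa using hc
  have h1 : HasDerivAt (fun y : ℝ => (c : ℂ) + y * Complex.I) Complex.I y := by
    have := (((hasDerivAt_id y).ofReal_comp).mul_const Complex.I).const_add (c : ℂ)
    simpa using this
  have h2 := HasDerivAt.comp_of_eq y (phG_hasDeriv hp.ne' hs) h1 rfl
  have h3 := (Complex.reCLM.hasFDerivAt.comp_hasDerivAt y h2)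
  simp only [Complex.reCLM_apply] at h3
  convert! h3 using 1
  simp only [Complex.mul_re, Complex.I_re, Complex.I_im, mul_zero, mul_one, zero_sub, Complex.add_im, Complex.one_im, zero_add]
  rw [Complex.cpow_ofReal_im]
  rw [show ((c : ℂ) + y * Complex.I).arg * (-p - 1) = -((p + 1) * ((c : ℂ) + y * Complex.I).arg) by ring, Real.sin_neg]
  ring

lemma ver_mono {p β : ℝ} (hp : 1 < p) (hβ : β = Real.pi / (1 + p)) :
    StrictMonoOn (fun y : ℝ => (phG p ((Real.cos β : ℂ) + y * Complex.I)).re) (Set.Icc 0 (Real.sin β)) := by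
  have hpi := Real.pi_pos
  have hp0 : 0 < p := by linarith
  obtain ⟨hb0, hb1⟩ := beta_mem hp0 hβ
  have hb2 : β < Real.pi / 2 := by
    rw [hβ]; apply div_lt_div_of_pos_left hpi (by norm_num); linarith
  have hc : 0 < Real.cos β := Real.cos_pos_of_mem_Ioo ⟨by linarith, hb2⟩
  have hd := fun y => ver_re_deriv hp0 hc y
  apply strictMonoOn_of_deriv_pos (convex_Icc _ _)
  · exact fun y _ => (hd y).continuousAt.continuousWithinAt
  · intro y hy
    rw [interior_Icc] at hy
    rw [(hd y).deriv]
    have ht : y < Real.cos β * Real.tan β := by rw [mul_comm, Real.tan_mul_cos hc.ne']; exact hy.2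
    have h1 := (arg_lt_iff (y := y) hc hb0 hb2).2 ht
    have h2 : 0 < ((Real.cos β : ℂ) + y * Complex.I).arg := by
      have h3 : 0 ≤ ((Real.cos β : ℂ) + y * Complex.I).arg := by
        rw [Complex.arg_nonneg_iff]; simpa [-Complex.ofReal_cos] using hy.1.le
      rcases h3.eq_or_lt with h | h
      · exfalso
        have := Complex.arg_eq_zero_iff.1 h.symm
        simp [-Complex.ofReal_cos] at this
        linarith [this.2, hy.1]
      · exact h
    have h4 : 0 < ‖(Real.cos β : ℂ) + y * Complex.I‖ := by
      apply norm_pos_iff.2; intro h; rw [h] at h2; simp at h2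
    apply mul_pos (by positivity)
    apply Real.sin_pos_of_pos_of_lt_pi
    · positivity
    · have : (p + 1) * β = Real.pi := by rw [hβ]; field_simp; ring
      rw [← this]
      gcongr

lemma ver_anti {p β Y : ℝ} (hp : 1 < p) (hβ : β = Real.pi / (1 + p))
    (hY : ∀ y < Y, ((Real.cos β : ℂ) + y * Complex.I).arg < 2 * β) :
    StrictAntiOn (fun y : ℝ => (phG p ((Real.cos β : ℂ) + y * Complex.I)).re) (Set.Icc (Real.sin β) Y) := by
  have hpi := Real.pi_pos
  have hp0 : 0 < p := by linarith
  obtain ⟨hb0, hb1⟩ := beta_mem hp0 hβ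
  have hb2 : β < Real.pi / 2 := by
    rw [hβ]; apply div_lt_div_of_pos_left hpi (by norm_num); linarith
  have hc : 0 < Real.cos β := Real.cos_pos_of_mem_Ioo ⟨by linarith, hb2⟩
  have hd := fun y => ver_re_deriv hp0 hc y
  apply strictAntiOn_of_deriv_neg (convex_Icc _ _)
  · exact fun y _ => (hd y).continuousAt.continuousWithinAt
  · intro y hy
    rw [interior_Icc] at hy
    rw [(hd y).deriv]
    have ht : Real.cos β * Real.tan β < y := by rw [mul_comm, Real.tan_mul_cos hc.ne']; exact hy.1
    have h1 := (arg_gt_iff (y := y) hc hb0 hb2).2 ht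
    have h2 := hY y hy.2
    have h4 : 0 < ‖(Real.cos β : ℂ) + y * Complex.I‖ := by
      apply norm_pos_iff.2; intro h; rw [h] at h1; simp at h1; linarith
    apply mul_neg_of_pos_of_neg (by positivity)
    have hpb : (p + 1) * β = Real.pi := by rw [hβ]; field_simp; ring
    set a := ((Real.cos β : ℂ) + y * Complex.I).arg
    have h5 : Real.pi < (p + 1) * a := by rw [← hpb]; gcongr
    have h6 : (p + 1) * a < 2 * Real.pi := by
      rw [← hpb]
      have : (p + 1) * a < (p + 1) * (2 * β) := by gcongr
      linarith
    have := Real.sin_neg_of_neg_of_neg_pi_lt (x := (p + 1) * a - 2 * Real.pi) (by linarith) (by linarith)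
    rwa [Real.sin_sub_two_pi] at this

lemma ver_gap {p β : ℝ} (hp : 1 < p) (hβ : β = Real.pi / (1 + p)) :
    ∃ B > 0, ∃ m > 0,
      StrictAntiOn (fun y : ℝ => (phG p ((Real.cos β : ℂ) + y * Complex.I)).re)
        (Set.Icc (Real.sin β) (Real.sin β + B)) ∧
      ∀ y : ℝ, Real.sin β + B ≤ y → (phG p ((Real.cos β : ℂ) + y * Complex.I)).re ≤
        (phG p (Complex.exp (β * Complex.I))).re - m := by
  have hpi := Real.pi_pos
  have hp0 : 0 < p := by linarith
  obtain ⟨hb0, hb1⟩ := beta_mem hp0 hβ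
  have hb2 : β < Real.pi / 2 := by
    rw [hβ]; apply div_lt_div_of_pos_left hpi (by norm_num); linarith
  have hc : 0 < Real.cos β := Real.cos_pos_of_mem_Ioo ⟨by linarith, hb2⟩
  have hsin : 0 < Real.sin β := Real.sin_pos_of_pos_of_lt_pi hb0 hb1
  have hw0 : Complex.exp (β * Complex.I) = (Real.cos β : ℂ) + (Real.sin β : ℝ) * Complex.I := by
    rw [Complex.exp_mul_I]; push_cast; ring
  rcases le_or_gt (Real.pi / 2) (2 * β) with h | h
  · have hanti : ∀ Y, StrictAntiOn (fun y : ℝ => (phG p ((Real.cos β : ℂ) + y * Complex.I)).re)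
        (Set.Icc (Real.sin β) Y) := by
      intro Y
      apply ver_anti hp hβ
      intro y _
      have ha : |((Real.cos β : ℂ) + y * Complex.I).arg| < Real.pi / 2 :=
        Complex.abs_arg_lt_pi_div_two_iff.2 (Or.inl (by simpa [-Complex.ofReal_cos] using hc))
      exact lt_of_lt_of_le (abs_lt.1 ha).2 h
    refine ⟨1, one_pos, (phG p ((Real.cos β : ℂ) + (Real.sin β : ℝ) * Complex.I)).re -
      (phG p ((Real.cos β : ℂ) + (Real.sin β + 1 : ℝ) * Complex.I)).re, ?_, hanti _, ?_⟩
    · have := hanti (Real.sin β + 1) (a := Real.sin β) (b := Real.sin β + 1)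
        ⟨le_refl _, by linarith⟩ ⟨by linarith, le_refl _⟩ (by linarith)
      exact sub_pos.2 this
    · intro y hy
      rw [hw0]
      have := (hanti y).antitoneOn (a := Real.sin β + 1) (b := y)
        ⟨by linarith, hy⟩ ⟨by linarith, le_refl _⟩ hy
      linarith
  · set Y := Real.cos β * Real.tan (2 * β) with hY
    have hc2 : 0 < Real.cos (2 * β) := Real.cos_pos_of_mem_Ioo ⟨by linarith, h⟩
    have hYs : Real.sin β < Y := by
      have : Real.tan β < Real.tan (2 * β) := Real.tan_lt_tan_of_lt_of_lt_pi_div_two (by linarith) h (by linarith)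
      calc Real.sin β = Real.cos β * Real.tan β := by rw [mul_comm, Real.tan_mul_cos hc.ne']
        _ < _ := by rw [hY]; exact mul_lt_mul_of_pos_left this hc
    have hc1 : Real.cos β < 1 := by
      have := Real.sin_sq_add_cos_sq β
      nlinarith
    have hlt : Real.cos (2 * β) / Real.cos β < Real.cos β := by
      rw [div_lt_iff₀ hc, Real.cos_two_mul]; nlinarith
    have hpow : (Real.cos (2 * β) / Real.cos β) ^ p < Real.cos β := by
      calc (Real.cos (2 * β) / Real.cos β) ^ p < Real.cos β ^ p :=
            Real.rpow_lt_rpow (by positivity) hlt hp0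
        _ ≤ Real.cos β ^ (1:ℝ) := Real.rpow_le_rpow_of_exponent_ge hc hc1.le hp.le
        _ = _ := Real.rpow_one _
    refine ⟨Y - Real.sin β, by linarith, (Real.cos β - (Real.cos (2 * β) / Real.cos β) ^ p) / p,
      div_pos (by linarith) hp0, ?_, ?_⟩
    · rw [show Real.sin β + (Y - Real.sin β) = Y by ring]
      apply ver_anti hp hβ
      intro y hy
      exact (arg_lt_iff hc (by linarith) h).2 hy
    · intro y hy
      have hy : Y ≤ y := by linarith
      have hre0 : (phG p (Complex.exp (β * Complex.I))).re = (1 + 1 / p) * Real.cos β := by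
        rw [phG_w0 hp0 hβ, Complex.re_ofReal_mul, Complex.exp_ofReal_mul_I_re]
      rw [hre0]
      refine (phG_re_le hp0 _).trans ?_
      have hn : Real.cos β / Real.cos (2 * β) ≤ ‖(Real.cos β : ℂ) + y * Complex.I‖ := by
        rw [Complex.norm_add_mul_I]
        apply Real.le_sqrt_of_sq_le
        have hYe : Y = Real.cos β * Real.sin (2 * β) / Real.cos (2 * β) := by
          rw [hY, Real.tan_eq_sin_div_cos]; ring
        have e : (Real.cos β / Real.cos (2 * β)) ^ 2 = Real.cos β ^ 2 + Y ^ 2 := by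
          rw [hYe]; field_simp
          linarith [Real.sin_sq_add_cos_sq (2 * β)]
        rw [e]
        have : 0 < Y := by linarith
        gcongr
      have hq : ‖(Real.cos β : ℂ) + y * Complex.I‖ ^ (-p) ≤ (Real.cos (2 * β) / Real.cos β) ^ p := by
        calc _ ≤ (Real.cos β / Real.cos (2 * β)) ^ (-p) :=
              Real.rpow_le_rpow_of_nonpos (by positivity) hn (by linarith)
          _ = _ := by rw [Real.rpow_neg (by positivity), ← Real.inv_rpow (by positivity), inv_div]
      have : ((Real.cos β : ℂ) + y * Complex.I).re = Real.cos β := by simp [-Complex.ofReal_cos]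
      rw [this]
      have e : (1 + 1 / p) * Real.cos β - (Real.cos β - (Real.cos (2 * β) / Real.cos β) ^ p) / p =
        Real.cos β + (Real.cos (2 * β) / Real.cos β) ^ p / p := by field_simp; ring
      rw [e]
      gcongr

theorem path_big {p β : ℝ} (hp : 1 < p) (hβ : β = Real.pi / (1 + p)) : Nonempty (PathD p β) := by
  have hpi := Real.pi_pos
  have hp0 : 0 < p := by linarith
  obtain ⟨hb0, hb1⟩ := beta_mem hp0 hβ
  have hb2 : β < Real.pi / 2 := by
    rw [hβ]; apply div_lt_div_of_pos_left hpi (by norm_num); linarith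
  have hc : 0 < Real.cos β := Real.cos_pos_of_mem_Ioo ⟨by linarith, hb2⟩
  have hsin : 0 < Real.sin β := Real.sin_pos_of_pos_of_lt_pi hb0 hb1
  obtain ⟨B, hB, m, hm, hanti, hup⟩ := ver_gap hp hβ
  have hmono := ver_mono hp hβ
  have hw0 : Complex.exp (β * Complex.I) = (Real.cos β : ℂ) + (Real.sin β : ℝ) * Complex.I := by
    rw [Complex.exp_mul_I]; push_cast; ring
  set γ : ℂ → ℂ := fun z => (Real.cos β : ℂ) + ((Real.sin β : ℝ) + z) * Complex.I with hγ
  have hγx : ∀ x : ℝ, γ x = (Real.cos β : ℂ) + ((Real.sin β + x : ℝ) : ℂ) * Complex.I := by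
    intro x; simp only [hγ]; push_cast; ring
  have hγ0 : γ 0 = Complex.exp (β * Complex.I) := by rw [hw0]; simp [hγ]
  have hre : ∀ x : ℝ, (γ x).re = Real.cos β := by intro x; rw [hγx]; simp [-Complex.ofReal_cos, -Complex.ofReal_sin]
  have him : ∀ x : ℝ, (γ x).im = Real.sin β + x := by
    intro x; rw [hγx]
    simp only [Complex.add_im, Complex.ofReal_im, Complex.mul_im, Complex.ofReal_re, Complex.I_im, Complex.I_re]
    ring
  have hdγ : ∀ z, HasDerivAt γ Complex.I z := by
    intro z
    have := (((hasDerivAt_id z).const_add ((Real.sin β : ℝ) : ℂ)).mul_const Complex.I).const_add ((Real.cos β : ℝ) : ℂ)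
    rw [one_mul] at this
    exact this
  exact ⟨{
    γ := γ
    κ := Complex.exp ((-(β / 2) : ℝ) * Complex.I)
    A := Real.sin β
    B := B
    xe := Real.cos β
    m := m
    hγ := fun z => (hdγ z).differentiableAt
    hA := hsin
    hB := hB
    hm := hm
    hκ := by
      rw [Complex.exp_ofReal_mul_I_re]
      exact Real.cos_pos_of_mem_Ioo ⟨by linarith, by linarith⟩
    hκ2 := by
      have : Complex.exp ((-(β / 2) : ℝ) * Complex.I) ^ 2 = Complex.exp ((-β : ℝ) * Complex.I) := by
        rw [← Complex.exp_nat_mul]; congr 1; push_cast; ring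
      rw [this, Complex.exp_ofReal_mul_I_re, Real.cos_neg]
      exact hc
    h0 := hγ0
    h0' := by
      rw [(hdγ 0).deriv, mul_assoc, ← Complex.exp_add]
      have : ((-(β / 2) : ℝ) * Complex.I + β / 2 * Complex.I : ℂ) = 0 := by push_cast; ring
      rw [this]; simp
    hs1 := by rw [him]; ring
    hs2 := by rw [hre]; exact hc
    him := by
      intro x hx
      rw [him]; linarith [hx.1]
    hre := by
      intro x hx hx0
      rw [hγ0, hw0, hγx]
      rcases lt_or_gt_of_ne hx0 with h | h
      · exact hmono ⟨by linarith [hx.1], by linarith⟩ ⟨hsin.le, le_refl _⟩ (by linarith)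
      · exact hanti ⟨le_refl _, by linarith⟩ ⟨by linarith, by linarith [hx.2]⟩ (by linarith)
    hleft := by
      intro x hx
      rw [hre, Set.uIcc_self, Set.mem_singleton_iff] at hx
      subst hx
      rw [hγ0]
      exact hup _ (by rw [him])
    hup := by
      intro y hy
      rw [hγ0]
      rw [him] at hy
      exact hup y hy }⟩

lemma spD_anti (β : ℝ) :
    StrictAntiOn (fun x : ℝ => Real.exp x * (Real.cos (β + x) - Real.sin (β + x))) (Set.Icc (-β) (Real.pi - β)) := by
  have hd : ∀ x : ℝ, HasDerivAt (fun x : ℝ => Real.exp x * (Real.cos (β + x) - Real.sin (β + x)))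
      (-2 * Real.exp x * Real.sin (β + x)) x := by
    intro x
    have h0 : HasDerivAt (fun x : ℝ => β + x) 1 x := (hasDerivAt_id x).const_add β
    have := (Real.hasDerivAt_exp x).mul (h0.cos.sub h0.sin)
    convert! this using 1
    simp only [Pi.sub_apply]
    ring
  apply strictAntiOn_of_deriv_neg (convex_Icc _ _)
  · exact fun y _ => (hd y).continuousAt.continuousWithinAt
  · intro x hx
    rw [interior_Icc] at hx
    rw [(hd x).deriv]
    have h1 : 0 < Real.sin (β + x) := Real.sin_pos_of_pos_of_lt_pi (by linarith [hx.1]) (by linarith [hx.2])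
    have := Real.exp_pos x
    have := mul_pos this h1
    linarith

lemma spR_deriv {p : ℝ} (hp : 0 < p) (β x : ℝ) :
    HasDerivAt (fun x : ℝ => Real.exp x * Real.cos (β + x) + Real.exp (-p * x) * Real.cos (β + -p * x) / p)
      (Real.exp x * (Real.cos (β + x) - Real.sin (β + x)) -
        Real.exp (-p * x) * (Real.cos (β + -p * x) - Real.sin (β + -p * x))) x := by
  have h0 : HasDerivAt (fun x : ℝ => β + x) 1 x := (hasDerivAt_id x).const_add β
  have h1 : HasDerivAt (fun x : ℝ => -p * x) (-p) x := by simpa using (hasDerivAt_id x).const_mul (-p)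
  have h2 := h1.const_add β
  have := ((Real.hasDerivAt_exp x).mul h0.cos).add ((h1.exp.mul h2.cos).div_const p)
  convert! this using 1
  field_simp
  ring

lemma sp_phG {p β x : ℝ} (hp : 0 < p) (hβ : β = Real.pi / (1 + p)) (h1 : -β ≤ x) (h2 : x ≤ Real.pi - β) :
    (phG p (Complex.exp (β * Complex.I + (1 + Complex.I) * x))).re =
      Real.exp x * Real.cos (β + x) + Real.exp (-p * x) * Real.cos (β + -p * x) / p := by
  have hpi := Real.pi_pos
  unfold phG
  have e : (β * Complex.I + (1 + Complex.I) * x : ℂ) = x + (β + x : ℝ) * Complex.I := by push_cast; ring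
  rw [e]
  have i1 : ((x : ℂ) + (β + x : ℝ) * Complex.I).im = β + x := by simp
  rw [Complex.cpow_def_of_ne_zero (Complex.exp_ne_zero _),
    Complex.log_exp (by rw [i1]; linarith) (by rw [i1]; linarith)]
  have e2 : ((x : ℂ) + (β + x : ℝ) * Complex.I) * ((-p : ℝ) : ℂ) =
      ((-p * x : ℝ) : ℂ) + ((β + -p * x - Real.pi : ℝ) : ℂ) * Complex.I := by
    have : p * β = Real.pi - β := by rw [hβ]; field_simp; ring
    have h3 : β + -p * x - Real.pi = -p * (β + x) := by linarith
    rw [h3]; push_cast; ring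
  rw [e2, Complex.exp_add, Complex.exp_add, ← Complex.ofReal_exp, ← Complex.ofReal_exp,
    Complex.sub_re, Complex.div_ofReal_re, Complex.re_ofReal_mul, Complex.re_ofReal_mul,
    Complex.exp_ofReal_mul_I_re, Complex.exp_ofReal_mul_I_re, Real.cos_sub_pi]
  ring

lemma hor_mono {p v X : ℝ} (hp : 0 < p) (hv : 0 < v) (hX : X ≤ 0) (hXv : 1 ≤ X ^ 2 + v ^ 2) :
    MonotoneOn (fun x : ℝ => (phG p ((x : ℂ) + v * Complex.I)).re) (Set.Iic X) := by
  have hd : ∀ x : ℝ, HasDerivAt (fun x : ℝ => (phG p ((x : ℂ) + v * Complex.I)).re)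
      (1 + ((x : ℂ) + v * Complex.I) ^ ((-p - 1 : ℝ) : ℂ)).re x := by
    intro x
    have hs : (x : ℂ) + v * Complex.I ∈ Complex.slitPlane := by right; simpa using hv.ne'
    have h1 : HasDerivAt (fun x : ℝ => (x : ℂ) + v * Complex.I) 1 x := by
      have := ((hasDerivAt_id x).ofReal_comp).add_const (v * Complex.I : ℂ)
      simpa using this
    have h2 := HasDerivAt.comp_of_eq x (phG_hasDeriv hp.ne' hs) h1 rfl
    have h3 := (Complex.reCLM.hasFDerivAt.comp_hasDerivAt x h2)
    simp only [Complex.reCLM_apply, mul_one] at h3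
    exact h3
  apply monotoneOn_of_deriv_nonneg (convex_Iic _)
  · exact fun y _ => (hd y).continuousAt.continuousWithinAt
  · exact fun y _ => (hd y).differentiableAt.differentiableWithinAt
  · intro x hx
    rw [interior_Iic] at hx
    rw [(hd x).deriv, Complex.add_re, Complex.one_re]
    have hx' : x < X := hx
    have hn : 1 ≤ ‖(x : ℂ) + v * Complex.I‖ := by
      rw [Complex.norm_add_mul_I]
      apply Real.le_sqrt_of_sq_le
      nlinarith
    have h1 : ‖((x : ℂ) + v * Complex.I) ^ ((-p - 1 : ℝ) : ℂ)‖ ≤ 1 := by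
      rw [Complex.norm_cpow_real]
      exact Real.rpow_le_one_of_one_le_of_nonpos hn (by linarith)
    have h2 := (abs_le.1 ((Complex.abs_re_le_norm _).trans h1)).1
    linarith

theorem path_small {p β : ℝ} (hp : 0 < p) (hp1 : p ≤ 1) (hβ : β = Real.pi / (1 + p)) : Nonempty (PathD p β) := by
  have hpi := Real.pi_pos
  obtain ⟨hb0, hb1⟩ := beta_mem hp hβ
  have hpb : p * β = Real.pi - β := by rw [hβ]; field_simp; ring
  have hb2 : Real.pi / 2 ≤ β := by nlinarith
  set R : ℝ → ℝ := fun x => Real.exp x * Real.cos (β + x) + Real.exp (-p * x) * Real.cos (β + -p * x) / p with hR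
  have hRd := fun x => spR_deriv hp β x
  have hD := spD_anti β
  set B := (Real.pi - β) / 2 with hB
  have hBp : 0 < B := by rw [hB]; linarith
  have hmono : StrictMonoOn R (Set.Icc (-β) 0) := by
    apply strictMonoOn_of_deriv_pos (convex_Icc _ _)
    · exact fun y _ => (hRd y).continuousAt.continuousWithinAt
    · intro x hx
      rw [interior_Icc] at hx
      rw [(hRd x).deriv]
      have h1 : 0 < -p * x := by nlinarith [hx.2]
      have h2 : -p * x < Real.pi - β := by rw [← hpb]; nlinarith [hx.1]
      have := hD (a := x) (b := -p * x) ⟨by linarith [hx.1], by linarith [hx.2]⟩ ⟨by linarith, by linarith⟩ (by linarith [hx.2])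
      simp only at this
      linarith
  have hanti : StrictAntiOn R (Set.Icc 0 B) := by
    apply strictAntiOn_of_deriv_neg (convex_Icc _ _)
    · exact fun y _ => (hRd y).continuousAt.continuousWithinAt
    · intro x hx
      rw [interior_Icc] at hx
      rw [(hRd x).deriv]
      have hx1 := hx.1
      have hx2 : x < (Real.pi - β) / 2 := hx.2
      have h1 : -p * x < 0 := by nlinarith [hx.1]
      have h2 : -β ≤ -p * x := by nlinarith
      have := hD (a := -p * x) (b := x) ⟨by linarith, by linarith⟩ ⟨by linarith, by linarith⟩ (by linarith [hx.2])
      simp only at this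
      linarith
  set γ : ℂ → ℂ := fun z => Complex.exp (β * Complex.I + (1 + Complex.I) * z) with hγ
  have hγ0 : γ 0 = Complex.exp (β * Complex.I) := by simp [hγ]
  have hγx : ∀ x : ℝ, γ x = ((Real.exp x : ℝ) : ℂ) * Complex.exp ((β + x : ℝ) * Complex.I) := by
    intro x
    simp only [hγ]
    rw [Complex.ofReal_exp, ← Complex.exp_add]; congr 1; push_cast; ring
  have hre : ∀ x : ℝ, (γ x).re = Real.exp x * Real.cos (β + x) := by
    intro x; rw [hγx, Complex.re_ofReal_mul, Complex.exp_ofReal_mul_I_re]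
  have him : ∀ x : ℝ, (γ x).im = Real.exp x * Real.sin (β + x) := by
    intro x; rw [hγx, Complex.im_ofReal_mul, Complex.exp_ofReal_mul_I_im]
  have hdγ : ∀ z, HasDerivAt γ (γ z * (1 + Complex.I)) z := by
    intro z
    have := (((hasDerivAt_id z).const_mul (1 + Complex.I)).const_add (β * Complex.I : ℂ)).cexp
    simpa using this
  have hph : ∀ x : ℝ, -β ≤ x → x ≤ Real.pi - β → (phG p (γ x)).re = R x := fun x h1 h2 => sp_phG hp hβ h1 h2
  have hph0 : (phG p (γ 0)).re = R 0 := by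
    have := hph 0 (by linarith) (by linarith)
    simpa using this
  set m := R 0 - R B with hm
  have hmp : 0 < m := sub_pos.2 (hanti ⟨le_refl _, hBp.le⟩ ⟨hBp.le, le_refl _⟩ hBp)
  set X := 1 + 1 / p + |R B| + |(γ (B:ℂ)).re| with hX
  have hp' : 0 < 1 / p := by positivity
  have hX1 : 1 ≤ X := by
    have := abs_nonneg (R B)
    have := abs_nonneg (γ (B:ℂ)).re
    linarith
  have hvB : 0 < (γ (B:ℂ)).im := by
    rw [him]
    exact mul_pos (Real.exp_pos _) (Real.sin_pos_of_pos_of_lt_pi (by linarith) (by linarith))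
  have hrB : (γ (B:ℂ)).re ≤ 0 := by
    rw [hre]
    exact mul_nonpos_of_nonneg_of_nonpos (Real.exp_pos _).le
      (Real.cos_nonpos_of_pi_div_two_le_of_le (by linarith) (by linarith))
  have hnB : 1 ≤ (γ (B:ℂ)).re ^ 2 + (γ (B:ℂ)).im ^ 2 := by
    rw [hre, him]
    have := Real.sin_sq_add_cos_sq (β + B)
    have h1 : 1 ≤ Real.exp B := Real.one_le_exp hBp.le
    have e : (Real.exp B * Real.cos (β + B)) ^ 2 + (Real.exp B * Real.sin (β + B)) ^ 2 = Real.exp B ^ 2 := by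
      linear_combination Real.exp B ^ 2 * this
    rw [e]; nlinarith
  have hphB : (phG p (((γ (B:ℂ)).re : ℂ) + (γ (B:ℂ)).im * Complex.I)).re = R B := by
    rw [Complex.re_add_im]
    exact hph B (by linarith) (by linarith)
  exact ⟨{
    γ := γ
    κ := (Real.sqrt 2 : ℝ) * Complex.exp ((β / 2 - Real.pi / 4 : ℝ) * Complex.I)
    A := β
    B := B
    xe := -X
    m := m
    hγ := fun z => (hdγ z).differentiableAt
    hA := hb0
    hB := hBp
    hm := hmp
    hκ := by
      rw [Complex.re_ofReal_mul, Complex.exp_ofReal_mul_I_re]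
      exact mul_pos (by positivity) (Real.cos_pos_of_mem_Ioo ⟨by linarith, by linarith⟩)
    hκ2 := by
      have e : ((Real.sqrt 2 : ℝ) * Complex.exp ((β / 2 - Real.pi / 4 : ℝ) * Complex.I)) ^ 2 =
          ((2 : ℝ) : ℂ) * Complex.exp ((β - Real.pi / 2 : ℝ) * Complex.I) := by
        rw [mul_pow, ← Complex.ofReal_pow, Real.sq_sqrt (by norm_num), ← Complex.exp_nat_mul]
        congr 2; push_cast; ring
      rw [e, Complex.re_ofReal_mul, Complex.exp_ofReal_mul_I_re]
      exact mul_pos (by norm_num) (Real.cos_pos_of_mem_Ioo ⟨by linarith, by linarith⟩)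
    h0 := hγ0
    h0' := by
      rw [(hdγ 0).deriv, hγ0]
      have e1 : (1 + Complex.I) = Complex.I * ((Real.sqrt 2 : ℝ) * Complex.exp ((-(Real.pi / 4) : ℝ) * Complex.I)) := by
        have h2 : (Real.sqrt 2 : ℝ) * (Real.sqrt 2 / 2) = 1 := by
          have := Real.mul_self_sqrt (show (0:ℝ) ≤ 2 by norm_num)
          linarith
        apply Complex.ext
        · rw [Complex.mul_re, Complex.im_ofReal_mul, Complex.exp_ofReal_mul_I_im, Real.sin_neg, Real.sin_pi_div_four]
          simp; linarith
        · rw [Complex.mul_im, Complex.re_ofReal_mul, Complex.exp_ofReal_mul_I_re, Real.cos_neg, Real.cos_pi_div_four]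
          simp; linarith
      have e2 : Complex.exp ((β / 2 - Real.pi / 4 : ℝ) * Complex.I) * Complex.exp (β / 2 * Complex.I) =
        Complex.exp ((-(Real.pi / 4) : ℝ) * Complex.I) * Complex.exp (β * Complex.I) := by
        rw [← Complex.exp_add, ← Complex.exp_add]; congr 1; push_cast; ring
      calc _ = Complex.I * (Real.sqrt 2 : ℝ) * (Complex.exp ((-(Real.pi / 4) : ℝ) * Complex.I) * Complex.exp (β * Complex.I)) := by
            rw [e1]; ring
        _ = _ := by rw [← e2]; ring
    hs1 := by rw [him]; simp
    hs2 := by rw [hre]; simp [Real.exp_pos]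
    him := by
      intro x hx
      rw [him]
      exact mul_pos (Real.exp_pos _) (Real.sin_pos_of_pos_of_lt_pi (by linarith [hx.1]) (by linarith [hx.2]))
    hre := by
      intro x hx hx0
      rw [hph0, hph x hx.1 (by linarith [hx.2])]
      rcases lt_or_gt_of_ne hx0 with h | h
      · exact hmono ⟨hx.1, h.le⟩ ⟨by linarith, le_refl _⟩ h
      · exact hanti ⟨le_refl _, hBp.le⟩ ⟨h.le, hx.2⟩ h
    hleft := by
      intro x hx
      have hle : -X ≤ (γ (B:ℂ)).re := by
        have := abs_nonneg (R B)
        have := neg_abs_le (γ (B:ℂ)).re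
        linarith
      rw [Set.uIcc_of_ge hle] at hx
      have := hor_mono hp hvB hrB hnB (a := x) (b := (γ (B:ℂ)).re) hx.2 (Set.mem_Iic.2 (le_refl _)) hx.2
      simp only at this
      rw [hphB] at this
      rw [hph0, hm]
      linarith
    hup := by
      intro y hy
      rw [hph0, hm]
      refine (phG_re_le hp _).trans ?_
      have hn : 1 ≤ ‖((-X : ℝ) : ℂ) + y * Complex.I‖ := by
        rw [Complex.norm_add_mul_I]
        apply Real.le_sqrt_of_sq_le
        nlinarith [sq_nonneg y]
      have h1 := Real.rpow_le_one_of_one_le_of_nonpos hn (show -p ≤ 0 by linarith)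
      have h2 : ‖((-X : ℝ) : ℂ) + y * Complex.I‖ ^ (-p) / p ≤ 1 / p := by gcongr
      have h3 : (((-X : ℝ) : ℂ) + y * Complex.I).re = -X := by simp
      rw [h3]
      have := neg_abs_le (R B)
      have := abs_nonneg (γ (B:ℂ)).re
      linarith }⟩

lemma integral_conj_symm {f : ℝ → ℂ} (hs : ∀ t, f (-t) = (starRingEnd ℂ) (f t))
    (hi : IntegrableOn f (Set.Ioi 0)) : ∫ t, f t = ((2 * (∫ t in Set.Ioi (0:ℝ), f t).re : ℝ) : ℂ) := by
  have hfun : (fun t => f (-t)) = fun t => (starRingEnd ℂ) (f t) := funext hs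
  have hconj : IntegrableOn (fun t => f (-t)) (Set.Ioi 0) := by
    rw [hfun]
    exact Complex.conjCLE.toContinuousLinearMap.integrable_comp hi
  have hIio : IntegrableOn f (Set.Iio 0) := by
    have hmp := Measure.measurePreserving_neg (volume : Measure ℝ)
    have hme : MeasurableEmbedding (fun x : ℝ => -x) := (Homeomorph.neg ℝ).measurableEmbedding
    have := (hmp.integrableOn_comp_preimage hme (f := f) (s := Set.Iio 0)).1 (by
      have e : f ∘ (Neg.neg : ℝ → ℝ) = fun t => f (-t) := rfl
      simpa [e] using hconj)
    exact this
  have hIic : IntegrableOn f (Set.Iic 0) := (integrableOn_Iic_iff_integrableOn_Iio).2 hIio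
  rw [← intervalIntegral.integral_Iic_add_Ioi hIic hi]
  have h1 : ∫ t in Set.Iic (0:ℝ), f t = (starRingEnd ℂ) (∫ t in Set.Ioi (0:ℝ), f t) := by
    have := integral_comp_neg_Ioi (0:ℝ) f
    rw [neg_zero] at this
    rw [← this, ← integral_conj]
    exact congrArg (fun g : ℝ → ℂ => ∫ t in Set.Ioi (0:ℝ), g t) hfun
  rw [h1, add_comm, Complex.add_conj]

lemma E_eq {c θ p k L r N z : ℝ} (hp : p = -θ) (hp0 : 0 < p) (hk : k = c * θ) (hk0 : 0 < k)
    (hz : 0 < z) (hL : L = Real.log z) (hL0 : 0 < L)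
    (hr : r = (k / L) ^ (1 / (1 + p))) (hN : N = r * L) :
    ∫ t : ℝ, Complex.exp ((c : ℂ) * (1 / 2 + t * Complex.I) ^ (θ : ℂ)) *
        (z : ℂ) ^ ((1 / 2 : ℂ) + t * Complex.I) *
        (↑Real.pi / Complex.sin (↑Real.pi * (1 / 2 + t * Complex.I))) =
    ((2 * (∫ y in Set.Ioi (0:ℝ), intF p N r (((1 / (2 * r) : ℝ) : ℂ) + y * Complex.I) * Complex.I).im : ℝ) : ℂ) := by
  have hr0 : 0 < r := by rw [hr]; positivity
  have hN0 : 0 < N := by rw [hN]; positivity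
  have hzc : (z : ℂ) ≠ 0 := by exact_mod_cast hz.ne'
  have hrc : (r : ℂ) ≠ 0 := by exact_mod_cast hr0.ne'
  have hrel : c * r ^ θ = -(N / p) := by
    have h1 : r ^ (1 + p) = k / L := by
      rw [hr, ← Real.rpow_mul (by positivity)]
      rw [show 1 / (1 + p) * (1 + p) = 1 by field_simp, Real.rpow_one]
    have h2 : r ^ (1 + p) * r ^ θ = r := by
      rw [← Real.rpow_add hr0, show 1 + p + θ = 1 by rw [hp]; ring, Real.rpow_one]
    have h3 : k * r ^ θ = N := by
      rw [h1] at h2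
      rw [hN]
      field_simp at h2
      linarith
    have hθ : θ = -p := by linarith
    rw [hk] at h3
    rw [← h3, hθ]
    field_simp
  set f : ℝ → ℂ := fun t => Complex.exp ((c : ℂ) * (1 / 2 + t * Complex.I) ^ (θ : ℂ)) *
        (z : ℂ) ^ ((1 / 2 : ℂ) + t * Complex.I) *
        (↑Real.pi / Complex.sin (↑Real.pi * (1 / 2 + t * Complex.I))) with hf
  have hscale : ∀ y : ℝ, (r : ℂ) * f (r * y) = intF p N r (((1 / (2 * r) : ℝ) : ℂ) + y * Complex.I) := by
    intro y
    set w : ℂ := ((1 / (2 * r) : ℝ) : ℂ) + y * Complex.I with hw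
    have hs : (1 / 2 + ((r * y : ℝ) : ℂ) * Complex.I : ℂ) = r * w := by
      rw [hw]; push_cast; field_simp
    have hw0 : w ≠ 0 := by
      intro h
      have := congrArg Complex.re h
      simp [hw] at this
      exact hr0.ne' this
    simp only [hf]
    rw [hs]
    have e1 : (r * w : ℂ) ^ (θ : ℂ) = ((r ^ θ : ℝ) : ℂ) * w ^ (θ : ℂ) := by
      have hrw : (r * w : ℂ) ≠ 0 := mul_ne_zero hrc hw0
      rw [Complex.cpow_def_of_ne_zero hrw, Complex.cpow_def_of_ne_zero hw0, Complex.log_ofReal_mul hr0 hw0,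
        Real.rpow_def_of_pos hr0, Complex.ofReal_exp, ← Complex.exp_add]
      congr 1; push_cast; ring
    have e2 : (z : ℂ) ^ (r * w : ℂ) = Complex.exp (N * w) := by
      rw [Complex.cpow_def_of_ne_zero hzc, ← Complex.ofReal_log hz.le, ← hL, hN]
      congr 1; push_cast; ring
    have e3 : (c : ℂ) * (((r ^ θ : ℝ) : ℂ) * w ^ (θ : ℂ)) = -(N / p) * w ^ ((-p : ℝ) : ℂ) := by
      have : ((c * r ^ θ : ℝ) : ℂ) = ((-(N / p) : ℝ) : ℂ) := by rw [hrel]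
      push_cast at this
      rw [← mul_assoc]
      push_cast
      rw [this, hp]
      push_cast
      rw [neg_neg]
    rw [e1, e2, e3, ← Complex.exp_add]
    unfold intF phG ampQ
    rw [show (-(N / p) * w ^ ((-p : ℝ) : ℂ) + N * w : ℂ) = N * (w - w ^ ((-p : ℝ) : ℂ) / p) by ring]
    rw [mul_assoc (Real.pi : ℂ) (r : ℂ) w]
    ring
  have hsym : ∀ t, f (-t) = (starRingEnd ℂ) (f t) := by
    intro t
    simp only [hf]
    have hs : (1 / 2 + ((-t : ℝ) : ℂ) * Complex.I : ℂ) = (starRingEnd ℂ) (1 / 2 + t * Complex.I) := by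
      simp only [map_add, map_mul, map_div₀, map_one, map_ofNat, Complex.conj_ofReal, Complex.conj_I]
      push_cast; ring
    have harg : (1 / 2 + t * Complex.I : ℂ).arg ≠ Real.pi := by
      intro h
      rw [Complex.arg_eq_pi_iff] at h
      have := h.1
      norm_num at this
    have hzarg : (z : ℂ).arg ≠ Real.pi := by
      rw [Complex.arg_ofReal_of_nonneg hz.le]; exact Real.pi_pos.ne
    rw [hs]
    have e1 : ((starRingEnd ℂ) (1 / 2 + t * Complex.I)) ^ (θ : ℂ) = (starRingEnd ℂ) ((1 / 2 + t * Complex.I) ^ (θ : ℂ)) := by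
      rw [Complex.conj_cpow _ _ harg, Complex.conj_ofReal]
    have e2 : (z : ℂ) ^ ((starRingEnd ℂ) (1 / 2 + t * Complex.I)) = (starRingEnd ℂ) ((z : ℂ) ^ (1 / 2 + t * Complex.I)) := by
      rw [Complex.cpow_conj _ _ hzarg, Complex.conj_ofReal]
    rw [e1, e2]
    simp only [map_mul, map_div₀, ← Complex.exp_conj, ← Complex.sin_conj, Complex.conj_ofReal]
  have hintg := half_int (p := p) (N := N) hp0 hN0.le hr0
  have hfi : IntegrableOn f (Set.Ioi 0) := by
    have h1 : IntegrableOn (fun y : ℝ => f (r * y)) (Set.Ioi 0) := by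
      have := hintg.const_mul ((r : ℂ)⁻¹)
      refine this.congr (Eventually.of_forall fun y => ?_)
      simp only
      rw [← hscale y]
      field_simp
    have := (integrableOn_Ioi_comp_mul_left_iff f 0 hr0).1 h1
    simpa using this
  rw [integral_conj_symm hsym hfi]
  have h2 : ∫ t in Set.Ioi (0:ℝ), f t = ∫ y in Set.Ioi (0:ℝ), intF p N r (((1 / (2 * r) : ℝ) : ℂ) + y * Complex.I) := by
    have := integral_comp_mul_left_Ioi' f 0 hr0
    rw [mul_zero] at this
    rw [← this, Complex.real_smul, ← integral_const_mul]
    congr 1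
    funext y
    exact hscale y
  rw [h2, integral_mul_const]
  congr 2
  simp

lemma err_bigO {k p m μ : ℝ} (hk : 0 < k) (hp : 0 < p) (hm : 0 < m)
    (h1 : μ ≤ p / (1 + p) / 2) (h2 : μ ≤ 1 / (1 + p)) :
    (fun L : ℝ => (1 / Real.sqrt ((k / L) ^ (1 / (1 + p)) * L) + (k / L) ^ (1 / (1 + p))) /
        Real.sqrt ((k / L) ^ (1 / (1 + p)) * L) +
        Real.exp (-((k / L) ^ (1 / (1 + p)) * L * m)) / (k / L) ^ (1 / (1 + p))) =O[atTop]
      fun L : ℝ => L ^ (-(p / (1 + p) / 2) - μ) := by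
  set q := 1 / (1 + p) with hq
  set α := p / (1 + p) with hα
  have hq0 : 0 < q := by positivity
  have hα0 : 0 < α := by positivity
  have hqα : 1 - q = α := by rw [hq, hα]; field_simp; ring
  set K := k ^ q with hK
  have hK0 : 0 < K := by positivity
  have hr : ∀ L : ℝ, 0 < L → (k / L) ^ q = K * L ^ (-q) := by
    intro L hL
    rw [Real.div_rpow hk.le hL.le, Real.rpow_neg hL.le]; rfl
  have hN : ∀ L : ℝ, 0 < L → (k / L) ^ q * L = K * L ^ α := by
    intro L hL
    rw [hr L hL, mul_assoc, ← hqα, sub_eq_add_neg, add_comm (1:ℝ), Real.rpow_add hL, Real.rpow_one]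
  have hexp : (fun L : ℝ => Real.exp (-(K * m) * L ^ α)) =o[atTop]
      fun L : ℝ => (L ^ α) ^ ((-(α / 2) - μ - q) / α) :=
    (isLittleO_exp_neg_mul_rpow_atTop (by positivity : 0 < K * m) _).comp_tendsto (tendsto_rpow_atTop hα0)
  have hb := hexp.bound (c := 1) one_pos
  apply IsBigO.of_bound (1 / K + Real.sqrt K + 1 / K)
  filter_upwards [hb, eventually_ge_atTop 1] with L hbL hL1
  have hL : 0 < L := by linarith
  rw [hN L hL, hr L hL]
  rw [← Real.rpow_mul hL.le, show α * ((-(α / 2) - μ - q) / α) = -(α / 2) - μ - q by field_simp] at hbL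
  rw [Real.norm_of_nonneg (by positivity), Real.norm_of_nonneg (by positivity), one_mul] at hbL
  rw [Real.norm_of_nonneg (by positivity), Real.norm_of_nonneg (by positivity)]
  have hs : Real.sqrt (K * L ^ α) = Real.sqrt K * L ^ (α / 2) := by
    rw [Real.sqrt_mul hK0.le, Real.sqrt_eq_rpow (L ^ α), ← Real.rpow_mul hL.le]
    congr 2; ring
  have hsK : Real.sqrt K * Real.sqrt K = K := Real.mul_self_sqrt hK0.le
  have hsK0 : 0 < Real.sqrt K := Real.sqrt_pos.2 hK0
  have t1 : 1 / Real.sqrt (K * L ^ α) / Real.sqrt (K * L ^ α) ≤ 1 / K * L ^ (-(α / 2) - μ) := by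
    rw [div_div, Real.mul_self_sqrt (by positivity)]
    calc 1 / (K * L ^ α) = 1 / K * L ^ (-α) := by rw [Real.rpow_neg hL.le]; field_simp
      _ ≤ _ := by
        gcongr
        linarith
  have t2 : K * L ^ (-q) / Real.sqrt (K * L ^ α) ≤ Real.sqrt K * L ^ (-(α / 2) - μ) := by
    rw [hs]
    calc K * L ^ (-q) / (Real.sqrt K * L ^ (α / 2)) = Real.sqrt K * L ^ (-q + -(α / 2)) := by
          rw [Real.rpow_add hL, Real.rpow_neg hL.le (α / 2)]
          rw [div_eq_iff (by positivity)]
          field_simp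
          linarith
      _ ≤ _ := by
        gcongr
        linarith
  have t3 : Real.exp (-(K * L ^ α * m)) / (K * L ^ (-q)) ≤ 1 / K * L ^ (-(α / 2) - μ) := by
    have e : Real.exp (-(K * L ^ α * m)) = Real.exp (-(K * m) * L ^ α) := by congr 1; ring
    rw [e]
    calc _ ≤ L ^ (-(α / 2) - μ - q) / (K * L ^ (-q)) := by gcongr
      _ = 1 / K * L ^ (-(α / 2) - μ) := by
        rw [show -(α / 2) - μ - q = (-(α / 2) - μ) + (-q) by ring, Real.rpow_add hL]
        field_simp
  rw [add_div]
  nlinarith [t1, t2, t3]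

theorem genExp_main
    (c θ ε : ℝ) (hc : c < 0) (hθ : θ < 0) (hε : 0 < ε)
    (A₁ A₂ A₃ A₄ μ : ℝ)
    (hA₁ : A₁ = -((c * θ) ^ (1 / (2 * (θ - 1)))) * Real.sqrt (2 / (Real.pi * (1 - θ))))
    (hA₂ : A₂ = (1 - 1 / θ) * (c * θ) ^ (1 / (1 - θ)) * Real.cos (Real.pi / (1 - θ)))
    (hA₃ : A₃ = (1 - 1 / θ) * (c * θ) ^ (1 / (1 - θ)) * Real.sin (Real.pi / (1 - θ)))
    (hA₄ : A₄ = Real.pi / (2 * (θ - 1)))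
    (hμ : μ = if -2 ≤ θ then θ / (2 * (θ - 1)) - ε else 1 / (1 - θ))
    (E : ℝ → ℂ)
    (hE : ∀ z : ℝ, 0 < z → E z = -(1 / (2 * Real.pi)) * ∫ t : ℝ,
      Complex.exp ((c : ℂ) * (1 / 2 + t * Complex.I) ^ (θ : ℂ)) *
        (z : ℂ) ^ ((1 / 2 : ℂ) + t * Complex.I) *
        (↑Real.pi / Complex.sin (↑Real.pi * (1 / 2 + t * Complex.I)))) :
    (fun z : ℝ => E z -
        ((A₁ * Real.exp (A₂ * Real.log z ^ (θ / (θ - 1))) *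
            Real.log z ^ (θ / (2 * (1 - θ))) *
            Real.cos (A₃ * Real.log z ^ (θ / (θ - 1)) + A₄) : ℝ) : ℂ))
      =O[atTop] fun z : ℝ =>
        Real.exp (A₂ * Real.log z ^ (θ / (θ - 1))) *
          Real.log z ^ (θ / (2 * (1 - θ)) - μ) := by
  have hpi := Real.pi_pos
  obtain ⟨p, hpθ⟩ : ∃ p : ℝ, p = -θ := ⟨_, rfl⟩
  have hθp : θ = -p := by linarith
  have hp : 0 < p := by linarith
  obtain ⟨k, hk⟩ : ∃ k : ℝ, k = c * θ := ⟨_, rfl⟩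
  have hk0 : 0 < k := by rw [hk]; exact mul_pos_of_neg_of_neg hc hθ
  rw [← hk] at hA₁ hA₂ hA₃
  set α := p / (1 + p) with hα
  set q := 1 / (1 + p) with hq
  have hq0 : 0 < q := by positivity
  have hα0 : 0 < α := by positivity
  have hqα : 1 - q = α := by rw [hq, hα]; field_simp; ring
  have hne : -p - 1 ≠ 0 := by linarith
  have x1 : θ / (θ - 1) = α := by
    rw [hθp, hα, div_eq_div_iff (by linarith) (by linarith)]; ring
  have x2 : θ / (2 * (1 - θ)) = -(α / 2) := by
    rw [hθp, hα]
    have : 1 - -p = 1 + p := by ring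
    rw [this]; field_simp
  have x3 : 1 / (1 - θ) = q := by rw [hθp, hq]; congr 1; ring
  have x4 : 1 / (2 * (θ - 1)) = -(q / 2) := by
    rw [hθp, hq]
    have : -p - 1 = -(1 + p) := by ring
    rw [this]; field_simp
  have x5 : Real.pi / (1 - θ) = Real.pi / (1 + p) := by rw [hθp]; congr 1; ring
  have x6 : 1 - 1 / θ = 1 + 1 / p := by rw [hθp]; field_simp; ring
  have x7 : Real.pi / (2 * (θ - 1)) = -(Real.pi / (1 + p) / 2) := by
    rw [hθp]
    have : -p - 1 = -(1 + p) := by ring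
    rw [this]; field_simp
  have x8 : Real.pi * (1 - θ) = Real.pi * (1 + p) := by rw [hθp]; ring
  have x9 : θ / (2 * (θ - 1)) = α / 2 := by rw [← x1]; field_simp
  rw [x4, x8] at hA₁
  rw [x3, x5, x6] at hA₂ hA₃
  rw [x7] at hA₄
  rw [x3, x9] at hμ
  rw [x1, x2]
  obtain ⟨β, hβ⟩ : ∃ β : ℝ, β = Real.pi / (1 + p) := ⟨_, rfl⟩
  rw [← hβ] at hA₂ hA₃ hA₄
  have hμ1 : μ ≤ α / 2 ∧ μ ≤ q := by
    rw [hμ]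
    split_ifs with h
    · refine ⟨by linarith, ?_⟩
      have : α / 2 ≤ q := by
        rw [hα, hq, div_div, div_le_div_iff₀ (by positivity) (by positivity)]
        nlinarith
      linarith
    · refine ⟨?_, le_refl _⟩
      rw [hα, hq, div_div, div_le_div_iff₀ (by positivity) (by positivity)]
      nlinarith
  obtain ⟨P⟩ : Nonempty (PathD p β) := by
    rcases le_or_gt p 1 with h | h
    · exact path_small hp h hβ
    · exact path_big h hβ
  obtain ⟨D, hD, m, hm, r0, hr0, hcore⟩ := core hp hβ P
  have herr := (err_bigO hk0 hp hm hμ1.1 hμ1.2).comp_tendsto Real.tendsto_log_atTop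
  set K := k ^ q with hK
  have hK0 : 0 < K := by positivity
  have hN : ∀ L : ℝ, 0 < L → (k / L) ^ q * L = K * L ^ α := by
    intro L hL
    rw [Real.div_rpow hk0.le hL.le, ← hqα, Real.rpow_sub hL, Real.rpow_one]; field_simp; rfl
  have hrt : Tendsto (fun L : ℝ => (k / L) ^ q) atTop (nhds 0) := by
    have h1 : Tendsto (fun L : ℝ => k / L) atTop (nhds 0) := tendsto_const_nhds.div_atTop tendsto_id
    have := h1.rpow_const (p := q) (Or.inr hq0.le)
    rwa [Real.zero_rpow hq0.ne'] at this
  have hrs : ∀ᶠ z : ℝ in atTop, (k / Real.log z) ^ q < r0 :=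
    Real.tendsto_log_atTop.eventually (hrt.eventually_lt_const hr0)
  have hLs : ∀ᶠ z : ℝ in atTop, 0 < Real.log z := Real.tendsto_log_atTop.eventually_gt_atTop 0
  have hmain := (isBigO_refl (fun z : ℝ => Real.exp (A₂ * Real.log z ^ α)) atTop).mul herr
  refine IsBigO.trans ?_ hmain
  apply IsBigO.of_bound (D / Real.pi)
  filter_upwards [hrs, hLs, eventually_gt_atTop 0] with z hrz hLz hz
  simp only [Function.comp]
  obtain ⟨L, hL⟩ : ∃ L, L = Real.log z := ⟨_, rfl⟩
  rw [← hL] at hrz hLz ⊢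
  obtain ⟨r, hr⟩ : ∃ r, r = (k / L) ^ q := ⟨_, rfl⟩
  obtain ⟨N, hNd⟩ : ∃ N, N = r * L := ⟨_, rfl⟩
  rw [← hr] at hrz ⊢
  rw [← hNd]
  have hrp : 0 < r := by rw [hr]; positivity
  have hNp : 0 < N := by rw [hNd]; positivity
  have hNK : N = K * L ^ α := by rw [hNd, hr, hN L hLz]
  have hc1 := hcore N hNp r ⟨hrp, hrz.le⟩
  rw [hE z hz, E_eq hpθ hp hk hk0 hz hL hLz hr hNd]
  set J := (∫ y in Set.Ioi (0:ℝ), intF p N r (((1 / (2 * r) : ℝ) : ℂ) + y * Complex.I) * Complex.I).im with hJ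
  have y1 : N * ((1 + 1 / p) * Real.cos β) = A₂ * L ^ α := by rw [hNK, hA₂]; ring
  have y2 : N * ((1 + 1 / p) * Real.sin β) - β / 2 = A₃ * L ^ α + A₄ := by rw [hNK, hA₃, hA₄]; ring
  rw [y1, y2] at hc1
  have y3 : A₁ * L ^ (-(α / 2)) = -(1 / Real.pi) * Real.sqrt (2 * Real.pi / ((1 + p) * N)) := by
    have e1 : 2 * Real.pi / ((1 + p) * N) = (2 / (Real.pi * (1 + p))) * (Real.pi * (k ^ (-(q / 2)) * L ^ (-(α / 2)))) ^ 2 := by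
      have i1 : (k ^ (-(q / 2))) ^ 2 = K⁻¹ := by
        rw [← Real.rpow_natCast, ← Real.rpow_mul hk0.le, hK, ← Real.rpow_neg hk0.le]
        congr 1; push_cast; ring
      have i2 : (L ^ (-(α / 2))) ^ 2 = (L ^ α)⁻¹ := by
        rw [← Real.rpow_natCast, ← Real.rpow_mul hLz.le, ← Real.rpow_neg hLz.le]
        congr 1; push_cast; ring
      rw [mul_pow, mul_pow, i1, i2, hNK]
      field_simp
    rw [e1, Real.sqrt_mul (by positivity), Real.sqrt_sq (by positivity), hA₁]
    field_simp
  have e : (-(1 / (2 * Real.pi)) * ((2 * J : ℝ) : ℂ) - ((A₁ * Real.exp (A₂ * L ^ α) * L ^ (-(α / 2)) *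
      Real.cos (A₃ * L ^ α + A₄) : ℝ) : ℂ) : ℂ) =
      ((-(1 / Real.pi) * (J - Real.exp (A₂ * L ^ α) * Real.sqrt (2 * Real.pi / ((1 + p) * N)) *
        Real.cos (A₃ * L ^ α + A₄)) : ℝ) : ℂ) := by
    have e' : A₁ * Real.exp (A₂ * L ^ α) * L ^ (-(α / 2)) * Real.cos (A₃ * L ^ α + A₄) =
      (A₁ * L ^ (-(α / 2))) * Real.exp (A₂ * L ^ α) * Real.cos (A₃ * L ^ α + A₄) := by ring
    rw [e', y3]
    push_cast
    have : (Real.pi : ℂ) ≠ 0 := by exact_mod_cast hpi.ne'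
    field_simp
    ring
  rw [e, Complex.norm_real, norm_mul, norm_neg, Real.norm_of_nonneg (by positivity : 0 ≤ 1 / Real.pi), Real.norm_eq_abs]
  rw [Real.norm_of_nonneg (by positivity)]
  calc _ ≤ 1 / Real.pi * (D * Real.exp (A₂ * L ^ α) *
        ((1 / Real.sqrt N + r) / Real.sqrt N + Real.exp (-(N * m)) / r)) := by gcongr
    _ = _ := by ring

/-- **Two-saddle-point asymptotics of `E(z;c,θ)`, case `c < 0`, `θ < 0`.**  Let `E` be the
analytic continuation along the positive real axis of `∑_{n≥1} e^{c n^θ}(−z)^n`, given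
for `z > 0` by the Lindelöf integral, and set
`A₁ = −(cθ)^{1/(2(θ−1))}√(2/(π(1−θ)))`, `A₂ = (1−1/θ)(cθ)^{1/(1−θ)}cos(π/(1−θ))`,
`A₃ = (1−1/θ)(cθ)^{1/(1−θ)}sin(π/(1−θ))`, `A₄ = π/(2(θ−1))`, and
`μ = θ/(2(θ−1)) − ε` if `θ ≥ −2`, `μ = 1/(1−θ)` if `θ < −2`.  Then, as `z → +∞`,
writing `L = log z`,
`E(z) = A₁ exp(A₂ L^{θ/(θ−1)}) L^{θ/(2(1−θ))} cos(A₃ L^{θ/(θ−1)} + A₄)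
        + O(exp(A₂ L^{θ/(θ−1)}) L^{θ/(2(1−θ))−μ})`. -/
theorem genExp_asymp_c_neg_theta_neg
    (c θ ε : ℝ) (hc : c < 0) (hθ : θ < 0) (hε : 0 < ε)
    (A₁ A₂ A₃ A₄ μ : ℝ)
    (hA₁ : A₁ = -((c * θ) ^ (1 / (2 * (θ - 1)))) * Real.sqrt (2 / (Real.pi * (1 - θ))))
    (hA₂ : A₂ = (1 - 1 / θ) * (c * θ) ^ (1 / (1 - θ)) * Real.cos (Real.pi / (1 - θ)))
    (hA₃ : A₃ = (1 - 1 / θ) * (c * θ) ^ (1 / (1 - θ)) * Real.sin (Real.pi / (1 - θ)))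
    (hA₄ : A₄ = Real.pi / (2 * (θ - 1)))
    (hμ : μ = if -2 ≤ θ then θ / (2 * (θ - 1)) - ε else 1 / (1 - θ))
    (E : ℝ → ℂ)
    (hE : ∀ z : ℝ, 0 < z → E z = -(1 / (2 * Real.pi)) * ∫ t : ℝ,
      Complex.exp ((c : ℂ) * (1 / 2 + t * Complex.I) ^ (θ : ℂ)) *
        (z : ℂ) ^ ((1 / 2 : ℂ) + t * Complex.I) *
        (↑Real.pi / Complex.sin (↑Real.pi * (1 / 2 + t * Complex.I)))) :
    (fun z : ℝ => E z -
        ((A₁ * Real.exp (A₂ * Real.log z ^ (θ / (θ - 1))) *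
            Real.log z ^ (θ / (2 * (1 - θ))) *
            Real.cos (A₃ * Real.log z ^ (θ / (θ - 1)) + A₄) : ℝ) : ℂ))
      =O[atTop] fun z : ℝ =>
        Real.exp (A₂ * Real.log z ^ (θ / (θ - 1))) *
          Real.log z ^ (θ / (2 * (1 - θ)) - μ) := by
  exact genExp_main c θ ε hc hθ hε A₁ A₂ A₃ A₄ μ hA₁ hA₂ hA₃ hA₄ hμ E hE
end

section
/- As n → ∞, the alternating binomial differences of e^{±√k} satisfy: ∑_{k=0}^{n} C(n,k)·(−1)^k·e^{√k} is asymptotically equivalent to −1/√(π·log n), and ∑_{k=0}^{n} C(n,k)·(−1)^k·e^{−√k} is asymptotically equivalent to +1/√(π·log n). -/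
open Filter Asymptotics
open MeasureTheory Set

/-- `w = u - a/u` integral. -/
lemma glasser_integral (a : ℝ) (ha : 0 < a) :
    ∫ u in Ioi (0:ℝ), Real.exp (-u ^ 2 - a ^ 2 / u ^ 2) =
      Real.sqrt Real.pi / 2 * Real.exp (-2 * a) := by
  set F : ℝ → ℝ := fun u => Real.exp (-(u - a / u) ^ 2) with hF
  have hFG : ∀ u ∈ Ioi (0:ℝ), Real.exp (-u ^ 2 - a ^ 2 / u ^ 2) = Real.exp (-2 * a) * F u := by
    intro u hu
    have hu' : u ≠ 0 := (ne_of_gt hu)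
    rw [hF]; simp only
    rw [← Real.exp_add]
    congr 1
    field_simp
    ring
  have hd1 : ∀ u ∈ Ioi (0:ℝ), HasDerivWithinAt (fun u : ℝ => u - a / u) (1 + a / u ^ 2) (Ioi 0) u := by
    intro u hu
    have hu' : u ≠ 0 := (ne_of_gt hu)
    have h := ((hasDerivAt_id u).sub ((hasDerivAt_inv hu').const_mul a))
    have h2 : HasDerivAt (fun u : ℝ => u - a / u) (1 + a / u ^ 2) u := by
      simp only [div_eq_mul_inv]
      exact h.congr_deriv (by ring)
    exact h2.hasDerivWithinAt
  have hd2 : ∀ u ∈ Ioi (0:ℝ), HasDerivWithinAt (fun u : ℝ => a / u) (-(a / u ^ 2)) (Ioi 0) u := by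
    intro u hu
    have hu' : u ≠ 0 := (ne_of_gt hu)
    have h := ((hasDerivAt_inv hu').const_mul a)
    have h2 : HasDerivAt (fun u : ℝ => a / u) (-(a / u ^ 2)) u := by
      simp only [div_eq_mul_inv]
      exact h.congr_deriv (by ring)
    exact h2.hasDerivWithinAt
  have hi1 : InjOn (fun u : ℝ => u - a / u) (Ioi 0) := by
    intro x hx y hy hxy
    have hx' : 0 < x := hx
    have hy' : 0 < y := hy
    simp only at hxy
    have h : (x - y) * (x * y + a) = 0 := by
      field_simp at hxy
      linear_combination hxy
    rcases mul_eq_zero.1 h with h | h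
    · linarith
    · have := mul_pos hx' hy'
      linarith
  have hi2 : InjOn (fun u : ℝ => a / u) (Ioi 0) := by
    intro x hx y hy hxy
    have hx' : 0 < x := hx
    have hy' : 0 < y := hy
    simp only at hxy
    field_simp at hxy
    linarith
  have him1 : (fun u : ℝ => u - a / u) '' (Ioi 0) = univ := by
    ext w
    simp only [mem_image, mem_univ, iff_true]
    have hs : 0 ≤ w ^ 2 + 4 * a := by positivity
    have hlt : |w| < Real.sqrt (w ^ 2 + 4 * a) := by
      rw [← Real.sqrt_sq_eq_abs]
      exact Real.sqrt_lt_sqrt (sq_nonneg _) (by linarith)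
    have hpos : 0 < (w + Real.sqrt (w ^ 2 + 4 * a)) / 2 := by
      have := neg_abs_le w
      linarith
    refine ⟨(w + Real.sqrt (w ^ 2 + 4 * a)) / 2, hpos, ?_⟩
    have hsq := Real.sq_sqrt hs
    set s := Real.sqrt (w ^ 2 + 4 * a)
    have : w + s ≠ 0 := by linarith
    field_simp
    linear_combination hsq
  have him2 : (fun u : ℝ => a / u) '' (Ioi 0) = Ioi 0 := by
    ext w
    simp only [mem_image, mem_Ioi]
    constructor
    · rintro ⟨x, hx, rfl⟩
      positivity
    · intro hw
      exact ⟨a / w, by positivity, by field_simp⟩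
  have hg : Integrable (fun x : ℝ => Real.exp (-x ^ 2)) := by
    simpa using integrable_exp_neg_mul_sq (b := 1) one_pos
  have hIG : ∫ x : ℝ, Real.exp (-x ^ 2) = Real.sqrt Real.pi := by
    simpa using integral_gaussian 1
  have e1 := integral_image_eq_integral_abs_deriv_smul measurableSet_Ioi hd1 hi1
    (fun x => Real.exp (-x ^ 2))
  have i1 := (integrableOn_image_iff_integrableOn_abs_deriv_smul measurableSet_Ioi hd1 hi1
    (fun x => Real.exp (-x ^ 2))).1 (hg.integrableOn)
  have e2 := integral_image_eq_integral_abs_deriv_smul measurableSet_Ioi hd2 hi2 F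
  rw [him1, setIntegral_univ, hIG] at e1
  rw [him2] at e2
  have e1' : ∫ u in Ioi (0:ℝ), |1 + a / u ^ 2| • Real.exp (-(u - a / u) ^ 2)
      = ∫ u in Ioi (0:ℝ), (F u + (a / u ^ 2) * F u) := by
    refine setIntegral_congr_fun measurableSet_Ioi (fun u hu => ?_)
    have hu' : 0 < u := hu
    simp only [smul_eq_mul, hF]
    rw [abs_of_pos (by positivity)]
    ring
  have e2' : ∫ u in Ioi (0:ℝ), |-(a / u ^ 2)| • F (a / u)
      = ∫ u in Ioi (0:ℝ), (a / u ^ 2) * F u := by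
    refine setIntegral_congr_fun measurableSet_Ioi (fun u hu => ?_)
    have hu' : 0 < u := hu
    simp only [smul_eq_mul, hF]
    rw [abs_neg, abs_of_pos (by positivity)]
    congr 2
    field_simp
    ring
  have hFm : Measurable F := by
    rw [hF]; fun_prop
  have j1 : IntegrableOn F (Ioi 0) := by
    refine Integrable.mono' i1 hFm.aestronglyMeasurable ?_
    refine (ae_restrict_iff' measurableSet_Ioi).2 (Eventually.of_forall fun u hu => ?_)
    have hu' : 0 < u := hu
    simp only [smul_eq_mul, hF]
    rw [Real.norm_of_nonneg (Real.exp_pos _).le, abs_of_pos (by positivity)]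
    have : 0 < a / u ^ 2 := by positivity
    nlinarith [Real.exp_pos (-(u - a / u) ^ 2)]
  have j2 : IntegrableOn (fun u => (a / u ^ 2) * F u) (Ioi 0) := by
    refine Integrable.mono' i1 (by fun_prop) ?_
    refine (ae_restrict_iff' measurableSet_Ioi).2 (Eventually.of_forall fun u hu => ?_)
    have hu' : 0 < u := hu
    have : 0 < a / u ^ 2 := by positivity
    simp only [smul_eq_mul, hF]
    rw [Real.norm_of_nonneg (by positivity), abs_of_pos (by positivity)]
    nlinarith [Real.exp_pos (-(u - a / u) ^ 2)]
  rw [e1', integral_add j1 j2, ← e2', ← e2] at e1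
  rw [setIntegral_congr_fun measurableSet_Ioi hFG, integral_const_mul]
  rw [e1]; ring

lemma exp_neg_sqrt_repr (k : ℕ) :
    Real.exp (-Real.sqrt k) =
      2 / Real.sqrt Real.pi * ∫ u in Ioi (0:ℝ), Real.exp (-u ^ 2) * Real.exp (-(1 / (4 * u ^ 2))) ^ k := by
  have hpi : Real.sqrt Real.pi ≠ 0 := (Real.sqrt_pos.2 Real.pi_pos).ne'
  rcases Nat.eq_zero_or_pos k with rfl | hk
  · have h := integral_gaussian_Ioi 1
    simp at h
    simp [h]
    field_simp
  · have h := glasser_integral (Real.sqrt k / 2) (by positivity)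
    have : ∫ u in Ioi (0:ℝ), Real.exp (-u ^ 2) * Real.exp (-(1 / (4 * u ^ 2))) ^ k
        = ∫ u in Ioi (0:ℝ), Real.exp (-u ^ 2 - (Real.sqrt k / 2) ^ 2 / u ^ 2) := by
      refine setIntegral_congr_fun measurableSet_Ioi (fun u hu => ?_)
      have hu' : 0 < u := hu
      rw [← Real.exp_nat_mul, ← Real.exp_add, div_pow, Real.sq_sqrt (by positivity)]
      congr 1
      field_simp
      ring
    rw [this, h]
    rw [show -2 * (Real.sqrt k / 2) = -Real.sqrt k by ring]
    field_simp

lemma diff_repr (n : ℕ) :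
    ∑ k ∈ Finset.range (n + 1), (n.choose k : ℝ) * (-1 : ℝ) ^ k * Real.exp (-Real.sqrt (k : ℝ))
    = 2 / Real.sqrt Real.pi *
      ∫ u in Ioi (0:ℝ), Real.exp (-u ^ 2) * (1 - Real.exp (-(1 / (4 * u ^ 2)))) ^ n := by
  have hg : Integrable (fun x : ℝ => Real.exp (-x ^ 2)) := by
    simpa using integrable_exp_neg_mul_sq (b := 1) one_pos
  have hI : ∀ k : ℕ, IntegrableOn
      (fun u : ℝ => Real.exp (-u ^ 2) * Real.exp (-(1 / (4 * u ^ 2))) ^ k) (Ioi 0) := by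
    intro k
    refine Integrable.mono' hg.integrableOn (by fun_prop) ?_
    refine Eventually.of_forall fun u => ?_
    rw [Real.norm_of_nonneg (by positivity)]
    refine mul_le_of_le_one_right (Real.exp_pos _).le (pow_le_one₀ (Real.exp_pos _).le ?_)
    rw [Real.exp_le_one_iff]
    have : 0 ≤ 1 / (4 * u ^ 2) := by positivity
    linarith
  have : ∀ u : ℝ, Real.exp (-u ^ 2) * (1 - Real.exp (-(1 / (4 * u ^ 2)))) ^ n
      = ∑ k ∈ Finset.range (n + 1), (n.choose k : ℝ) * (-1 : ℝ) ^ k *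
        (Real.exp (-u ^ 2) * Real.exp (-(1 / (4 * u ^ 2))) ^ k) := by
    intro u
    rw [sub_eq_neg_add, add_pow, Finset.mul_sum]
    refine Finset.sum_congr rfl fun k _ => ?_
    rw [neg_pow]
    ring
  simp_rw [this]
  rw [integral_finsetSum _ (fun k _ => (hI k).const_mul _), Finset.mul_sum]
  refine Finset.sum_congr rfl fun k _ => ?_
  rw [integral_const_mul, exp_neg_sqrt_repr k]
  ring

/-- The rescaled integrand. -/
noncomputable def scaledG (n : ℕ) (v : ℝ) : ℝ :=
  Real.exp (-(v ^ 2 / (4 * Real.log n))) * (1 - Real.exp (-(Real.log n / v ^ 2))) ^ n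

lemma diff_scaled (n : ℕ) (hn : 2 ≤ n) :
    (∑ k ∈ Finset.range (n + 1),
      (n.choose k : ℝ) * (-1 : ℝ) ^ k * Real.exp (-Real.sqrt (k : ℝ))) *
      Real.sqrt (Real.pi * Real.log n) = ∫ v in Ioi (0:ℝ), scaledG n v := by
  have hL : 0 < Real.log n := Real.log_pos (by exact_mod_cast hn)
  have hsL : 0 < Real.sqrt (Real.log n) := Real.sqrt_pos.2 hL
  have hspi : 0 < Real.sqrt Real.pi := Real.sqrt_pos.2 Real.pi_pos
  have hb : 0 < (2 * Real.sqrt (Real.log n))⁻¹ := by positivity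
  have h := integral_comp_mul_left_Ioi' (fun u : ℝ =>
    Real.exp (-u ^ 2) * (1 - Real.exp (-(1 / (4 * u ^ 2)))) ^ n) 0 hb
  rw [mul_zero] at h
  rw [diff_repr, ← h, Real.sqrt_mul Real.pi_pos.le, smul_eq_mul]
  have : ∫ x in Ioi (0:ℝ), Real.exp (-((2 * Real.sqrt (Real.log n))⁻¹ * x) ^ 2) *
      (1 - Real.exp (-(1 / (4 * ((2 * Real.sqrt (Real.log n))⁻¹ * x) ^ 2)))) ^ n
      = ∫ v in Ioi (0:ℝ), scaledG n v := by
    refine setIntegral_congr_fun measurableSet_Ioi (fun v hv => ?_)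
    have hv' : 0 < v := hv
    have e : ((2 * Real.sqrt (Real.log n))⁻¹ * v) ^ 2 = v ^ 2 / (4 * Real.log n) := by
      rw [mul_pow, inv_pow, mul_pow, Real.sq_sqrt hL.le]
      ring
    have e2 : 1 / (4 * (v ^ 2 / (4 * Real.log n))) = Real.log n / v ^ 2 := by
      field_simp
    simp only [scaledG]
    rw [e, e2]
  rw [this]
  field_simp

lemma tendsto_log_nat : Tendsto (fun n : ℕ => Real.log n) atTop atTop :=
  Real.tendsto_log_atTop.comp tendsto_natCast_atTop_atTop

lemma nat_mul_exp (n : ℕ) (hn : 2 ≤ n) (v : ℝ) :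
    (n : ℝ) * Real.exp (-(Real.log n / v ^ 2)) = Real.exp (Real.log n * (1 - 1 / v ^ 2)) := by
  have hn0 : (0:ℝ) < n := by positivity
  nth_rewrite 1 [← Real.exp_log hn0]
  rw [← Real.exp_add]
  congr 1
  ring

lemma x_mem (n : ℕ) (hn : 2 ≤ n) (v : ℝ) :
    0 ≤ 1 - Real.exp (-(Real.log n / v ^ 2)) := by
  have hL : 0 < Real.log n := Real.log_pos (by exact_mod_cast hn)
  have : Real.exp (-(Real.log n / v ^ 2)) ≤ 1 := by
    rw [Real.exp_le_one_iff]
    have : 0 ≤ Real.log n / v ^ 2 := by positivity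
    linarith
  linarith

lemma pow_upper (n : ℕ) (hn : 2 ≤ n) (v : ℝ) :
    (1 - Real.exp (-(Real.log n / v ^ 2))) ^ n
      ≤ Real.exp (-Real.exp (Real.log n * (1 - 1 / v ^ 2))) := by
  rw [← nat_mul_exp n hn, ← mul_neg, Real.exp_nat_mul]
  exact pow_le_pow_left₀ (x_mem n hn v) (Real.one_sub_le_exp_neg _) n

lemma scaled_pow_le_one (n : ℕ) (hn : 2 ≤ n) (v : ℝ) :
    (1 - Real.exp (-(Real.log n / v ^ 2))) ^ n ≤ 1 :=
  pow_le_one₀ (x_mem n hn v) (by linarith [Real.exp_pos (-(Real.log n / v ^ 2))])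

lemma pow_lower (n : ℕ) (hn : 2 ≤ n) (v : ℝ) :
    1 - Real.exp (Real.log n * (1 - 1 / v ^ 2)) ≤
    (1 - Real.exp (-(Real.log n / v ^ 2))) ^ n := by
  rw [← nat_mul_exp n hn]
  have := one_add_mul_le_pow (a := -Real.exp (-(Real.log n / v ^ 2)))
    (by linarith [x_mem n hn v]) n
  rw [← sub_eq_add_neg] at this
  linarith

lemma exp_neg_le_inv (y : ℝ) (hy : 0 ≤ y) : Real.exp (-y) ≤ 1 / (1 + y) := by
  rw [Real.exp_neg, ← one_div]
  exact one_div_le_one_div_of_le (by linarith) (by linarith [Real.add_one_le_exp y])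

lemma scaledG_bound (n : ℕ) (hn : 2 ≤ n) (v : ℝ) :
    ‖scaledG n v‖ ≤ 8 * (1 + v ^ 2)⁻¹ := by
  have hL : 0 < Real.log n := Real.log_pos (by exact_mod_cast hn)
  have h0 := pow_nonneg (x_mem n hn v) n
  unfold scaledG
  rw [Real.norm_of_nonneg (mul_nonneg (Real.exp_pos _).le h0)]
  have h1 := exp_neg_le_inv (v ^ 2 / (4 * Real.log n)) (by positivity)
  rcases lt_or_ge (v ^ 2) 2 with hv | hv
  · have h2 : Real.exp (-(v ^ 2 / (4 * Real.log n))) ≤ 1 := by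
      rw [Real.exp_le_one_iff]
      have : 0 ≤ v ^ 2 / (4 * Real.log n) := by positivity
      linarith
    have h3 : (1:ℝ) ≤ 8 * (1 + v ^ 2)⁻¹ := by
      rw [← div_eq_mul_inv, le_div_iff₀ (by positivity)]
      linarith
    exact (mul_le_one₀ h2 h0 (scaled_pow_le_one n hn v)).trans h3
  · have h2 := pow_upper n hn v
    have h3 : Real.log n / 2 ≤ Real.log n * (1 - 1 / v ^ 2) := by
      have : 1 / v ^ 2 ≤ 1 / 2 := one_div_le_one_div_of_le (by norm_num) hv
      nlinarith
    have h4 : 1 + Real.log n / 2 ≤ Real.exp (Real.log n * (1 - 1 / v ^ 2)) := by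
      linarith [Real.add_one_le_exp (Real.log n * (1 - 1 / v ^ 2))]
    have h5 : Real.exp (-Real.exp (Real.log n * (1 - 1 / v ^ 2))) ≤ 1 / (2 + Real.log n / 2) := by
      refine (exp_neg_le_inv _ (Real.exp_pos _).le).trans ?_
      exact one_div_le_one_div_of_le (by positivity) (by linarith)
    refine (mul_le_mul h1 (h2.trans h5) h0 (by positivity)).trans ?_
    generalize Real.log n = L at *
    have e : 1 / (1 + v ^ 2 / (4 * L)) * (1 / (2 + L / 2)) =
      8 * L / ((4 * L + v ^ 2) * (4 + L)) := by
      field_simp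
      ring
    rw [e, ← div_eq_mul_inv, div_le_div_iff₀ (by positivity) (by positivity)]
    nlinarith [sq_nonneg v, mul_pos hL hL, mul_nonneg hL.le (sq_nonneg v)]

lemma scaledG_lim (v : ℝ) (hv : 0 < v) (hv1 : v ≠ 1) :
    Tendsto (fun n : ℕ => scaledG n v) atTop (nhds ((Iio (1:ℝ)).indicator (fun _ => (1:ℝ)) v)) := by
  have hA : Tendsto (fun n : ℕ => Real.exp (-(v ^ 2 / (4 * Real.log n)))) atTop (nhds 1) := by
    have h : Tendsto (fun n : ℕ => v ^ 2 / (4 * Real.log n)) atTop (nhds 0) :=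
      (tendsto_log_nat.const_mul_atTop (by norm_num : (0:ℝ) < 4)).const_div_atTop _
    have := (Real.continuous_exp.tendsto _).comp h.neg
    simpa [Function.comp_def] using this
  have key : Tendsto (fun n : ℕ => (1 - Real.exp (-(Real.log n / v ^ 2))) ^ n) atTop
      (nhds ((Iio (1:ℝ)).indicator (fun _ => (1:ℝ)) v)) := by
    rcases lt_or_gt_of_ne hv1 with h | h
    · rw [indicator_of_mem (by exact h)]
      have hc : 1 - 1 / v ^ 2 < 0 := by
        have : 1 < 1 / v ^ 2 := by
          rw [lt_div_iff₀ (by positivity)]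
          nlinarith
        linarith
      have h1 : Tendsto (fun n : ℕ => 1 - Real.exp (Real.log n * (1 - 1 / v ^ 2))) atTop
          (nhds 1) := by
        have := Real.tendsto_exp_atBot.comp (tendsto_log_nat.atTop_mul_const_of_neg hc)
        simpa using this.const_sub 1
      refine tendsto_of_tendsto_of_tendsto_of_le_of_le' h1 tendsto_const_nhds ?_ ?_
      · filter_upwards [eventually_ge_atTop 2] with n hn using pow_lower n hn v
      · filter_upwards [eventually_ge_atTop 2] with n hn using scaled_pow_le_one n hn v
    · rw [indicator_of_notMem (by simpa using h.le)]
      have hc : 0 < 1 - 1 / v ^ 2 := by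
        have : 1 / v ^ 2 < 1 := by
          rw [div_lt_iff₀ (by positivity)]
          nlinarith
        linarith
      have h1 : Tendsto (fun n : ℕ => Real.exp (-Real.exp (Real.log n * (1 - 1 / v ^ 2)))) atTop
          (nhds 0) :=
        Real.tendsto_exp_neg_atTop_nhds_zero.comp
          (Real.tendsto_exp_atTop.comp (tendsto_log_nat.atTop_mul_const hc))
      refine tendsto_of_tendsto_of_tendsto_of_le_of_le' tendsto_const_nhds h1 ?_ ?_
      · filter_upwards [eventually_ge_atTop 2] with n hn using pow_nonneg (x_mem n hn v) n
      · filter_upwards [eventually_ge_atTop 2] with n hn using pow_upper n hn v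
  simpa [scaledG] using hA.mul key

lemma tendsto_int : Tendsto (fun n : ℕ => ∫ v in Ioi (0:ℝ), scaledG n v) atTop (nhds 1) := by
  have e : ∫ v in Ioi (0:ℝ), (Iio (1:ℝ)).indicator (fun _ => (1:ℝ)) v = 1 := by
    rw [setIntegral_indicator measurableSet_Iio, Ioi_inter_Iio]
    simp
  rw [← e]
  refine tendsto_integral_filter_of_dominated_convergence (fun v => 8 * (1 + v ^ 2)⁻¹) ?_ ?_ ?_ ?_
  · refine Eventually.of_forall fun n => ?_
    unfold scaledG
    fun_prop
  · filter_upwards [eventually_ge_atTop 2] with n hn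
    exact Eventually.of_forall (scaledG_bound n hn)
  · exact (integrable_inv_one_add_sq.const_mul 8).integrableOn
  · rw [ae_restrict_iff' measurableSet_Ioi]
    have : ∀ᵐ v : ℝ, v ≠ 1 := Measure.ae_ne volume 1
    filter_upwards [this] with v h1 hv using scaledG_lim v hv h1

lemma tendsto_minus : Tendsto (fun n : ℕ => (∑ k ∈ Finset.range (n + 1),
      (n.choose k : ℝ) * (-1 : ℝ) ^ k * Real.exp (-Real.sqrt (k : ℝ))) *
      Real.sqrt (Real.pi * Real.log n)) atTop (nhds 1) := by
  refine tendsto_int.congr' ?_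
  filter_upwards [eventually_ge_atTop 2] with n hn using (diff_scaled n hn).symm

lemma alt_pow_zero (n j : ℕ) (h : j < n) :
    ∑ k ∈ Finset.range (n + 1), (n.choose k : ℝ) * (-1 : ℝ) ^ k * (k : ℝ) ^ j = 0 := by
  have h1 := congrFun (fwdDiff_iter_pow_eq_zero_of_lt (R := ℝ) h) 0
  rw [fwdDiff_iter_eq_sum_shift] at h1
  have h2 : ∑ k ∈ Finset.range (n + 1), (n.choose k : ℝ) * (-1 : ℝ) ^ k * (k : ℝ) ^ j
     = (-1) ^ n * ∑ k ∈ Finset.range (n + 1),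
        ((-1 : ℤ) ^ (n - k) * n.choose k) • ((0:ℝ) + k • (1:ℝ)) ^ j := by
    rw [Finset.mul_sum]
    refine Finset.sum_congr rfl fun k hk => ?_
    have hk' : k ≤ n := by simpa [Nat.lt_succ_iff] using hk
    have : (-1 : ℝ) ^ n * (-1) ^ (n - k) = (-1) ^ k := by
      rw [← pow_add, neg_one_pow_congr]
      grind
    rw [← this]
    simp
    ring
  rw [h2, h1]
  simp

lemma alt_pow_bound (n j : ℕ) :
    |∑ k ∈ Finset.range (n + 1), (n.choose k : ℝ) * (-1 : ℝ) ^ k * (k : ℝ) ^ j| ≤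
      2 ^ n * (n : ℝ) ^ j := by
  refine (Finset.abs_sum_le_sum_abs _ _).trans ?_
  have : (2:ℝ) ^ n = ∑ k ∈ Finset.range (n + 1), (n.choose k : ℝ) := by
    exact_mod_cast (Nat.sum_range_choose n).symm
  rw [this, Finset.sum_mul]
  refine Finset.sum_le_sum fun k hk => ?_
  have hk' : k ≤ n := by simpa [Nat.lt_succ_iff] using hk
  rw [abs_mul, abs_mul, abs_pow, abs_neg, abs_one, one_pow, mul_one, abs_of_nonneg (by positivity),
    abs_of_nonneg (by positivity)]
  gcongr

lemma cosh_bound (n : ℕ) :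
    |∑ k ∈ Finset.range (n + 1), (n.choose k : ℝ) * (-1 : ℝ) ^ k * Real.cosh (Real.sqrt k)| ≤
      Real.exp 4 * (1 / 2) ^ n := by
  have hs : HasSum (fun j : ℕ => ∑ k ∈ Finset.range (n + 1), (n.choose k : ℝ) * (-1 : ℝ) ^ k *
      (Real.sqrt k ^ (2 * j) / ((2 * j).factorial : ℝ)))
      (∑ k ∈ Finset.range (n + 1), (n.choose k : ℝ) * (-1 : ℝ) ^ k * Real.cosh (Real.sqrt k)) :=
    hasSum_sum fun k _ => (Real.hasSum_cosh (Real.sqrt k)).mul_left _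
  have he : HasSum (fun j : ℕ => (4:ℝ) ^ j / (j.factorial : ℝ) * (1 / 2) ^ n)
      (Real.exp 4 * (1 / 2) ^ n) := by
    have := NormedSpace.expSeries_div_hasSum_exp (4:ℝ)
    rw [← Real.exp_eq_exp_ℝ] at this
    exact this.mul_right _
  rw [← hs.tsum_eq, ← Real.norm_eq_abs]
  refine tsum_of_norm_bounded he fun j => ?_
  have e : ∑ k ∈ Finset.range (n + 1), (n.choose k : ℝ) * (-1 : ℝ) ^ k *
      (Real.sqrt k ^ (2 * j) / ((2 * j).factorial : ℝ)) =
      (∑ k ∈ Finset.range (n + 1), (n.choose k : ℝ) * (-1 : ℝ) ^ k * (k : ℝ) ^ j)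
        / ((2 * j).factorial : ℝ) := by
    rw [Finset.sum_div]
    refine Finset.sum_congr rfl fun k _ => ?_
    rw [pow_mul, Real.sq_sqrt (by positivity)]
    ring
  rw [e]
  rcases lt_or_ge j n with h | h
  · rw [alt_pow_zero n j h]
    simp only [zero_div, norm_zero]
    positivity
  · rw [Real.norm_eq_abs, abs_div, abs_of_nonneg (by positivity : (0:ℝ) ≤ ((2 * j).factorial : ℝ))]
    have hf : (j.factorial : ℝ) * (n:ℝ) ^ j ≤ ((2 * j).factorial : ℝ) := by
      have h1 : j.factorial * (j + 1) ^ j ≤ (j + j).factorial := Nat.factorial_mul_pow_le_factorial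
      have h2 : j.factorial * n ^ j ≤ (2 * j).factorial := by
        rw [two_mul]
        refine le_trans ?_ h1
        gcongr
        omega
      exact_mod_cast h2
    have hj : (0:ℝ) < j.factorial := by positivity
    have h4 : (2:ℝ) ^ n ≤ 4 ^ j * (1 / 2) ^ n := by
      have : (4:ℝ) ^ n ≤ 4 ^ j := pow_le_pow_right₀ (by norm_num) h
      calc (2:ℝ) ^ n = 4 ^ n * (1 / 2) ^ n := by rw [← mul_pow]; norm_num
        _ ≤ _ := by gcongr
    rw [div_le_iff₀ (by positivity)]
    refine (alt_pow_bound n j).trans ?_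
    calc (2:ℝ) ^ n * (n:ℝ) ^ j ≤ (4 ^ j * (1 / 2) ^ n) * (n:ℝ) ^ j := by gcongr
      _ = 4 ^ j / (j.factorial : ℝ) * (1 / 2) ^ n * ((j.factorial : ℝ) * (n:ℝ) ^ j) := by
        field_simp
      _ ≤ _ := by gcongr

lemma tendsto_cosh : Tendsto (fun n : ℕ => (∑ k ∈ Finset.range (n + 1),
      (n.choose k : ℝ) * (-1 : ℝ) ^ k * Real.cosh (Real.sqrt k)) *
      Real.sqrt (Real.pi * Real.log n)) atTop (nhds 0) := by
  have h0 := (tendsto_self_mul_const_pow_of_lt_one (r := (1/2 : ℝ)) (by norm_num)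
    (by norm_num)).const_mul (Real.exp 4 * Real.pi)
  rw [mul_zero] at h0
  refine squeeze_zero_norm' ?_ h0
  filter_upwards [eventually_ge_atTop 2] with n hn
  have hn1 : (1:ℝ) ≤ n := by exact_mod_cast (by omega : 1 ≤ n)
  have hs : Real.sqrt (Real.pi * Real.log n) ≤ Real.pi * n := by
    have hp := Real.pi_gt_three
    have hl : Real.log n ≤ n := Real.log_le_self (by positivity)
    refine Real.sqrt_le_iff.2 ⟨by positivity, ?_⟩
    have : 1 ≤ Real.pi * n := by nlinarith
    nlinarith [mul_le_mul_of_nonneg_left hl Real.pi_pos.le]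
  rw [norm_mul, Real.norm_eq_abs, Real.norm_of_nonneg (Real.sqrt_nonneg _)]
  calc _ ≤ (Real.exp 4 * (1 / 2) ^ n) * (Real.pi * n) :=
        mul_le_mul (cosh_bound n) hs (Real.sqrt_nonneg _) (by positivity)
    _ = _ := by ring

lemma tendsto_plus : Tendsto (fun n : ℕ => (∑ k ∈ Finset.range (n + 1),
      (n.choose k : ℝ) * (-1 : ℝ) ^ k * Real.exp (Real.sqrt (k : ℝ))) *
      Real.sqrt (Real.pi * Real.log n)) atTop (nhds (-1)) := by
  have h := (tendsto_cosh.const_mul 2).sub tendsto_minus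
  rw [mul_zero, zero_sub] at h
  refine h.congr fun n => ?_
  rw [← mul_assoc, ← sub_mul, Finset.mul_sum, ← Finset.sum_sub_distrib]
  congr 1
  refine Finset.sum_congr rfl fun k _ => ?_
  rw [Real.cosh_eq]
  ring

/-- As `n → ∞`, `∑_{k=0}^{n} C(n,k)(−1)^k e^{√k} ~ −1/√(π log n)` and
`∑_{k=0}^{n} C(n,k)(−1)^k e^{−√k} ~ 1/√(π log n)`. -/
theorem differences_exp_sqrt_asymp :
    ((fun n : ℕ => ∑ k ∈ Finset.range (n + 1),
        (n.choose k : ℝ) * (-1 : ℝ) ^ k * Real.exp (Real.sqrt (k : ℝ)))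
      ~[atTop] fun n : ℕ => -(1 / Real.sqrt (Real.pi * Real.log (n : ℝ)))) ∧
    ((fun n : ℕ => ∑ k ∈ Finset.range (n + 1),
        (n.choose k : ℝ) * (-1 : ℝ) ^ k * Real.exp (-Real.sqrt (k : ℝ)))
      ~[atTop] fun n : ℕ => 1 / Real.sqrt (Real.pi * Real.log (n : ℝ))) := by
  constructor
  · refine isEquivalent_of_tendsto_one ?_
    have h := tendsto_plus.neg
    rw [neg_neg] at h
    refine h.congr fun n => ?_
    simp only [Pi.div_apply, div_neg, div_div_eq_mul_div, div_one]
  · refine isEquivalent_of_tendsto_one ?_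
    refine tendsto_minus.congr fun n => ?_
    simp only [Pi.div_apply, div_div_eq_mul_div, div_one]
end

section
/- As n → ∞, ∑_{k=1}^{n} C(n,k)·(−1)^k·e^{1/k} is asymptotically equivalent to −e^{2√(log n)} / (2√π·(log n)^{1/4}). -/
open Filter Asymptotics
lemma hda {f g : ℝ → ℝ} {f' g' x : ℝ} (h : HasDerivAt f f' x) (hf : g = f) (hf' : g' = f') :
    HasDerivAt g g' x := by subst hf; subst hf'; exact h

noncomputable def aa (n m : ℕ) : ℝ :=
  ∑ k ∈ Finset.range n, (n.choose (k+1) : ℝ) * (-1 : ℝ) ^ k * (1 / ((k:ℝ)+1)) ^ m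

lemma aa_rec (n m : ℕ) : aa (n+1) (m+1) = aa n (m+1) + aa (n+1) m / ((n:ℝ)+1) := by
  have h : aa n (m+1) = ∑ k ∈ Finset.range (n+1), (n.choose (k+1) : ℝ) * (-1 : ℝ) ^ k * (1 / ((k:ℝ)+1)) ^ (m+1) := by
    rw [Finset.sum_range_succ]; simp [aa]
  rw [h, aa, aa, Finset.sum_div, ← Finset.sum_add_distrib]
  refine Finset.sum_congr rfl fun k _ => ?_
  have h1 : ((n:ℝ)+1) * (n.choose k : ℝ) = ((n+1).choose (k+1) : ℝ) * ((k:ℝ)+1) := by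
    exact_mod_cast Nat.add_one_mul_choose_eq n k
  have h2 : ((n+1).choose (k+1) : ℝ) = n.choose k + n.choose (k+1) := by
    exact_mod_cast Nat.choose_succ_succ n k
  have hn : ((n:ℝ)+1) ≠ 0 := by positivity
  have hk : ((k:ℝ)+1) ≠ 0 := by positivity
  have h3 : (n.choose k : ℝ) = ((n+1).choose (k+1) : ℝ) * ((k:ℝ)+1) / ((n:ℝ)+1) := by
    rw [← h1]; field_simp
  have h4 : ((n+1).choose (k+1) : ℝ) / ((n:ℝ)+1) = n.choose k * (1 / ((k:ℝ)+1)) := by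
    rw [h3]; field_simp
  calc _ = ((n+1).choose (k+1) : ℝ) * (-1 : ℝ) ^ k * (1 / ((k:ℝ)+1)) ^ (m+1) := rfl
    _ = (n.choose (k+1) : ℝ) * (-1 : ℝ) ^ k * (1 / ((k:ℝ)+1)) ^ (m+1) 
        + (n.choose k * (1 / ((k:ℝ)+1))) * (-1 : ℝ) ^ k * (1 / ((k:ℝ)+1)) ^ m := by
          rw [h2]; ring
    _ = _ := by rw [← h4]; ring

lemma aa_zero (n : ℕ) : aa (n+1) 0 = 1 := by
  have h := add_pow (-1:ℝ) 1 (n+1)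
  rw [Finset.sum_range_succ'] at h
  simp only [aa]
  have : ∑ k ∈ Finset.range (n + 1), ((n + 1).choose (k + 1) : ℝ) * (-1) ^ k * (1 / ((k:ℝ) + 1)) ^ 0 = 
    - ∑ k ∈ Finset.range (n + 1), (-1:ℝ) ^ (k + 1) * 1 ^ (n + 1 - (k + 1)) * ((n + 1).choose (k + 1)) := by
    rw [← Finset.sum_neg_distrib]
    refine Finset.sum_congr rfl fun k _ => ?_
    simp [pow_succ]; ring
  rw [this]
  simp at h ⊢
  linarith

lemma aa_one (m : ℕ) : aa 1 m = 1 := by simp [aa]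

noncomputable def gg (s : ℝ) (m : ℕ) : ℝ := ∑ j ∈ Finset.range (m+1), s ^ j / (j.factorial : ℝ)

lemma gg_succ (s : ℝ) (m : ℕ) : gg s (m+1) = gg s m + s^(m+1) / ((m+1).factorial : ℝ) := by
  rw [gg, Finset.sum_range_succ]; rfl

lemma pow_fact_deriv (m : ℕ) (s : ℝ) :
    HasDerivAt (fun s : ℝ => s^(m+1) / ((m+1).factorial : ℝ)) (s^m / (m.factorial : ℝ)) s := by
  have h := (hasDerivAt_pow (m+1) s).div_const ((m+1).factorial : ℝ)
  refine hda h rfl ?_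
  rw [Nat.factorial_succ]; push_cast
  have : (m.factorial : ℝ) ≠ 0 := by positivity
  have : (m:ℝ)+1 ≠ 0 := by positivity
  field_simp

lemma gg_deriv (m : ℕ) (s : ℝ) : HasDerivAt (fun s => gg s (m+1)) (gg s m) s := by
  induction m with
  | zero => 
    have := (hasDerivAt_id s).const_add 1
    refine hda this ?_ ?_
    · ext x; simp [gg, Finset.sum_range_succ]
    · simp [gg]
  | succ m ih =>
    have := ih.add (pow_fact_deriv (m+1) s)
    rw [gg_succ s m]
    refine hda this ?_ rfl
    ext x; rw [gg_succ x (m+1)]; rfl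

lemma gg_deriv' (m : ℕ) (s : ℝ) : 
    HasDerivAt (fun s => gg s m) (gg s m - s^m / (m.factorial : ℝ)) s := by
  cases m with
  | zero => 
    have := hasDerivAt_const s (1:ℝ)
    refine hda this ?_ ?_
    · ext x; simp [gg]
    · simp [gg]
  | succ m => 
    refine hda (gg_deriv m s) rfl ?_
    rw [gg_succ]; ring

lemma gg_exp_anti (m : ℕ) {s b : ℝ} (hs : 0 ≤ s) (hsb : s ≤ b) :
    Real.exp (s - b) * gg b m ≤ gg s m := by
  have key : AntitoneOn (fun x => Real.exp (-x) * gg x m) (Set.Ici 0) := by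
    have hd : ∀ x, HasDerivAt (fun x => Real.exp (-x) * gg x m) 
      (-(Real.exp (-x) * (x^m / (m.factorial : ℝ)))) x := by
      intro x
      have := ((hasDerivAt_neg x).exp).mul (gg_deriv' m x)
      refine hda this rfl ?_
      ring
    apply antitoneOn_of_deriv_nonpos (convex_Ici 0)
    · exact fun x _ => (hd x).continuousAt.continuousWithinAt
    · exact fun x _ => (hd x).differentiableAt.differentiableWithinAt
    · intro x hx
      simp at hx
      rw [(hd x).deriv]
      have : 0 ≤ Real.exp (-x) * (x^m / (m.factorial : ℝ)) := by positivity
      linarith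
  have h := key (Set.mem_Ici.2 hs) (Set.mem_Ici.2 (hs.trans hsb)) hsb
  simp only at h
  have h2 := mul_le_mul_of_nonneg_left h (Real.exp_pos s).le
  rw [← mul_assoc, ← mul_assoc, ← Real.exp_add, ← Real.exp_add] at h2
  simpa [sub_eq_add_neg] using h2

lemma gg_step (m : ℕ) {a b : ℝ} (ha : 0 ≤ a) (hab : a ≤ b) :
    gg a (m+1) + (1 - Real.exp (a - b)) * gg b m ≤ gg b (m+1) := by
  have hd : ∀ x, HasDerivAt (fun x => gg x (m+1) - Real.exp (x - b) * gg b m) 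
      (gg x m - Real.exp (x - b) * gg b m) x := by
    intro x
    have := (gg_deriv m x).sub ((((hasDerivAt_id x).sub_const b).exp).mul_const (gg b m))
    refine hda this rfl ?_
    simp
  have key : MonotoneOn (fun x => gg x (m+1) - Real.exp (x - b) * gg b m) (Set.Icc a b) := by
    apply monotoneOn_of_deriv_nonneg (convex_Icc a b)
    · exact fun x _ => (hd x).continuousAt.continuousWithinAt
    · exact fun x _ => (hd x).differentiableAt.differentiableWithinAt
    · intro x hx
      rw [interior_Icc] at hx
      rw [(hd x).deriv]
      have := gg_exp_anti m (ha.trans hx.1.le) hx.2.le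
      linarith
  have h := key (Set.left_mem_Icc.2 hab) (Set.right_mem_Icc.2 hab) hab
  simp at h
  linarith

lemma aa_le (n : ℕ) : ∀ m, aa (n+1) m ≤ gg (Real.log ((n:ℝ)+1)) m := by
  induction n with
  | zero => 
    intro m
    rw [aa_one]
    simp [gg, Finset.sum_range_succ']
  | succ n ih =>
    intro m
    induction m with
    | zero => rw [aa_zero]; simp [gg]
    | succ m ihm =>
      rw [aa_rec]
      have hn : (0:ℝ) < (n:ℝ)+1 := by positivity
      have h := gg_step m (a := Real.log ((n:ℝ)+1)) (b := Real.log (((n+1:ℕ):ℝ)+1)) 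
        (Real.log_nonneg (by simp)) (Real.log_le_log hn (by push_cast; linarith))
      rw [Real.exp_sub, Real.exp_log hn, Real.exp_log (by positivity)] at h
      have e : 1 - ((n:ℝ)+1) / (((n+1:ℕ):ℝ)+1) = 1 / (((n+1:ℕ):ℝ)+1) := by
        have : (((n+1:ℕ):ℝ)+1) ≠ 0 := by positivity
        field_simp; push_cast; ring
      rw [e] at h
      have h2 : aa (n+1+1) m / (((n+1:ℕ):ℝ)+1) ≤ 1 / (((n+1:ℕ):ℝ)+1) * gg (Real.log (((n+1:ℕ):ℝ)+1)) m := by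
        rw [div_eq_inv_mul, one_div]
        exact mul_le_mul_of_nonneg_left ihm (by positivity)
      linarith [ih (m+1)]

lemma le_aa (n : ℕ) : ∀ m, (Real.log ((n:ℝ)+2)) ^ m / (m.factorial : ℝ) ≤ aa (n+1) m := by
  induction n with
  | zero => 
    intro m
    rw [aa_one]
    have h0 : 0 ≤ Real.log 2 := Real.log_nonneg (by norm_num)
    have h1 : Real.log 2 ≤ 1 := by linarith [Real.log_two_lt_d9]
    have hm : (1:ℝ) ≤ m.factorial := by exact_mod_cast Nat.one_le_iff_ne_zero.2 (Nat.factorial_ne_zero m)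
    rw [div_le_one (by positivity)]
    simpa using (pow_le_one₀ h0 h1).trans hm
  | succ n ih =>
    intro m
    induction m with
    | zero => rw [aa_zero]; simp
    | succ m ihm =>
      rw [aa_rec]
      set b := Real.log (((n+1:ℕ):ℝ)+2) with hb
      set a := Real.log ((n:ℝ)+2) with ha
      have ha0 : 0 ≤ a := Real.log_nonneg (by linarith [(Nat.cast_nonneg n : (0:ℝ) ≤ n)])
      have hab : a ≤ b := Real.log_le_log (by positivity) (by push_cast; linarith)
      have hd : b - a ≤ 1 / (((n+1:ℕ):ℝ)+1) := by
        rw [hb, ha, ← Real.log_div (by positivity) (by positivity)]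
        refine (Real.log_le_sub_one_of_pos (by positivity)).trans (le_of_eq ?_)
        push_cast
        have : (n:ℝ)+2 ≠ 0 := by positivity
        have : (n:ℝ)+1+1 ≠ 0 := by positivity
        field_simp; ring
      -- mean value
      have hmv : b^(m+1)/((m+1).factorial:ℝ) - a^(m+1)/((m+1).factorial:ℝ) ≤ (b-a) * (b^m/(m.factorial:ℝ)) := by
        have := (convex_Icc a b).image_sub_le_mul_sub_of_deriv_le (f := fun s : ℝ => s^(m+1)/((m+1).factorial:ℝ)) (C := b^m/(m.factorial:ℝ))
          (fun x _ => (pow_fact_deriv m x).continuousAt.continuousWithinAt)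
          (fun x _ => (pow_fact_deriv m x).differentiableAt.differentiableWithinAt)
          (by
            intro x hx
            rw [interior_Icc] at hx
            rw [(pow_fact_deriv m x).deriv]
            have := hx.1; have := hx.2
            gcongr
            linarith) a (Set.left_mem_Icc.2 hab) b (Set.right_mem_Icc.2 hab) hab
        linarith
      have h2 : (b-a) * (b^m/(m.factorial:ℝ)) ≤ 1 / (((n+1:ℕ):ℝ)+1) * aa (n+1+1) m := by
        apply mul_le_mul hd ihm _ (by positivity)
        have : 0 ≤ b := ha0.trans hab
        positivity
      have h3 : aa (n+1+1) m / (((n+1:ℕ):ℝ)+1) = 1 / (((n+1:ℕ):ℝ)+1) * aa (n+1+1) m := by ring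
      linarith [ih (m+1)]

noncomputable def FF (t : ℝ) : ℝ := ∑' m : ℕ, t ^ m / ((m.factorial : ℝ) ^ 2)

lemma FF_summable {t : ℝ} (ht : 0 ≤ t) : Summable fun m : ℕ => t ^ m / ((m.factorial : ℝ) ^ 2) := by
  refine Summable.of_nonneg_of_le (fun m => by positivity) (fun m => ?_) (Real.summable_pow_div_factorial t)
  have hm : (1:ℝ) ≤ m.factorial := by exact_mod_cast Nat.one_le_iff_ne_zero.2 (Nat.factorial_ne_zero m)
  gcongr
  nlinarith

lemma FF_mono {s t : ℝ} (hs : 0 ≤ s) (hst : s ≤ t) : FF s ≤ FF t := by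
  refine Summable.tsum_le_tsum (fun m => ?_) (FF_summable hs) (FF_summable (hs.trans hst))
  gcongr

lemma FF_pos {t : ℝ} (ht : 0 ≤ t) : 0 < FF t := 
  (FF_summable ht).tsum_pos (fun m => by positivity) 0 (by simp)

noncomputable def SS (n : ℕ) : ℝ := - ∑ k ∈ Finset.Icc 1 n,
        (n.choose k : ℝ) * (-1 : ℝ) ^ k * Real.exp (1 / (k : ℝ))

lemma SS_hasSum (n : ℕ) : HasSum (fun m => aa n m / (m.factorial : ℝ)) (SS n) := by
  have e : SS n = ∑ k ∈ Finset.range n, (n.choose (k+1) : ℝ) * (-1 : ℝ) ^ k * Real.exp (1 / ((k:ℝ)+1)) := by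
    have h := Finset.sum_Ico_add' (fun k : ℕ => (n.choose k : ℝ) * (-1 : ℝ) ^ (k-1) * Real.exp (1 / (k:ℝ))) 0 n 1
    rw [← Finset.range_eq_Ico] at h
    simp only [Nat.add_sub_cancel, Nat.cast_add, Nat.cast_one] at h
    rw [h, SS, ← Finset.sum_neg_distrib]
    · rw [zero_add, Finset.Ico_add_one_right_eq_Icc]
      refine Finset.sum_congr rfl fun k hk => ?_
      obtain ⟨j, rfl⟩ := Nat.exists_eq_add_of_le' (Finset.mem_Icc.1 hk).1
      simp [pow_succ]
  rw [e]
  have : (fun m => aa n m / (m.factorial : ℝ)) = fun m => ∑ k ∈ Finset.range n, (n.choose (k+1) : ℝ) * (-1 : ℝ) ^ k * ((1 / ((k:ℝ)+1)) ^ m / (m.factorial:ℝ)) := by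
    ext m; rw [aa, Finset.sum_div]
    exact Finset.sum_congr rfl fun k _ => by ring
  rw [this]
  refine hasSum_sum fun k _ => HasSum.mul_left _ ?_
  rw [Real.exp_eq_exp_ℝ]
  exact NormedSpace.expSeries_div_hasSum_exp _

lemma SS_lower (n : ℕ) : FF (Real.log ((n:ℝ)+1)) ≤ SS (n+1) := by
  have h0 : 0 ≤ Real.log ((n:ℝ)+1) := Real.log_nonneg (by simp)
  have h1 : Real.log ((n:ℝ)+1) ≤ Real.log ((n:ℝ)+2) := Real.log_le_log (by positivity) (by linarith)
  refine (FF_mono h0 h1).trans ?_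
  rw [← (SS_hasSum (n+1)).tsum_eq]
  refine Summable.tsum_le_tsum (fun m => ?_) (FF_summable (h0.trans h1)) (SS_hasSum (n+1)).summable
  rw [pow_two, ← div_div]
  gcongr
  exact le_aa n m

lemma SS_upper (n : ℕ) (h : 1 < Real.log ((n:ℝ)+1)) : 
    SS (n+1) ≤ FF (Real.log ((n:ℝ)+1)) * (1 - 1 / √(Real.log ((n:ℝ)+1)))⁻¹ := by
  set L := Real.log ((n:ℝ)+1) with hL
  have hs1 : 1 < √L := by rw [Real.lt_sqrt (by norm_num)]; simpa using h
  set r := √L with hr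
  have hrr : L = r^2 := by rw [hr, Real.sq_sqrt (by linarith)]
  have hr0 : 0 < r := by linarith
  set q := 1 / r with hq
  have hq0 : 0 ≤ q := by positivity
  have hq1 : q < 1 := by rw [hq, div_lt_one hr0]; exact hs1
  set x : ℕ → ℝ := fun l => r^l / (l.factorial:ℝ) with hx
  have hxF : ∀ l, x l ^ 2 = L ^ l / ((l.factorial:ℝ)^2) := by
    intro l; simp only [hx]; rw [div_pow, hrr, ← pow_mul, ← pow_mul, mul_comm]
  have hgeo := summable_geometric_of_lt_one hq0 hq1
  have hgs := tsum_geometric_of_lt_one hq0 hq1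
  have hFs := FF_summable (t := L) (by linarith)
  have hFs' : Summable fun l => x l ^ 2 := by simpa only [hxF] using hFs
  have hFF : ∑' l, x l ^ 2 = FF L := by simp only [hxF]; rfl
  have hc : HasSum (fun m => ∑ k ∈ Finset.range (m+1), x k ^ 2 * q ^ (m - k)) (FF L * (1-q)⁻¹) := by
    rw [← hFF, ← hgs, tsum_mul_tsum_eq_tsum_sum_range_of_summable_norm hFs'.norm hgeo.norm]
    exact (summable_norm_sum_mul_range_of_summable_norm hFs'.norm hgeo.norm).of_norm.hasSum
  have hd : HasSum (fun m => x m ^ 2 * (1-q)⁻¹) (FF L * (1-q)⁻¹) := by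
    rw [← hFF]; exact hFs'.hasSum.mul_right _
  have htot := (hc.add hd).mul_left (1/2)
  have hle : ∀ m, aa (n+1) m / (m.factorial : ℝ) ≤ 1/2 * ((∑ k ∈ Finset.range (m+1), x k ^ 2 * q ^ (m - k)) + x m ^ 2 * (1-q)⁻¹) := by
    intro m
    have h1 : aa (n+1) m / (m.factorial : ℝ) ≤ gg L m / (m.factorial : ℝ) := by
      gcongr; exact aa_le n m
    have h2 : gg L m / (m.factorial : ℝ) = ∑ k ∈ Finset.range (m+1), q ^ (m-k) * x k * x m := by
      rw [gg, Finset.sum_div]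
      refine Finset.sum_congr rfl fun k hk => ?_
      obtain ⟨j, rfl⟩ := Nat.exists_eq_add_of_le (Nat.lt_succ_iff.1 (Finset.mem_range.1 hk))
      simp only [hx, hq, hrr, Nat.add_sub_cancel_left]
      have : ((k+j).factorial : ℝ) ≠ 0 := by positivity
      have : (k.factorial : ℝ) ≠ 0 := by positivity
      have e : (r^2)^k = (1/r)^j * r^k * r^(k+j) := by
        rw [div_pow, one_pow]; field_simp; ring
      rw [e]; field_simp
    have h3 : ∑ k ∈ Finset.range (m+1), q ^ (m-k) ≤ (1-q)⁻¹ := by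
      rw [← hgs]
      have e : ∑ k ∈ Finset.range (m+1), q ^ (m-k) = ∑ k ∈ Finset.range (m+1), q ^ k := by
        have := Finset.sum_range_reflect (fun k => q^k) (m+1)
        simpa using this
      rw [e]
      exact hgeo.sum_le_tsum _ (fun i _ => by positivity)
    have h4 : ∑ k ∈ Finset.range (m+1), q ^ (m-k) * x k * x m ≤ 
        ∑ k ∈ Finset.range (m+1), (1/2 * (x k ^ 2 * q ^ (m - k)) + 1/2 * (x m ^ 2 * q ^ (m-k))) := by
      refine Finset.sum_le_sum fun k _ => ?_
      have : 0 ≤ q ^ (m-k) := by positivity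
      nlinarith [mul_nonneg this (sq_nonneg (x k - x m))]
    rw [Finset.sum_add_distrib, ← Finset.mul_sum, ← Finset.mul_sum, ← Finset.mul_sum] at h4
    have h5 := mul_le_mul_of_nonneg_left h3 (sq_nonneg (x m))
    linarith
  have := hasSum_le hle (SS_hasSum (n+1)) htot
  linarith

lemma fact_prod (m : ℕ) : (∏ i ∈ Finset.range m, (2 * (i:ℝ) + 1) / (2 * i + 2)) / ((2*m).factorial : ℝ)
    = 1 / (4 ^ m * (m.factorial : ℝ) ^ 2) := by
  induction m with
  | zero => simp
  | succ m ih =>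
    rw [Finset.prod_range_succ, show 2 * (m+1) = (2*m+1)+1 by ring, Nat.factorial_succ, Nat.factorial_succ,
      Nat.factorial_succ]
    push_cast
    have h1 : ((2*m).factorial : ℝ) ≠ 0 := by positivity
    have h2 : (m.factorial : ℝ) ≠ 0 := by positivity
    have h3 : (m:ℝ) + 1 ≠ 0 := by positivity
    have h4 : 2 * (m:ℝ) + 1 ≠ 0 := by positivity
    have ih' : (∏ i ∈ Finset.range m, (2 * (i:ℝ) + 1) / (2 * i + 2)) = 1 / (4 ^ m * (m.factorial : ℝ) ^ 2) * ((2*m).factorial : ℝ) := by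
      rw [← ih]; field_simp
    rw [ih']
    field_simp
    ring

lemma FF_integral (x : ℝ) : Real.pi * FF (x^2/4) = ∫ θ in (0:ℝ)..Real.pi, Real.cosh (x * Real.sin θ) := by
  have h := intervalIntegral.hasSum_integral_of_dominated_convergence (a := 0) (b := Real.pi)
    (μ := MeasureTheory.volume)
    (F := fun (m : ℕ) θ => (x * Real.sin θ)^(2*m) / ((2*m).factorial : ℝ))
    (f := fun θ => Real.cosh (x * Real.sin θ))
    (fun (m : ℕ) _ => x^(2*m) / ((2*m).factorial : ℝ))
    (fun m => by fun_prop)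
    (fun m => Eventually.of_forall fun θ _ => by
      rw [Real.norm_eq_abs, abs_of_nonneg (div_nonneg (by rw [pow_mul]; positivity) (by positivity))]
      gcongr ?_ / _
      rw [mul_pow, pow_mul (Real.sin θ), pow_mul x]
      exact mul_le_of_le_one_right (by positivity) (pow_le_one₀ (sq_nonneg _) (Real.sin_sq_le_one θ)))
    (Eventually.of_forall fun θ _ => (Real.hasSum_cosh x).summable)
    (by simp)
    (Eventually.of_forall fun θ _ => Real.hasSum_cosh _)
  rw [← h.tsum_eq, FF, ← tsum_mul_left]
  congr 1
  ext m
  have : ∀ θ : ℝ, (x * Real.sin θ)^(2*m) / ((2*m).factorial : ℝ) = (x^(2*m) / ((2*m).factorial : ℝ)) * Real.sin θ ^ (2*m) := by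
    intro θ; rw [mul_pow]; ring
  simp only [this]
  rw [intervalIntegral.integral_const_mul, integral_sin_pow_even]
  have h2 := fact_prod m
  calc _ = x^(2*m) * Real.pi * (1 / (4 ^ m * (m.factorial : ℝ) ^ 2)) := by
        rw [div_pow, ← pow_mul]; field_simp
    _ = _ := by rw [← h2]; ring

noncomputable def KK (c u : ℝ) : ℝ := 
  Set.indicator (Set.Ioc (-(c * (Real.pi/2))) (c * (Real.pi/2)))
    (fun u => Real.exp (-c^2) * Real.cosh (c^2 * Real.cos (u/c))) u

lemma KK_integral {c : ℝ} (hc : 0 < c) : 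
    ∫ u, KK c u = c * Real.exp (-c^2) * (Real.pi * FF (c^4/4)) := by
  have hp := Real.pi_pos
  unfold KK
  rw [MeasureTheory.integral_indicator measurableSet_Ioc, 
    ← intervalIntegral.integral_of_le (by nlinarith [mul_pos hc hp]),
    intervalIntegral.integral_const_mul,
    intervalIntegral.integral_comp_div (fun v => Real.cosh (c^2 * Real.cos v)) hc.ne',
    show c^4/4 = (c^2)^2/4 by ring, FF_integral]
  have h := intervalIntegral.integral_comp_add_right (a := -(Real.pi/2)) (b := Real.pi/2) 
    (fun v => Real.cosh (c^2 * Real.sin v)) (Real.pi/2)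
  simp only [Real.sin_add_pi_div_two] at h
  rw [show -(Real.pi/2) + Real.pi/2 = 0 by ring, show Real.pi/2 + Real.pi/2 = Real.pi by ring] at h
  rw [← h, neg_div, mul_div_cancel_left₀ _ hc.ne', smul_eq_mul]
  ring

lemma KK_bound {c : ℝ} (hc : 0 < c) (u : ℝ) : ‖KK c u‖ ≤ Real.exp (-(2/Real.pi^2) * u^2) := by
  unfold KK
  by_cases hu : u ∈ Set.Ioc (-(c * (Real.pi/2))) (c * (Real.pi/2))
  · rw [Set.indicator_of_mem hu]
    have hp := Real.pi_pos
    have h1 : |u/c| ≤ Real.pi/2 := by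
      rw [abs_div, abs_of_pos hc, div_le_iff₀ hc, mul_comm, abs_le]
      exact ⟨hu.1.le, hu.2⟩
    have hcos : 0 ≤ Real.cos (u/c) := Real.cos_nonneg_of_mem_Icc (by rw [abs_le] at h1; exact h1)
    have hb := Real.cos_le_one_sub_mul_cos_sq (h1.trans (by linarith))
    have hy : 0 ≤ c^2 * Real.cos (u/c) := by positivity
    have hch : Real.cosh (c^2 * Real.cos (u/c)) ≤ Real.exp (c^2 * Real.cos (u/c)) := by
      rw [Real.cosh_eq]
      have : Real.exp (-(c^2 * Real.cos (u/c))) ≤ Real.exp (c^2 * Real.cos (u/c)) := 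
        Real.exp_le_exp.2 (by linarith)
      linarith
    rw [Real.norm_eq_abs, abs_of_pos (mul_pos (Real.exp_pos _) (Real.cosh_pos _))]
    calc _ ≤ Real.exp (-c^2) * Real.exp (c^2 * Real.cos (u/c)) := by gcongr
      _ = Real.exp (-c^2 + c^2 * Real.cos (u/c)) := (Real.exp_add _ _).symm
      _ ≤ _ := by
        apply Real.exp_le_exp.2
        have := mul_le_mul_of_nonneg_left hb (sq_nonneg c)
        have e : c^2 * (1 - 2 / Real.pi ^ 2 * (u/c) ^ 2) = c^2 - 2/Real.pi^2 * u^2 := by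
          field_simp
        linarith
  · rw [Set.indicator_of_notMem hu]
    simpa using (Real.exp_pos _).le

lemma KK_lim (u : ℝ) : Tendsto (fun c => KK c u) atTop (nhds (1/2 * Real.exp (-(1/2) * u^2))) := by
  have hinv : Tendsto (fun c : ℝ => (c^2)⁻¹) atTop (nhds 0) := 
    tendsto_inv_atTop_zero.comp (tendsto_pow_atTop (by norm_num))
  have hev : ∀ᶠ c : ℝ in atTop, 0 < c ∧ |u/c| ≤ 1 := by
    filter_upwards [eventually_gt_atTop 0, eventually_ge_atTop |u|] with c h0 h1
    refine ⟨h0, ?_⟩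
    rw [abs_div, abs_of_pos h0, div_le_one h0]; exact h1
  have hcosu : Tendsto (fun c : ℝ => c^2 * (Real.cos (u/c) - 1)) atTop (nhds (-(1/2) * u^2)) := by
    rw [tendsto_iff_norm_sub_tendsto_zero]
    refine squeeze_zero' (Eventually.of_forall fun _ => norm_nonneg _) ?_ 
      (by simpa using hinv.const_mul (u^4 * (5/96)))
    filter_upwards [hev] with c ⟨h0, h1⟩
    have hb := Real.cos_bound h1
    have e : c^2 * (Real.cos (u/c) - 1) - (-(1/2) * u^2) = c^2 * (Real.cos (u/c) - (1 - (u/c)^2/2)) := by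
      field_simp; ring
    rw [e, Real.norm_eq_abs, abs_mul, abs_of_pos (by positivity : 0 < c^2)]
    refine (mul_le_mul_of_nonneg_left hb (by positivity)).trans (le_of_eq ?_)
    rw [show |u/c|^4 = (u/c)^4 from Even.pow_abs (by decide) _]
    field_simp
  have h1 := (Real.continuous_exp.tendsto _).comp hcosu
  have h2 : Tendsto (fun c : ℝ => Real.exp (-(c^2 * (1 + Real.cos (u/c))))) atTop (nhds 0) := by
    apply Real.tendsto_exp_neg_atTop_nhds_zero.comp
    apply tendsto_atTop_mono' atTop (f₁ := fun c : ℝ => c^2) _ (tendsto_pow_atTop (by norm_num))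
    filter_upwards [hev] with c ⟨h0, h1⟩
    have : 0 ≤ Real.cos (u/c) := Real.cos_nonneg_of_mem_Icc (by
      rw [abs_le] at h1; constructor <;> linarith [Real.pi_gt_three])
    nlinarith [mul_nonneg (sq_nonneg c) this]
  have h3 := (h1.add h2).const_mul (1/2)
  rw [add_zero] at h3
  refine h3.congr' ?_
  filter_upwards [hev, eventually_gt_atTop |u|] with c ⟨h0, h1⟩ h4
  unfold KK
  rw [Set.indicator_of_mem, Real.cosh_eq]
  · simp only [Function.comp]
    rw [mul_div_assoc', mul_add (Real.exp (-c^2)), ← Real.exp_add, ← Real.exp_add]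
    ring_nf
  · have := abs_lt.1 h4
    have hp := Real.pi_gt_three
    constructor <;> nlinarith

lemma FF_lim_c : Tendsto (fun c : ℝ => c * Real.exp (-c^2) * (Real.pi * FF (c^4/4))) atTop 
    (nhds (1/2 * √(Real.pi / (1/2)))) := by
  rw [← integral_gaussian, ← MeasureTheory.integral_const_mul]
  have := MeasureTheory.tendsto_integral_filter_of_dominated_convergence (l := atTop) (F := KK)
    (μ := MeasureTheory.volume)
    (f := fun u => 1/2 * Real.exp (-(1/2) * u^2)) (fun u => Real.exp (-(2/Real.pi^2) * u^2))
    (Eventually.of_forall fun c => by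
      unfold KK
      refine Measurable.aestronglyMeasurable (Measurable.indicator ?_ measurableSet_Ioc)
      have : Measurable fun u : ℝ => u / c := measurable_id.div_const c
      exact (Real.measurable_cosh.comp ((Real.measurable_cos.comp this).const_mul _)).const_mul _)
    (by
      filter_upwards [eventually_gt_atTop 0] with c hc
      exact Eventually.of_forall fun u => KK_bound hc u)
    (integrable_exp_neg_mul_sq (by have := Real.pi_pos; positivity))
    (Eventually.of_forall KK_lim)
  refine this.congr' ?_
  filter_upwards [eventually_gt_atTop 0] with c hc
  exact KK_integral hc

lemma FF_equiv : FF ~[atTop] fun t => Real.exp (2 * √t) / (2 * √Real.pi * t ^ ((1:ℝ)/4)) := by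
  apply isEquivalent_of_tendsto_one
  have hp := Real.pi_pos
  have hcl : Tendsto (fun t : ℝ => √2 * t ^ ((1:ℝ)/4)) atTop atTop :=
    (tendsto_rpow_atTop (by norm_num)).const_mul_atTop (by positivity)
  have h := (FF_lim_c.comp hcl).const_mul (√2 / √Real.pi)
  have e1 : √2 / √Real.pi * (1/2 * √(Real.pi / (1/2))) = 1 := by
    rw [show Real.pi / (1/2) = 2 * Real.pi by ring, Real.sqrt_mul (by norm_num)]
    have h2 : √2 * √2 = 2 := Real.mul_self_sqrt (by norm_num)
    have : √Real.pi ≠ 0 := by positivity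
    field_simp
    nlinarith
  rw [e1] at h
  refine h.congr' ?_
  filter_upwards [eventually_gt_atTop 0] with t ht
  have h4 : (t ^ ((1:ℝ)/4))^4 = t := by
    rw [← Real.rpow_natCast, ← Real.rpow_mul ht.le]; norm_num
  have h2 : (t ^ ((1:ℝ)/4))^2 = √t := by
    rw [← Real.rpow_natCast, ← Real.rpow_mul ht.le, Real.sqrt_eq_rpow]; norm_num
  have hs : √2^2 = 2 := Real.sq_sqrt (by norm_num)
  have hs4 : √2^4 = 4 := by rw [show √2^4 = (√2^2)^2 by ring, hs]; norm_num
  have hpp : √Real.pi * √Real.pi = Real.pi := Real.mul_self_sqrt hp.le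
  simp only [Function.comp, Pi.div_apply]
  rw [mul_pow, mul_pow, h4, h2, hs, hs4, show 4 * t / 4 = t by ring, Real.exp_neg]
  have : √Real.pi ≠ 0 := by positivity
  have : t ^ ((1:ℝ)/4) ≠ 0 := by positivity
  generalize t ^ ((1:ℝ)/4) = w at *
  calc _ = √2^2 * w * (Real.exp (2 * √t))⁻¹ * Real.pi / √Real.pi * FF t := by ring
    _ = _ := by rw [hs]; field_simp; rw [Real.sq_sqrt hp.le]

lemma SS_equiv : (fun n : ℕ => SS n) ~[atTop] fun n : ℕ => FF (Real.log (n:ℝ)) := by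
  apply isEquivalent_of_tendsto_one
  have hlog : Tendsto (fun n : ℕ => Real.log (n:ℝ)) atTop atTop :=
    Real.tendsto_log_atTop.comp tendsto_natCast_atTop_atTop
  have hlim : Tendsto (fun n : ℕ => (1 - 1 / √(Real.log (n:ℝ)))⁻¹) atTop (nhds 1) := by
    have h1 : Tendsto (fun n : ℕ => 1 / √(Real.log (n:ℝ))) atTop (nhds 0) := by
      simp only [one_div]
      exact tendsto_inv_atTop_zero.comp (Real.tendsto_sqrt_atTop.comp hlog)
    have := (h1.const_sub 1).inv₀ (by norm_num)
    simpa using this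
  refine tendsto_of_tendsto_of_tendsto_of_le_of_le' tendsto_const_nhds hlim ?_ ?_
  · filter_upwards [hlog.eventually_gt_atTop 1, eventually_ge_atTop 1] with n h1 h2
    obtain ⟨j, rfl⟩ := Nat.exists_eq_add_of_le' h2
    rw [Pi.div_apply, one_le_div (FF_pos (by linarith))]
    simpa using SS_lower j
  · filter_upwards [hlog.eventually_gt_atTop 1, eventually_ge_atTop 1] with n h1 h2
    obtain ⟨j, rfl⟩ := Nat.exists_eq_add_of_le' h2
    rw [Pi.div_apply, div_le_iff₀ (FF_pos (by linarith)), mul_comm]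
    push_cast at h1 ⊢
    exact SS_upper j h1

/-- As `n → ∞`, `∑_{k=1}^{n} C(n,k)(−1)^k e^{1/k} ~ −e^{2√(log n)}/(2√π (log n)^{1/4})`. -/
theorem differences_exp_inv_asymp :
    (fun n : ℕ => ∑ k ∈ Finset.Icc 1 n,
        (n.choose k : ℝ) * (-1 : ℝ) ^ k * Real.exp (1 / (k : ℝ)))
      ~[atTop] fun n : ℕ =>
        -(Real.exp (2 * Real.sqrt (Real.log (n : ℝ))) /
          (2 * Real.sqrt Real.pi * Real.log (n : ℝ) ^ ((1 : ℝ) / 4))) := by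
  have hlog : Tendsto (fun n : ℕ => Real.log (n:ℝ)) atTop atTop :=
    Real.tendsto_log_atTop.comp tendsto_natCast_atTop_atTop
  have h := (SS_equiv.trans (FF_equiv.comp_tendsto hlog)).neg
  have e : (fun n : ℕ => - SS n) = fun n : ℕ => ∑ k ∈ Finset.Icc 1 n,
        (n.choose k : ℝ) * (-1 : ℝ) ^ k * Real.exp (1 / (k : ℝ)) := by
    ext n; simp [SS]
  rw [← e]
  exact h
end
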